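/- arXiv:2111.07381 — 2 statements merged into one kernel-verified Lean document; each statement's English description precedes it below -/
import Mathlib

section
/- Commutator estimate for the modified low×high paraproduct (Corollary 2.12). Let s, r, r′, σ ∈ ℝ satisfy 0 < s < 1, 0 < r′ < r < 1, r′ + s > 1, 0 < σ < 1, and (1−σ)(1−r′−s) + r − s − σ < 0. Then there is a constant C, depending only on these parameters, such that for all C_b^∞ functions F, G, H: ℝ² → ℝ and every finite set S of dyadic scales, ‖Σ_{M∈S} [ F·(P_{≤M^{1−σ}}^u G)·(P_M^u H) − (P_{≤M^{1−σ}}^u (F·G))·(P_M^u H) ]‖_{C_u^{r−1}C_v^{r−1}} ≤ C ‖F‖_{C_u^{s}C_v^{1−r′}} ‖G‖_{C_u^{1−r′}C_v^{r−1}} ‖H‖_{C_u^{s−1+σ}C_v^{1−r′}}. -/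
noncomputable section

open Real MeasureTheory
open scoped ENNReal Classical NNReal

/-- A function between real normed spaces is `C_b^∞`: it is smooth and it together with all of
its iterated derivatives is bounded. -/
def CbSmooth {E F : Type*} [NormedAddCommGroup E] [NormedSpace ℝ E]
    [NormedAddCommGroup F] [NormedSpace ℝ F] (f : E → F) : Prop :=
  ContDiff ℝ (⊤ : ℕ∞) f ∧ ∀ n : ℕ, ∃ C : ℝ, ∀ x : E, ‖iteratedFDeriv ℝ n f x‖ ≤ C

/-- An admissible Littlewood–Paley cutoff: a smooth even `[0,1]`-valued function which is `≡ 1`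
on `{|ξ| ≤ 7/8}` and vanishes on `{|ξ| ≥ 9/8}`. -/
structure IsLPCutoff (ρ : ℝ → ℝ) : Prop where
  smooth : ContDiff ℝ (⊤ : ℕ∞) ρ
  nonneg : ∀ ξ, 0 ≤ ρ ξ
  le_one : ∀ ξ, ρ ξ ≤ 1
  even : ∀ ξ, ρ (-ξ) = ρ ξ
  eq_one : ∀ ξ : ℝ, |ξ| ≤ 7 / 8 → ρ ξ = 1
  eq_zero : ∀ ξ : ℝ, 9 / 8 ≤ |ξ| → ρ ξ = 0

/-- The Littlewood–Paley symbol `ρ_N` at the dyadic scale `N = 2 ^ k`. -/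
def lpSymbol (ρ : ℝ → ℝ) : ℕ → ℝ → ℝ
  | 0 => ρ
  | k + 1 => fun ξ => ρ (ξ / 2 ^ (k + 1)) - ρ (2 * ξ / 2 ^ (k + 1))

/-- The inverse Fourier transform `(2π)^{-1/2} ∫ e^{ixξ} g(ξ) dξ` of a real even function,
written as a cosine transform. -/
def invFourier (g : ℝ → ℝ) (x : ℝ) : ℝ :=
  (Real.sqrt (2 * Real.pi))⁻¹ * ∫ ξ : ℝ, Real.cos (x * ξ) * g ξ

/-- The Littlewood–Paley convolution kernel `ρ̌_N`, `N = 2 ^ k`. -/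
def lpKernel (ρ : ℝ → ℝ) (k : ℕ) : ℝ → ℝ :=
  invFourier (lpSymbol ρ k)

/-- The Littlewood–Paley projection `P_N f = ρ̌_N ∗ f`, `N = 2 ^ k`. -/
def LP (ρ : ℝ → ℝ) (k : ℕ) (f : ℝ → ℝ) (x : ℝ) : ℝ :=
  ∫ y : ℝ, lpKernel ρ k y * f (x - y)

/-- The Littlewood–Paley projection in the first variable. -/
def LPu (ρ : ℝ → ℝ) (k : ℕ) (F : ℝ × ℝ → ℝ) (p : ℝ × ℝ) : ℝ :=
  ∫ y : ℝ, lpKernel ρ k y * F (p.1 - y, p.2)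

/-- The Littlewood–Paley projection in the second variable. -/
def LPv (ρ : ℝ → ℝ) (k : ℕ) (F : ℝ × ℝ → ℝ) (p : ℝ × ℝ) : ℝ :=
  ∫ y : ℝ, lpKernel ρ k y * F (p.1, p.2 - y)

/-- The Hölder norm `‖f‖_{C^γ} = sup_N N^γ ‖P_N f‖_{L^∞}`, valued in `[0,∞]`. -/
def hNorm (ρ : ℝ → ℝ) (γ : ℝ) (f : ℝ → ℝ) : ℝ≥0∞ :=
  ⨆ k : ℕ, ENNReal.ofReal (((2 : ℝ) ^ k) ^ γ) * ⨆ x : ℝ, ENNReal.ofReal |LP ρ k f x|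

/-- The product Hölder norm `‖F‖_{C_u^{γ₁} C_v^{γ₂}}`, valued in `[0,∞]`. -/
def hNorm2 (ρ : ℝ → ℝ) (γ₁ γ₂ : ℝ) (F : ℝ × ℝ → ℝ) : ℝ≥0∞ :=
  ⨆ k₁ : ℕ, ⨆ k₂ : ℕ,
    ENNReal.ofReal (((2 : ℝ) ^ k₁) ^ γ₁ * ((2 : ℝ) ^ k₂) ^ γ₂) *
      ⨆ p : ℝ × ℝ, ENNReal.ofReal |LPu ρ k₁ (LPv ρ k₂ F) p|

/-- `2 ^ k₁ ∼ 2 ^ k₂`: comparable dyadic scales. -/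
def DClose (k₁ k₂ : ℕ) : Prop :=
  (2 : ℝ) ^ k₂ / 2 ^ 10 < (2 : ℝ) ^ k₁ ∧ (2 : ℝ) ^ k₁ < 2 ^ 10 * (2 : ℝ) ^ k₂

/-- `2 ^ k₁ ≪ 2 ^ k₂`. -/
def DLow (k₁ k₂ : ℕ) : Prop := (2 : ℝ) ^ k₁ ≤ (2 : ℝ) ^ k₂ / 2 ^ 10

/-- `2 ^ k₁ ≳ 2 ^ k₂`. -/
def DGtr (k₁ k₂ : ℕ) : Prop := (2 : ℝ) ^ k₂ ≤ 2 ^ 10 * (2 : ℝ) ^ k₁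

/-- The projection `P_{≤ L}^u = Σ_{dyadic N ≤ L} P_N^u` onto `u`-frequencies below a real
threshold `L`. (The summands vanish for `2 ^ l > L`, so the series is a finite sum.) -/
def LPuLe (ρ : ℝ → ℝ) (L : ℝ) (F : ℝ × ℝ → ℝ) (p : ℝ × ℝ) : ℝ :=
  ∑' l : ℕ, if (2 : ℝ) ^ l ≤ L then LPu ρ l F p else 0

section Part1
open Real MeasureTheory
open scoped ENNReal Classical NNReal
open scoped FourierTransform SchwartzMap ContDiff

lemma rho_compact {ρ : ℝ → ℝ} (hρ : IsLPCutoff ρ) : HasCompactSupport ρ := by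
  refine HasCompactSupport.intro (K := Set.Icc (-(9/8)) (9/8)) isCompact_Icc ?_
  intro x hx
  apply hρ.eq_zero
  by_contra h
  push Not at h
  rw [abs_lt] at h
  exact hx ⟨h.1.le, h.2.le⟩

lemma rho_integrable {ρ : ℝ → ℝ} (hρ : IsLPCutoff ρ) : Integrable ρ :=
  hρ.smooth.continuous.integrable_of_hasCompactSupport (rho_compact hρ)

lemma fourier_rho {ρ : ℝ → ℝ} (hρ : IsLPCutoff ρ) (w : ℝ) :
    𝓕 (fun v => (ρ v : ℂ)) w = ((∫ v, Real.cos (2 * π * w * v) * ρ v : ℝ) : ℂ) := by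
  rw [Real.fourier_real_eq_integral_exp_smul]
  have hi := rho_integrable hρ
  have h1 : Integrable (fun v => Real.cos (2 * π * w * v) * ρ v) := by
    refine hi.bdd_mul (c := 1) (by fun_prop) ?_
    exact Filter.Eventually.of_forall fun v => by simpa using Real.abs_cos_le_one _
  have h2 : Integrable (fun v => Real.sin (2 * π * w * v) * ρ v) := by
    refine hi.bdd_mul (c := 1) (by fun_prop) ?_
    exact Filter.Eventually.of_forall fun v => by simpa using Real.abs_sin_le_one _
  have h3 : ∫ v, Real.sin (2 * π * w * v) * ρ v = 0 := by
    have := integral_neg_eq_self (fun v => Real.sin (2 * π * w * v) * ρ v) volume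
    simp only [mul_neg, Real.sin_neg, hρ.even, neg_mul, integral_neg] at this
    linarith
  have : ∀ v : ℝ, Complex.exp (↑(-2 * π * v * w) * Complex.I) • (ρ v : ℂ)
      = ((Real.cos (2 * π * w * v) * ρ v : ℝ) : ℂ)
        - ((Real.sin (2 * π * w * v) * ρ v : ℝ) : ℂ) * Complex.I := by
    intro v
    rw [Complex.exp_mul_I, ← Complex.ofReal_cos, ← Complex.ofReal_sin]
    have e : -2 * π * v * w = - (2 * π * w * v) := by ring
    rw [e, Real.cos_neg, Real.sin_neg]
    push_cast
    simp only [smul_eq_mul]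
    ring
  simp_rw [this]
  rw [integral_sub, integral_mul_const, integral_complex_ofReal, integral_complex_ofReal, h3]
  · simp
  · exact h1.ofReal
  · exact h2.ofReal.mul_const _

/-- the cutoff as a Schwartz function -/
def rhoS {ρ : ℝ → ℝ} (hρ : IsLPCutoff ρ) : 𝓢(ℝ, ℂ) :=
  HasCompactSupport.toSchwartzMap (f := fun v => (ρ v : ℂ))
    ((rho_compact hρ).comp_left (g := fun x : ℝ => (x : ℂ)) (by simp))
    (Complex.ofRealCLM.contDiff.comp hρ.smooth)

lemma rhoS_coe {ρ : ℝ → ℝ} (hρ : IsLPCutoff ρ) : (rhoS hρ : ℝ → ℂ) = fun v => (ρ v : ℂ) := rfl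

lemma invF_eq {ρ : ℝ → ℝ} (hρ : IsLPCutoff ρ) (x : ℝ) :
    ((invFourier ρ x : ℝ) : ℂ) = ((√(2 * π))⁻¹ : ℝ) * (𝓕 (rhoS hρ)) ((2 * π)⁻¹ * x) := by
  rw [SchwartzMap.fourier_coe, rhoS_coe, fourier_rho hρ, invFourier, ← Complex.ofReal_mul]
  congr 3
  ext v
  congr 2
  field_simp

lemma invF_re {ρ : ℝ → ℝ} (hρ : IsLPCutoff ρ) :
    invFourier ρ = fun x => (√(2 * π))⁻¹ * ((𝓕 (rhoS hρ)) ((2 * π)⁻¹ * x)).re := by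
  ext x
  have := congrArg Complex.re (invF_eq hρ x)
  rw [Complex.ofReal_re, Complex.re_ofReal_mul] at this
  exact this

lemma inversion {ρ : ℝ → ℝ} (hρ : IsLPCutoff ρ) (ξ : ℝ) :
    ∫ y, invFourier ρ y * Real.cos (y * ξ) = √(2 * π) * ρ ξ := by
  have hinv : 𝓕⁻ (𝓕 (rhoS hρ : ℝ → ℂ)) ξ = (ρ ξ : ℂ) := by
    rw [Continuous.fourierInv_fourier_eq (rhoS hρ).continuous (rhoS hρ).integrable]
    · rfl
    · rw [← SchwartzMap.fourier_coe]; exact (𝓕 (rhoS hρ)).integrable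
  rw [Real.fourierInv_eq_fourier_neg, Real.fourier_real_eq_integral_exp_smul] at hinv
  have hre := congrArg Complex.re hinv
  have hInt : Integrable (𝓕 (rhoS hρ : ℝ → ℂ)) := by
    rw [← SchwartzMap.fourier_coe]; exact (𝓕 (rhoS hρ)).integrable
  have hI : Integrable (fun v : ℝ => Complex.exp (↑(-2 * π * v * -ξ) * Complex.I) •
      𝓕 (rhoS hρ : ℝ → ℂ) v) := by
    simp only [smul_eq_mul]
    refine hInt.bdd_mul (c := 1) (by fun_prop) ?_
    exact Filter.Eventually.of_forall fun v => by
      rw [Complex.norm_exp_ofReal_mul_I]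
  have h4 : ∫ v : ℝ, Real.cos (2 * π * v * ξ) * (𝓕 (rhoS hρ : ℝ → ℂ) v).re = ρ ξ := by
    rw [Complex.ofReal_re] at hre
    rw [← hre]
    have := integral_re hI
    simp only [RCLike.re_eq_complex_re] at this
    rw [← this]
    congr 1
    ext v
    rw [rhoS_coe, fourier_rho hρ, smul_eq_mul, mul_comm (Complex.exp _), Complex.re_ofReal_mul,
      Complex.exp_ofReal_mul_I_re, Complex.ofReal_re, mul_comm]
    congr 2
    ring
  rw [invF_re hρ]
  have h5 := Measure.integral_comp_mul_left
    (fun v : ℝ => Real.cos (2 * π * v * ξ) * (𝓕 (rhoS hρ : ℝ → ℂ) v).re) (2 * π)⁻¹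
  rw [h4, inv_inv, abs_of_pos (by positivity), smul_eq_mul] at h5
  have h6 : ∀ y : ℝ, (√(2 * π))⁻¹ * ((𝓕 (rhoS hρ)) ((2 * π)⁻¹ * y)).re * Real.cos (y * ξ)
     = (√(2 * π))⁻¹ * (Real.cos (2 * π * ((2 * π)⁻¹ * y) * ξ) *
        (𝓕 (rhoS hρ : ℝ → ℂ) ((2 * π)⁻¹ * y)).re) := by
    intro y
    rw [SchwartzMap.fourier_coe, mul_inv_cancel_left₀ (by positivity)]
    ring
  simp_rw [h6]
  rw [integral_const_mul, h5]
  have : √(2 * π) * √(2 * π) = 2 * π := Real.mul_self_sqrt (by positivity)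
  have h7 : 0 < √(2 * π) := by positivity
  field_simp
  rw [pow_two, this]

/-- Quantitative decay of the basic kernel and its derivative. -/
lemma kernel_decay {ρ : ℝ → ℝ} (hρ : IsLPCutoff ρ) :
    ∃ C : ℝ, 0 < C ∧ Differentiable ℝ (invFourier ρ) ∧
      (∀ x, |invFourier ρ x| ≤ C * (1 + |x|) ^ (-(4 : ℝ))) ∧
      (∀ x, |deriv (invFourier ρ) x| ≤ C * (1 + |x|) ^ (-(4 : ℝ))) := by
  set Φ := 𝓕 (rhoS hρ) with hΦ
  set a : ℝ := (√(2 * π))⁻¹ with ha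
  set b : ℝ := (2 * π)⁻¹ with hb
  have ha0 : 0 < a := by positivity
  have hb0 : 0 < b := by positivity
  have key : ∀ n : ℕ, ∃ C : ℝ, 0 < C ∧ ∀ x : ℝ, ‖iteratedFDeriv ℝ n Φ x‖ * (1 + |x / b|) ^ 4 ≤ C := by
    intro n
    obtain ⟨C0, h0, H0⟩ := Φ.decay 0 n
    obtain ⟨C4, h4, H4⟩ := Φ.decay 4 n
    refine ⟨8 * (C0 + C4 / b ^ 4), by positivity, fun x => ?_⟩
    have e1 := H0 x
    have e2 := H4 x
    rw [pow_zero, one_mul] at e1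
    rw [Real.norm_eq_abs] at e2
    set y := |x| / b
    have hy : 0 ≤ y := by positivity
    have : |x / b| = y := by rw [abs_div, abs_of_pos hb0]
    rw [this]
    have h3 : (1 + y) ^ 4 ≤ 8 * (1 + y ^ 4) := by
      nlinarith [sq_nonneg (y - 1), sq_nonneg (y^2 - 1), sq_nonneg (y^2-y), mul_nonneg hy (sq_nonneg (y-1)), mul_nonneg (mul_nonneg hy hy) (sq_nonneg (y-1))]
    have h5 : y ^ 4 * ‖iteratedFDeriv ℝ n Φ x‖ ≤ C4 / b ^ 4 := by
      rw [le_div_iff₀ (by positivity)]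
      calc _ = |x| ^ 4 * ‖iteratedFDeriv ℝ n Φ x‖ := by simp only [y]; field_simp
        _ ≤ _ := e2
    calc _ ≤ ‖iteratedFDeriv ℝ n Φ x‖ * (8 * (1 + y ^ 4)) := by gcongr
      _ = 8 * (‖iteratedFDeriv ℝ n Φ x‖ + y ^ 4 * ‖iteratedFDeriv ℝ n Φ x‖) := by ring
      _ ≤ _ := by gcongr
  obtain ⟨C0, h0, H0⟩ := key 0
  obtain ⟨C1, h1, H1⟩ := key 1
  have hder : ∀ x, HasDerivAt (invFourier ρ) (a * ((b • deriv Φ (b * x)).re)) x := by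
    intro x
    rw [invF_re hρ]
    apply HasDerivAt.const_mul
    have hd : HasDerivAt Φ (deriv Φ (b * x)) (b * x) := Φ.differentiableAt.hasDerivAt
    have hm : HasDerivAt (fun x : ℝ => b * x) b x := by simpa using (hasDerivAt_id x).const_mul b
    have := HasDerivAt.scomp x hd hm
    exact (Complex.reCLM.hasFDerivAt.comp_hasDerivAt x this)
  refine ⟨a * C0 + a * b * C1, by positivity, fun x => (hder x).differentiableAt, ?_, ?_⟩
  · intro x
    have e := H0 (b * x)
    rw [norm_iteratedFDeriv_zero, mul_div_cancel_left₀ _ hb0.ne'] at e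
    rw [Real.rpow_neg (by positivity), ← div_eq_mul_inv, le_div_iff₀ (by positivity)]
    have : (1 + |x|) ^ (4 : ℝ) = (1 + |x|) ^ 4 := by norm_cast
    rw [this, invF_re hρ]
    simp only [abs_mul]
    rw [abs_of_pos ha0]
    have h2 := Complex.abs_re_le_norm (Φ (b * x))
    calc _ ≤ a * ‖Φ (b * x)‖ * (1 + |x|) ^ 4 := by gcongr
      _ = a * (‖Φ (b * x)‖ * (1 + |x|) ^ 4) := by ring
      _ ≤ a * C0 := by gcongr
      _ ≤ _ := by have : 0 < a * b * C1 := by positivity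
                  linarith
  · intro x
    have e := H1 (b * x)
    rw [norm_iteratedFDeriv_one, ← norm_deriv_eq_norm_fderiv, mul_div_cancel_left₀ _ hb0.ne'] at e
    rw [Real.rpow_neg (by positivity), ← div_eq_mul_inv, le_div_iff₀ (by positivity)]
    have : (1 + |x|) ^ (4 : ℝ) = (1 + |x|) ^ 4 := by norm_cast
    rw [this, (hder x).deriv, abs_mul, abs_of_pos ha0]
    have h2 := Complex.abs_re_le_norm (b • deriv Φ (b * x))
    rw [norm_smul, Real.norm_eq_abs, abs_of_pos hb0] at h2
    calc _ ≤ a * (b * ‖deriv Φ (b * x)‖) * (1 + |x|) ^ 4 := by gcongr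
      _ = a * b * (‖deriv Φ (b * x)‖ * (1 + |x|) ^ 4) := by ring
      _ ≤ a * b * C1 := by gcongr
      _ ≤ _ := by have : 0 < a * C0 := by positivity
                  linarith

end Part1

section Part2
open Real MeasureTheory
open scoped ENNReal Classical NNReal

/-- Bounded continuous functions. -/
def BC {E : Type*} [TopologicalSpace E] (f : E → ℝ) : Prop :=
  Continuous f ∧ ∃ C : ℝ, ∀ x, |f x| ≤ C

lemma BC.integrable {k f : ℝ → ℝ} (hk : Integrable k) (hf : BC f) :
    Integrable (fun y => k y * f y) := by
  obtain ⟨C, hC⟩ := hf.2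
  exact hk.mul_bdd (c := C) hf.1.aestronglyMeasurable
    (Filter.Eventually.of_forall fun v => by simpa using hC v)

lemma swapInt {k₁ k₂ : ℝ → ℝ} (h₁ : Integrable k₁) (h₂ : Integrable k₂) {B : ℝ × ℝ → ℝ}
    (hB : BC B) :
    ∫ x, k₁ x * ∫ y, k₂ y * B (x, y) = ∫ y, k₂ y * ∫ x, k₁ x * B (x, y) := by
  obtain ⟨C, hC⟩ := hB.2
  have hInt : Integrable (fun p : ℝ × ℝ => (k₁ p.1 * k₂ p.2) * B p)
      ((volume : Measure ℝ).prod volume) :=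
    (h₁.mul_prod h₂).mul_bdd (c := C) hB.1.aestronglyMeasurable
      (Filter.Eventually.of_forall fun v => by simpa using hC v)
  have := integral_integral_swap (f := fun x y => (k₁ x * k₂ y) * B (x, y)) (μ := volume)
    (ν := volume) hInt
  calc _ = ∫ x, ∫ y, (k₁ x * k₂ y) * B (x, y) := by
        congr 1; ext x; rw [← integral_const_mul]; congr 1; ext y; ring
    _ = _ := this
    _ = _ := by
        congr 1; ext x; rw [← integral_const_mul]; congr 1; ext y; ring

/-- Rescaled kernel. -/
def kap (ρ : ℝ → ℝ) (k : ℕ) (x : ℝ) : ℝ := 2 ^ k * invFourier ρ (2 ^ k * x)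

/-- The Littlewood–Paley kernels as differences. -/
def dker (κ : ℕ → ℝ → ℝ) : ℕ → ℝ → ℝ
  | 0 => κ 0
  | k + 1 => fun x => κ (k + 1) x - κ k x

/-- All facts about the kernels that are used. -/
structure KP (κ : ℕ → ℝ → ℝ) (c C : ℝ) : Prop where
  cont : ∀ k, Continuous (κ k)
  c_pos : 0 < c
  C_pos : 0 < C
  integ : ∀ k, Integrable (κ k)
  wint : ∀ k (α : ℝ), 0 ≤ α → α ≤ 1 → Integrable (fun x => |κ k x| * |x| ^ α)
  wbd : ∀ k (α : ℝ), 0 ≤ α → α ≤ 1 → ∫ x, |κ k x| * |x| ^ α ≤ C * ((2 : ℝ) ^ k) ^ (-α)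
  dint : ∀ k (α h : ℝ), 0 ≤ α → α ≤ 1 → Integrable (fun x => |κ k (x + h) - κ k x| * |x| ^ α)
  dbd : ∀ k (α h : ℝ), 0 ≤ α → α ≤ 1 →
    ∫ x, |κ k (x + h) - κ k x| * |x| ^ α ≤ C * ((2 : ℝ) ^ k) ^ (-α) * (2 ^ k * |h|)
  mass : ∀ k, ∫ x, κ k x = c
  rep : ∀ a b, b < a → ∀ x, ∫ y, κ a y * κ b (x - y) = c * κ b x
  tends : ∀ f : ℝ → ℝ, BC f → ∀ x,
    Filter.Tendsto (fun n => ∫ y, κ n y * f (x - y)) Filter.atTop (nhds (c * f x))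

lemma invF_even (ρ : ℝ → ℝ) (x : ℝ) : invFourier ρ (-x) = invFourier ρ x := by
  simp [invFourier]

lemma kap_eq (ρ : ℝ → ℝ) (k : ℕ) : kap ρ k = invFourier (fun ξ => ρ (ξ / 2 ^ k)) := by
  ext x
  unfold kap invFourier
  have := Measure.integral_comp_mul_left (fun v : ℝ => Real.cos (2 ^ k * x * v) * ρ v)
    ((2 : ℝ) ^ k)⁻¹
  rw [inv_inv, abs_of_pos (by positivity), smul_eq_mul] at this
  rw [mul_left_comm, ← this]
  congr 2
  ext ξ
  congr 2 <;> field_simp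

lemma lpKernel_eq {ρ : ℝ → ℝ} (hρ : IsLPCutoff ρ) (k : ℕ) : lpKernel ρ k = dker (kap ρ) k := by
  have hInt : ∀ (k : ℕ) (x : ℝ), Integrable (fun ξ => Real.cos (x * ξ) * ρ (ξ / 2 ^ k)) := by
    intro k x
    refine ((rho_integrable hρ).comp_div (by positivity)).bdd_mul (c := 1) (by fun_prop) ?_
    exact Filter.Eventually.of_forall fun v => by simpa using Real.abs_cos_le_one _
  cases k with
  | zero =>
    simp only [dker, kap_eq]
    unfold lpKernel lpSymbol
    simp
  | succ k =>
    ext x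
    simp only [dker, kap_eq]
    unfold lpKernel lpSymbol invFourier
    rw [← mul_sub, ← integral_sub (hInt _ _) (hInt _ _)]
    congr 2
    ext ξ
    have e : 2 * ξ / 2 ^ (k + 1) = ξ / 2 ^ k := by rw [pow_succ]; field_simp
    rw [mul_sub, e]

lemma rpow_le_one_add {x α : ℝ} (h0 : 0 ≤ α) (h1 : α ≤ 1) : |x| ^ α ≤ 1 + |x| := by
  rcases le_total |x| 1 with h | h
  · have := Real.rpow_le_one (abs_nonneg x) h h0
    linarith [abs_nonneg x]
  · calc |x| ^ α ≤ |x| ^ (1 : ℝ) := Real.rpow_le_rpow_of_exponent_le h h1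
      _ = |x| := Real.rpow_one _
      _ ≤ _ := by linarith

lemma int3 : Integrable (fun x : ℝ => (1 + |x|) ^ (-(3 : ℝ))) := by
  have := integrable_one_add_norm (E := ℝ) (μ := volume) (r := 3) (by simp)
  simpa using this

lemma base_pkg {ρ : ℝ → ℝ} (hρ : IsLPCutoff ρ) :
    ∃ C : ℝ, 0 < C ∧ Continuous (invFourier ρ) ∧
      Integrable (fun x => |invFourier ρ x| * (1 + |x|)) ∧
      ∫ x, |invFourier ρ x| * (1 + |x|) ≤ C ∧
      ∀ h : ℝ, Integrable (fun x => |invFourier ρ (x + h) - invFourier ρ x| * (1 + |x|)) ∧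
        ∫ x, |invFourier ρ (x + h) - invFourier ρ x| * (1 + |x|) ≤ C * |h| := by
  obtain ⟨C, C0, hd, h0, h1⟩ := kernel_decay hρ
  set κ := invFourier ρ
  have hc : Continuous κ := hd.continuous
  set I := ∫ x : ℝ, (1 + |x|) ^ (-(3 : ℝ)) with hI
  have I0 : 0 ≤ I := integral_nonneg fun x => by positivity
  have e34 : ∀ x : ℝ, (1 + |x|) ^ (-(4 : ℝ)) * (1 + |x|) = (1 + |x|) ^ (-(3 : ℝ)) := by
    intro x
    rw [← Real.rpow_add_one (by positivity)]; norm_num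
  have b0 : ∀ x, |κ x| * (1 + |x|) ≤ C * (1 + |x|) ^ (-(3 : ℝ)) := by
    intro x
    calc _ ≤ C * (1 + |x|) ^ (-(4 : ℝ)) * (1 + |x|) := by gcongr; exact h0 x
      _ = _ := by rw [mul_assoc, e34]
  have i0 : Integrable (fun x => |κ x| * (1 + |x|)) := by
    refine (int3.const_mul C).mono' (by fun_prop) (Filter.Eventually.of_forall fun x => ?_)
    rw [Real.norm_eq_abs, abs_of_nonneg (by positivity)]
    exact b0 x
  have B0 : ∫ x, |κ x| * (1 + |x|) ≤ C * I := by
    rw [hI, ← integral_const_mul]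
    exact integral_mono i0 (int3.const_mul C) b0
  have i0h : ∀ h : ℝ, Integrable (fun x => |κ (x + h)| * (1 + |x + h|)) := fun h =>
    i0.comp_add_right h
  have B0h : ∀ h : ℝ, ∫ x, |κ (x + h)| * (1 + |x + h|) ≤ C * I := fun h => by
    rw [integral_add_right_eq_self (fun x => |κ x| * (1 + |x|)) h]; exact B0
  have bd1 : ∀ h x : ℝ, |κ (x + h) - κ x| * (1 + |x|) ≤
      (1 + |h|) * (|κ (x + h)| * (1 + |x + h|)) + |κ x| * (1 + |x|) := by
    intro h x
    have e1 : |κ (x + h) - κ x| ≤ |κ (x + h)| + |κ x| := abs_sub _ _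
    have e2 : |x| ≤ |x + h| + |h| := by
      have := abs_sub (x + h) h
      rwa [add_sub_cancel_right] at this
    have e3 : 1 + |x| ≤ (1 + |h|) * (1 + |x + h|) := by
      nlinarith [abs_nonneg h, abs_nonneg (x + h)]
    calc _ ≤ (|κ (x + h)| + |κ x|) * (1 + |x|) := by gcongr
      _ = |κ (x + h)| * (1 + |x|) + |κ x| * (1 + |x|) := by ring
      _ ≤ |κ (x + h)| * ((1 + |h|) * (1 + |x + h|)) + |κ x| * (1 + |x|) := by gcongr
      _ = _ := by ring
  have ih : ∀ h, Integrable (fun x => |κ (x + h) - κ x| * (1 + |x|)) := by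
    intro h
    refine (((i0h h).const_mul (1 + |h|)).add i0).mono' (by fun_prop)
      (Filter.Eventually.of_forall fun x => ?_)
    rw [Real.norm_eq_abs, abs_of_nonneg (by positivity)]
    exact bd1 h x
  refine ⟨16 * (C * I) + 1, by positivity, hc, i0, by nlinarith, fun h => ⟨ih h, ?_⟩⟩
  rcases le_total 1 |h| with hh | hh
  · have : ∫ x, |κ (x + h) - κ x| * (1 + |x|) ≤ (1 + |h|) * (C * I) + C * I := by
      calc _ ≤ ∫ x, ((1 + |h|) * (|κ (x + h)| * (1 + |x + h|)) + |κ x| * (1 + |x|)) :=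
            integral_mono (ih h) (((i0h h).const_mul (1 + |h|)).add i0) (bd1 h)
        _ = (1 + |h|) * (∫ x, |κ (x + h)| * (1 + |x + h|)) + ∫ x, |κ x| * (1 + |x|) := by
            rw [integral_add ((i0h h).const_mul (1 + |h|)) i0, integral_const_mul]
        _ ≤ _ := by gcongr; exact B0h h
    have : 0 ≤ C * I := by positivity
    nlinarith
  · have bd2 : ∀ x, |κ (x + h) - κ x| * (1 + |x|) ≤ 16 * C * |h| * (1 + |x|) ^ (-(3 : ℝ)) := by
      intro x
      have hseg : ∀ z ∈ segment ℝ x (x + h), ‖deriv κ z‖ ≤ 16 * C * (1 + |x|) ^ (-(4 : ℝ)) := by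
        intro z hz
        rw [segment_eq_image'] at hz
        obtain ⟨θ, ⟨t0, t1⟩, rfl⟩ := hz
        simp only [add_sub_cancel_left, smul_eq_mul]
        rw [Real.norm_eq_abs]
        refine (h1 _).trans ?_
        have e1 : |x| ≤ |x + θ * h| + |θ * h| := by
          have := abs_sub (x + θ * h) (θ * h)
          rwa [add_sub_cancel_right] at this
        have e2 : |θ * h| ≤ 1 := by
          rw [abs_mul, abs_of_nonneg t0]
          nlinarith [abs_nonneg h]
        have e3 : (1 + |x|) / 2 ≤ 1 + |x + θ * h| := by linarith [abs_nonneg (x + θ * h)]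
        have e4 : (1 + |x + θ * h|) ^ (-(4 : ℝ)) ≤ ((1 + |x|) / 2) ^ (-(4 : ℝ)) :=
          Real.rpow_le_rpow_of_nonpos (by positivity) e3 (by norm_num)
        have e5 : ((1 + |x|) / 2) ^ (-(4 : ℝ)) = 16 * (1 + |x|) ^ (-(4 : ℝ)) := by
          rw [Real.div_rpow (by positivity) (by norm_num)]
          have : (2 : ℝ) ^ (-(4 : ℝ)) = 1 / 16 := by
            rw [Real.rpow_neg (by norm_num)]; norm_num
          rw [this]; ring
        rw [e5] at e4
        calc _ ≤ C * (16 * (1 + |x|) ^ (-(4 : ℝ))) := by gcongr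
          _ = _ := by ring
      have := (convex_segment x (x + h)).norm_image_sub_le_of_norm_deriv_le (f := κ)
        (fun z _ => hd z) hseg (left_mem_segment ℝ x (x + h)) (right_mem_segment ℝ x (x + h))
      rw [add_sub_cancel_left, Real.norm_eq_abs, Real.norm_eq_abs] at this
      calc _ ≤ (16 * C * (1 + |x|) ^ (-(4 : ℝ)) * |h|) * (1 + |x|) := by gcongr
        _ = 16 * C * |h| * ((1 + |x|) ^ (-(4 : ℝ)) * (1 + |x|)) := by ring
        _ = _ := by rw [e34]
    have : ∫ x, |κ (x + h) - κ x| * (1 + |x|) ≤ 16 * C * |h| * I := by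
      rw [hI, ← integral_const_mul]
      exact integral_mono (ih h) (int3.const_mul _) bd2
    nlinarith [abs_nonneg h]

theorem kp_exists {ρ : ℝ → ℝ} (hρ : IsLPCutoff ρ) : ∃ c C : ℝ, KP (kap ρ) c C := by
  obtain ⟨C, C0, hc, i0, B0, hdiff⟩ := base_pkg hρ
  set κ := invFourier ρ with hκ
  have wi : ∀ α : ℝ, 0 ≤ α → α ≤ 1 → Integrable (fun x => |κ x| * |x| ^ α) := by
    intro α h0 h1
    refine i0.mono' ?_ (Filter.Eventually.of_forall fun x => ?_)
    · exact (hc.abs.mul (continuous_abs.rpow_const fun _ => Or.inr h0)).aestronglyMeasurable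
    · rw [Real.norm_eq_abs, abs_of_nonneg (by positivity)]
      gcongr
      exact rpow_le_one_add h0 h1
  have di : ∀ α h : ℝ, 0 ≤ α → α ≤ 1 → Integrable (fun x => |κ (x + h) - κ x| * |x| ^ α) := by
    intro α h h0 h1
    refine (hdiff h).1.mono' ?_ (Filter.Eventually.of_forall fun x => ?_)
    · exact (Continuous.mul (by fun_prop)
        (continuous_abs.rpow_const fun _ => Or.inr h0)).aestronglyMeasurable
    · rw [Real.norm_eq_abs, abs_of_nonneg (by positivity)]
      gcongr
      exact rpow_le_one_add h0 h1
  have integ0 : Integrable κ := by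
    have := wi 0 le_rfl zero_le_one
    simp only [Real.rpow_zero, mul_one] at this
    exact (integrable_norm_iff hc.aestronglyMeasurable).1 (by simpa using this)
  have scal : ∀ (k : ℕ) (α x : ℝ), |x| ^ α = ((2 : ℝ) ^ k) ^ (-α) * |2 ^ k * x| ^ α := by
    intro k α x
    rw [abs_mul, abs_of_pos (by positivity : (0 : ℝ) < 2 ^ k),
      Real.mul_rpow (by positivity) (abs_nonneg _),
      ← mul_assoc, ← Real.rpow_add (by positivity)]
    simp
  have w1 : ∀ (k : ℕ) (α : ℝ), (fun x => |kap ρ k x| * |x| ^ α) =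
      fun x => (2 ^ k * ((2 : ℝ) ^ k) ^ (-α)) * (fun y => |κ y| * |y| ^ α) (2 ^ k * x) := by
    intro k α
    ext x
    simp only [kap]
    rw [abs_mul, abs_of_pos (by positivity : (0 : ℝ) < 2 ^ k), scal k α x]
    ring
  have d1 : ∀ (k : ℕ) (α h : ℝ), (fun x => |kap ρ k (x + h) - kap ρ k x| * |x| ^ α) =
      fun x => (2 ^ k * ((2 : ℝ) ^ k) ^ (-α)) *
        (fun y => |κ (y + 2 ^ k * h) - κ y| * |y| ^ α) (2 ^ k * x) := by
    intro k α h
    ext x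
    simp only [kap]
    rw [← mul_sub, abs_mul, abs_of_pos (by positivity : (0 : ℝ) < 2 ^ k), scal k α x, mul_add]
    ring
  have kint : ∀ k, Integrable (kap ρ k) := fun k =>
    (integ0.comp_mul_left' (by positivity : (2 : ℝ) ^ k ≠ 0)).const_mul _
  have kcos : ∀ (k : ℕ) (ξ : ℝ), ∫ y, kap ρ k y * Real.cos (y * ξ) = √(2 * π) * ρ (ξ / 2 ^ k) := by
    intro k ξ
    have := Measure.integral_comp_mul_left (fun y => κ y * Real.cos (y * (ξ / 2 ^ k)))
      ((2 : ℝ) ^ k)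
    rw [inversion hρ] at this
    rw [abs_of_pos (by positivity), smul_eq_mul, eq_inv_mul_iff_mul_eq₀ (by positivity)] at this
    rw [← this, ← integral_const_mul]
    congr 1
    ext y
    simp only [kap]
    rw [mul_assoc]
    congr 3
    field_simp
  have kmass : ∀ k, ∫ x, kap ρ k x = √(2 * π) := by
    intro k
    have := kcos k 0
    simp only [mul_zero, Real.cos_zero, mul_one, zero_div] at this
    rw [this, hρ.eq_one 0 (by norm_num), mul_one]
  refine ⟨√(2 * π), C, ?_⟩
  refine ⟨fun k => continuous_const.mul (hc.comp (by fun_prop)), by positivity, C0, kint, ?_, ?_, ?_, ?_, kmass, ?_, ?_⟩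
  · intro k α h0 h1
    rw [w1]
    exact ((wi α h0 h1).comp_mul_left' (by positivity)).const_mul _
  · intro k α h0 h1
    rw [w1, integral_const_mul, Measure.integral_comp_mul_left (fun y => |κ y| * |y| ^ α), abs_of_pos (by positivity),
      smul_eq_mul]
    have : ∫ y, |κ y| * |y| ^ α ≤ C := (integral_mono (wi α h0 h1) i0 fun x => by
      dsimp only
      gcongr; exact rpow_le_one_add h0 h1).trans B0
    calc _ = (∫ y, |κ y| * |y| ^ α) * ((2 : ℝ) ^ k) ^ (-α) := by field_simp
      _ ≤ _ := by gcongr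
  · intro k α h h0 h1
    rw [d1]
    exact ((di α _ h0 h1).comp_mul_left' (by positivity)).const_mul _
  · intro k α h h0 h1
    rw [d1, integral_const_mul, Measure.integral_comp_mul_left
      (fun y => |κ (y + 2 ^ k * h) - κ y| * |y| ^ α), abs_of_pos (by positivity),
      smul_eq_mul]
    have : ∫ y, |κ (y + 2 ^ k * h) - κ y| * |y| ^ α ≤ C * |2 ^ k * h| :=
      (integral_mono (di α _ h0 h1) (hdiff _).1 fun x => by
      dsimp only
      gcongr; exact rpow_le_one_add h0 h1).trans (hdiff _).2
    rw [abs_mul, abs_of_pos (by positivity : (0 : ℝ) < 2 ^ k)] at this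
    calc _ = (∫ y, |κ (y + 2 ^ k * h) - κ y| * |y| ^ α) * ((2 : ℝ) ^ k) ^ (-α) := by field_simp
      _ ≤ (C * (2 ^ k * |h|)) * ((2 : ℝ) ^ k) ^ (-α) := by gcongr
      _ = _ := by ring
  · intro a b hab x
    have hρb : Integrable (fun ξ => ρ (ξ / 2 ^ b)) :=
      (rho_integrable hρ).comp_div (by positivity)
    have e1 : ∀ y, kap ρ b y = (√(2 * π))⁻¹ * ∫ ξ, ρ (ξ / 2 ^ b) * Real.cos (y * ξ) := by
      intro y
      rw [kap_eq, invFourier]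
      congr 2
      ext ξ; ring
    have e2 : ∀ ξ, ∫ y, kap ρ a y * Real.cos ((x - y) * ξ)
        = Real.cos (x * ξ) * (√(2 * π) * ρ (ξ / 2 ^ a)) := by
      intro ξ
      have hi1 : Integrable (fun y => kap ρ a y * Real.cos (y * ξ)) :=
        BC.integrable (kint a) ⟨by fun_prop, 1, fun x => Real.abs_cos_le_one _⟩
      have hi2 : Integrable (fun y => kap ρ a y * Real.sin (y * ξ)) :=
        BC.integrable (kint a) ⟨by fun_prop, 1, fun x => Real.abs_sin_le_one _⟩
      have h3 : ∫ y, kap ρ a y * Real.sin (y * ξ) = 0 := by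
        have := integral_neg_eq_self (fun y => kap ρ a y * Real.sin (y * ξ)) volume
        simp only [kap, mul_neg, invF_even, neg_mul, Real.sin_neg, integral_neg] at this
        simp only [kap]
        linarith
      calc _ = ∫ y, (Real.cos (x * ξ) * (kap ρ a y * Real.cos (y * ξ))
              + Real.sin (x * ξ) * (kap ρ a y * Real.sin (y * ξ))) := by
            congr 1; ext y
            rw [sub_mul, Real.cos_sub]; ring
        _ = _ := by
            rw [integral_add (hi1.const_mul _) (hi2.const_mul _), integral_const_mul,
              integral_const_mul, h3, kcos]
            ring
    have e3 : ∀ y, kap ρ a y * kap ρ b (x - y) = (√(2 * π))⁻¹ *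
        (kap ρ a y * ∫ ξ, ρ (ξ / 2 ^ b) * (fun p : ℝ × ℝ => Real.cos ((x - p.1) * p.2)) (y, ξ)) := by
      intro y
      rw [e1 (x - y)]; ring
    simp_rw [e3]
    rw [integral_const_mul, swapInt (kint a) hρb (B := fun p : ℝ × ℝ => Real.cos ((x - p.1) * p.2))
      ⟨by fun_prop, 1, fun x => Real.abs_cos_le_one _⟩]
    simp only [e2]
    have e5 : √(2 * π) * kap ρ b x =
        (√(2 * π))⁻¹ * ∫ ξ, √(2 * π) * (ρ (ξ / 2 ^ b) * Real.cos (x * ξ)) := by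
      rw [e1 x, integral_const_mul]; ring
    rw [e5]
    congr 2
    ext ξ
    by_cases hξ : 9 / 8 ≤ |ξ / 2 ^ b|
    · rw [hρ.eq_zero _ hξ]; ring
    · have : ρ (ξ / 2 ^ a) = 1 := by
        apply hρ.eq_one
        push Not at hξ
        obtain ⟨d, rfl⟩ := Nat.exists_eq_add_of_lt hab
        rw [abs_div, abs_of_pos (by positivity : (0 : ℝ) < 2 ^ b), div_lt_iff₀ (by positivity)] at hξ
        rw [abs_div, abs_of_pos (by positivity : (0 : ℝ) < 2 ^ (b + d + 1)),
          div_le_iff₀ (by positivity), pow_succ, pow_add]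
        have h1 : (1 : ℝ) ≤ 2 ^ d := one_le_pow₀ (by norm_num)
        have h2 : (0 : ℝ) < 2 ^ b := by positivity
        nlinarith
      rw [this]; ring
  · intro f hf x
    obtain ⟨D, hD⟩ := hf.2
    have e1 : ∀ n : ℕ, ∫ y, kap ρ n y * f (x - y) = ∫ y, κ y * f (x - y / 2 ^ n) := by
      intro n
      have := Measure.integral_comp_mul_left (fun y => κ y * f (x - y / 2 ^ n)) ((2 : ℝ) ^ n)
      rw [abs_of_pos (by positivity), smul_eq_mul, eq_inv_mul_iff_mul_eq₀ (by positivity)] at this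
      rw [← this, ← integral_const_mul]
      congr 1
      ext y
      simp only [kap]
      rw [mul_assoc]
      congr 3
      field_simp
    simp_rw [e1]
    have e2 : √(2 * π) * f x = ∫ y, κ y * f x := by
      rw [integral_mul_const]
      have := kmass 0
      simp only [kap, pow_zero, one_mul] at this
      rw [this]
    rw [e2]
    apply tendsto_integral_of_dominated_convergence (fun y => |κ y| * D)
    · intro n
      have := hf.1
      exact (by fun_prop : Continuous fun y => κ y * f (x - y / 2 ^ n)).aestronglyMeasurable
    · exact integ0.abs.mul_const D
    · intro n
      refine Filter.Eventually.of_forall fun y => ?_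
      rw [Real.norm_eq_abs, abs_mul]
      gcongr
      exact hD _
    · refine Filter.Eventually.of_forall fun y => ?_
      apply Filter.Tendsto.const_mul
      have h3 : Filter.Tendsto (fun n : ℕ => x - y / 2 ^ n) Filter.atTop (nhds x) := by
        have h4 : Filter.Tendsto (fun n : ℕ => y * ((1 / 2 : ℝ)) ^ n) Filter.atTop (nhds (y * 0)) :=
          (tendsto_pow_atTop_nhds_zero_of_lt_one (by norm_num) (by norm_num)).const_mul y
        have := h4.const_sub x
        simp only [mul_zero, sub_zero] at this
        refine this.congr fun n => ?_
        rw [one_div, inv_pow]; rfl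
      exact (hf.1.tendsto x).comp h3

end Part2

section Part3
open Real MeasureTheory
open scoped ENNReal Classical NNReal

/-- Convolution. -/
def cv (k f : ℝ → ℝ) (x : ℝ) : ℝ := ∫ y, k y * f (x - y)

section BCsec
variable {E : Type*} [TopologicalSpace E]

lemma BC.bound_nonneg {f : E → ℝ} (hf : BC f) : ∃ D : ℝ, 0 ≤ D ∧ ∀ x, |f x| ≤ D := by
  obtain ⟨D, hD⟩ := hf.2
  exact ⟨|D|, abs_nonneg _, fun x => (hD x).trans (le_abs_self _)⟩

lemma BC.mul {f g : E → ℝ} (hf : BC f) (hg : BC g) : BC (fun x => f x * g x) := by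
  obtain ⟨a, a0, ha⟩ := hf.bound_nonneg
  obtain ⟨b, b0, hb⟩ := hg.bound_nonneg
  refine ⟨hf.1.mul hg.1, a * b, fun x => ?_⟩
  rw [abs_mul]
  exact mul_le_mul (ha x) (hb x) (abs_nonneg _) a0

lemma BC.sub {f g : E → ℝ} (hf : BC f) (hg : BC g) : BC (fun x => f x - g x) := by
  obtain ⟨a, a0, ha⟩ := hf.bound_nonneg
  obtain ⟨b, b0, hb⟩ := hg.bound_nonneg
  exact ⟨hf.1.sub hg.1, a + b, fun x => (abs_sub _ _).trans (add_le_add (ha x) (hb x))⟩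

lemma BC.const_mul {f : E → ℝ} (c : ℝ) (hf : BC f) : BC (fun x => c * f x) :=
  BC.mul ⟨continuous_const, |c|, fun _ => le_rfl⟩ hf

lemma BC.comp {E' : Type*} [TopologicalSpace E'] {f : E → ℝ} (hf : BC f) {g : E' → E}
    (hg : Continuous g) : BC (fun x => f (g x)) :=
  ⟨hf.1.comp hg, hf.2.imp fun _ h x => h _⟩

lemma BC.int [FirstCountableTopology E] {k : ℝ → ℝ} (hk : Integrable k) {B : E × ℝ → ℝ}
    (hB : BC B) : BC (fun x => ∫ y, k y * B (x, y)) := by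
  obtain ⟨D, D0, hD⟩ := hB.bound_nonneg
  have hbd : ∀ x y, ‖k y * B (x, y)‖ ≤ |k y| * D := fun x y => by
    rw [Real.norm_eq_abs, abs_mul]; gcongr; exact hD _
  have hB1 := hB.1
  refine ⟨?_, (∫ y, |k y| * D), fun x => ?_⟩
  · refine continuous_of_dominated (bound := fun y => |k y| * D) ?_ ?_ ?_ ?_
    · intro x
      exact hk.aestronglyMeasurable.mul
        (by fun_prop : Continuous fun y => B (x, y)).aestronglyMeasurable
    · intro x; exact Filter.Eventually.of_forall (hbd x)
    · exact hk.abs.mul_const D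
    · exact Filter.Eventually.of_forall fun y => by fun_prop
  · exact norm_integral_le_of_norm_le (hk.abs.mul_const D) (Filter.Eventually.of_forall (hbd x))

end BCsec

lemma BC.shift {f : ℝ → ℝ} (hf : BC f) (x : ℝ) : BC (fun y => f (x - y)) :=
  hf.comp (by fun_prop)

lemma BC.cv {k f : ℝ → ℝ} (hk : Integrable k) (hf : BC f) : BC (cv k f) :=
  BC.int hk (B := fun p : ℝ × ℝ => f (p.1 - p.2)) (hf.comp (by fun_prop))

lemma cv_integrable {k f : ℝ → ℝ} (hk : Integrable k) (hf : BC f) (x : ℝ) :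
    Integrable (fun y => k y * f (x - y)) := BC.integrable hk (hf.shift x)

lemma int_bound {k f w : ℝ → ℝ} (hw : Integrable (fun y => |k y| * w y))
    (hfw : ∀ y, |f y| ≤ w y) : |∫ y, k y * f y| ≤ ∫ y, |k y| * w y :=
  norm_integral_le_of_norm_le hw (Filter.Eventually.of_forall fun y => by
    rw [Real.norm_eq_abs, abs_mul]; gcongr; exact hfw y)

lemma int_bound_const {k f : ℝ → ℝ} {D : ℝ} (hk : Integrable k)
    (hf : ∀ y, |f y| ≤ D) : |∫ y, k y * f y| ≤ (∫ y, |k y|) * D := by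
  rw [← integral_mul_const]
  exact int_bound (w := fun _ => D) (hk.abs.mul_const D) hf

/-- Iterated convolution. -/
lemma cv_cv {k₁ k₂ f : ℝ → ℝ} (h₁ : Integrable k₁) (h₂ : Integrable k₂) (hf : BC f) (x : ℝ) :
    cv k₁ (cv k₂ f) x = cv (cv k₁ k₂) f x := by
  obtain ⟨D, hD⟩ := hf.2
  have hf1 := hf.1
  have hI : Integrable (fun p : ℝ × ℝ => (k₁ p.2 * k₂ (p.1 - p.2)) * f (x - p.1))
      ((volume : Measure ℝ).prod volume) := by
    have := h₁.convolution_integrand (ContinuousLinearMap.mul ℝ ℝ) h₂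
    simp only [ContinuousLinearMap.mul_apply'] at this
    exact this.mul_bdd (c := D) (by fun_prop : Continuous fun p : ℝ × ℝ => f (x - p.1)).aestronglyMeasurable
      (Filter.Eventually.of_forall fun v => by simpa using hD _)
  have hs := integral_integral_swap (f := fun w y => (k₁ y * k₂ (w - y)) * f (x - w))
    (μ := volume) (ν := volume) hI
  calc cv k₁ (cv k₂ f) x = ∫ y, ∫ w, (k₁ y * k₂ (w - y)) * f (x - w) := by
        unfold cv
        congr 1; ext y
        rw [← integral_const_mul,
          ← integral_sub_right_eq_self (fun z => k₁ y * (k₂ z * f (x - y - z))) y]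
        congr 1; ext w
        rw [mul_assoc]; congr 3; ring
    _ = _ := hs.symm
    _ = _ := by
        unfold cv
        congr 1; ext w
        rw [integral_mul_const]

lemma cv_comm {k₁ k₂ f : ℝ → ℝ} (h₁ : Integrable k₁) (h₂ : Integrable k₂) (hf : BC f) (x : ℝ) :
    cv k₁ (cv k₂ f) x = cv k₂ (cv k₁ f) x := by
  unfold cv
  rw [swapInt h₁ h₂ (B := fun p : ℝ × ℝ => f (x - p.1 - p.2)) (hf.comp (by fun_prop))]
  congr 1; ext y; congr 2; ext z
  dsimp only
  congr 2; ring

/-- Translation estimate. -/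
lemma cv_shift (k g : ℝ → ℝ) (x y : ℝ) : cv k g x = ∫ w, k (w + (x - y)) * g (y - w) := by
  unfold cv
  rw [← integral_add_right_eq_self (fun w => k w * g (x - w)) (x - y)]
  congr 1; ext w; congr 2; ring

lemma cv_sub_ker {k₁ k₂ f : ℝ → ℝ} (h₁ : Integrable k₁) (h₂ : Integrable k₂) (hf : BC f) (x : ℝ) :
    cv (fun y => k₁ y - k₂ y) f x = cv k₁ f x - cv k₂ f x := by
  unfold cv
  rw [← integral_sub (cv_integrable h₁ hf x) (cv_integrable h₂ hf x)]
  congr 1; ext y; ring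

lemma cv_sub_fun {k f g : ℝ → ℝ} (hk : Integrable k) (hf : BC f) (hg : BC g) (x : ℝ) :
    cv k (fun y => f y - g y) x = cv k f x - cv k g x := by
  unfold cv
  rw [← integral_sub (cv_integrable hk hf x) (cv_integrable hk hg x)]
  congr 1; ext y; ring

lemma cv_lip {k g : ℝ → ℝ} {D E : ℝ} (hk : Integrable k) (hg : BC g) (hD : ∀ x, |g x| ≤ D)
    (x y : ℝ) (hE : ∫ w, |k (w + (x - y)) - k w| ≤ E) : |cv k g x - cv k g y| ≤ E * D := by
  have D0 : 0 ≤ D := (abs_nonneg _).trans (hD 0)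
  rw [cv_shift k g x y]
  have hk' : Integrable (fun w => k (w + (x - y))) := hk.comp_add_right _
  have : (∫ w, k (w + (x - y)) * g (y - w)) - cv k g y =
      ∫ w, (k (w + (x - y)) - k w) * g (y - w) := by
    unfold cv
    rw [← integral_sub (BC.integrable hk' (hg.shift y)) (cv_integrable hk hg y)]
    congr 1; ext w; ring
  rw [this]
  refine (int_bound_const (hk'.sub hk) (fun w => hD (y - w))).trans ?_
  exact mul_le_mul_of_nonneg_right hE D0

section kernels
variable {κ : ℕ → ℝ → ℝ} {c C : ℝ}

lemma KP.abs_int (h : KP κ c C) (k : ℕ) : ∫ x, |κ k x| ≤ C := by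
  simpa using h.wbd k 0 le_rfl zero_le_one

lemma KP.diff_int (h : KP κ c C) (k : ℕ) (t : ℝ) : ∫ x, |κ k (x + t) - κ k x| ≤ C * (2 ^ k * |t|) := by
  simpa using h.dbd k 0 t le_rfl zero_le_one

lemma KP.dker_integ (h : KP κ c C) (k : ℕ) : Integrable (dker κ k) := by
  cases k with
  | zero => exact h.integ 0
  | succ k => exact (h.integ (k + 1)).sub (h.integ k)

lemma KP.dker_abs (h : KP κ c C) (k : ℕ) : ∫ x, |dker κ k x| ≤ 2 * C := by
  have C0 := h.C_pos
  cases k with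
  | zero => exact (h.abs_int 0).trans (by linarith)
  | succ k =>
    calc _ ≤ ∫ x, (|κ (k + 1) x| + |κ k x|) :=
          integral_mono (h.dker_integ (k + 1)).abs ((h.integ _).abs.add (h.integ _).abs)
            fun x => abs_sub _ _
      _ = (∫ x, |κ (k + 1) x|) + ∫ x, |κ k x| := integral_add (h.integ _).abs (h.integ _).abs
      _ ≤ _ := by linarith [h.abs_int (k + 1), h.abs_int k]

lemma KP.dker_diff (h : KP κ c C) (k : ℕ) (t : ℝ) :
    ∫ x, |dker κ k (x + t) - dker κ k x| ≤ 2 * C * (2 ^ k * |t|) := by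
  have C0 := h.C_pos
  have hi : ∀ k, Integrable (fun x => |κ k (x + t) - κ k x|) := fun k =>
    (((h.integ k).comp_add_right t).sub (h.integ k)).abs
  cases k with
  | zero =>
    refine (h.diff_int 0 t).trans ?_
    have : 0 ≤ C * (2 ^ 0 * |t|) := by positivity
    linarith
  | succ k =>
    calc _ ≤ ∫ x, (|κ (k + 1) (x + t) - κ (k + 1) x| + |κ k (x + t) - κ k x|) := by
          refine integral_mono (((h.dker_integ (k + 1)).comp_add_right t).sub
            (h.dker_integ (k + 1))).abs ((hi _).add (hi _)) fun x => ?_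
          simp only [dker]
          refine le_trans (le_of_eq ?_) (abs_sub _ _)
          congr 1; ring
      _ = _ := integral_add (hi _) (hi _)
      _ ≤ C * (2 ^ (k + 1) * |t|) + C * (2 ^ k * |t|) :=
          add_le_add (h.diff_int (k + 1) t) (h.diff_int k t)
      _ ≤ _ := by
          rw [pow_succ]
          have : 0 ≤ C * (2 ^ k * |t|) := by positivity
          nlinarith

lemma KP.cv_dker_succ (h : KP κ c C) (k : ℕ) {f : ℝ → ℝ} (hf : BC f) (x : ℝ) :
    cv (dker κ (k + 1)) f x = cv (κ (k + 1)) f x - cv (κ k) f x :=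
  cv_sub_ker (h.integ _) (h.integ _) hf x

lemma KP.sum_dker (h : KP κ c C) (n : ℕ) {f : ℝ → ℝ} (hf : BC f) (x : ℝ) :
    ∑ i ∈ Finset.range (n + 1), cv (dker κ i) f x = cv (κ n) f x := by
  induction n with
  | zero => simp [dker]
  | succ n ih => rw [Finset.sum_range_succ, ih, h.cv_dker_succ n hf]; ring

lemma KP.cv_rep (h : KP κ c C) (a b : ℕ) (hab : b < a) {f : ℝ → ℝ} (hf : BC f) (x : ℝ) :
    cv (κ a) (cv (κ b) f) x = c * cv (κ b) f x := by
  rw [cv_cv (h.integ a) (h.integ b) hf]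
  have : cv (κ a) (κ b) = fun x => c * κ b x := by ext x; exact h.rep a b hab x
  rw [this]
  unfold cv
  rw [← integral_const_mul]
  congr 1; ext y; ring

lemma KP.cv_rep' (h : KP κ c C) (a b : ℕ) (hab : b < a) {f : ℝ → ℝ} (hf : BC f) (x : ℝ) :
    cv (κ b) (cv (κ a) f) x = c * cv (κ b) f x := by
  rw [cv_comm (h.integ b) (h.integ a) hf, h.cv_rep a b hab hf]

lemma KP.fat1 (h : KP κ c C) (m : ℕ) {f : ℝ → ℝ} (hf : BC f) (x : ℝ) :
    cv (κ (m + 1)) (cv (dker κ m) f) x = c * cv (dker κ m) f x := by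
  cases m with
  | zero => exact h.cv_rep 1 0 (by norm_num) hf x
  | succ m =>
    have : cv (dker κ (m + 1)) f = fun x => cv (κ (m + 1)) f x - cv (κ m) f x := by
      ext x; exact h.cv_dker_succ m hf x
    rw [this, cv_sub_fun (h.integ _) (hf.cv (h.integ _)) (hf.cv (h.integ _)),
      h.cv_rep _ _ (by omega) hf, h.cv_rep _ _ (by omega) hf]
    ring

/-- fattened kernel for scale `m + 2` -/
def ktil (κ : ℕ → ℝ → ℝ) (m : ℕ) (x : ℝ) : ℝ := κ (m + 3) x - κ m x

lemma KP.ktil_integ (h : KP κ c C) (m : ℕ) : Integrable (ktil κ m) := (h.integ _).sub (h.integ _)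

lemma KP.ktil_mass (h : KP κ c C) (m : ℕ) : ∫ x, ktil κ m x = 0 := by
  unfold ktil
  rw [integral_sub (h.integ _) (h.integ _), h.mass, h.mass, sub_self]

lemma KP.ktil_wint (h : KP κ c C) (m : ℕ) (α : ℝ) (h0 : 0 ≤ α) (h1 : α ≤ 1) :
    Integrable (fun x => |ktil κ m x| * |x| ^ α) := by
  refine ((h.wint (m + 3) α h0 h1).add (h.wint m α h0 h1)).mono' ?_
    (Filter.Eventually.of_forall fun x => ?_)
  · have := h.cont (m + 3)
    have := h.cont m
    exact (Continuous.mul (by unfold ktil; fun_prop)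
      (continuous_abs.rpow_const fun _ => Or.inr h0)).aestronglyMeasurable
  · rw [Real.norm_eq_abs, abs_of_nonneg (by positivity)]
    dsimp only [Pi.add_apply]
    rw [← add_mul]
    gcongr
    exact abs_sub _ _

lemma KP.ktil_wbd (h : KP κ c C) (m : ℕ) (α : ℝ) (h0 : 0 ≤ α) (h1 : α ≤ 1) :
    ∫ x, |ktil κ m x| * |x| ^ α ≤ 5 * C * ((2 : ℝ) ^ (m + 2)) ^ (-α) := by
  have C0 := h.C_pos
  have e1 : ((2 : ℝ) ^ (m + 3)) ^ (-α) ≤ ((2 : ℝ) ^ (m + 2)) ^ (-α) :=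
    Real.rpow_le_rpow_of_nonpos (by positivity) (pow_le_pow_right₀ (by norm_num) (by omega))
      (by linarith)
  have e2 : ((2 : ℝ) ^ m) ^ (-α) ≤ 4 * ((2 : ℝ) ^ (m + 2)) ^ (-α) := by
    rw [pow_add, Real.mul_rpow (by positivity) (by positivity), Real.rpow_neg (x := 2 ^ 2) (by norm_num)]
    have : ((2 : ℝ) ^ 2) ^ α ≤ 4 := by
      calc ((2 : ℝ) ^ 2) ^ α ≤ ((2 : ℝ) ^ 2) ^ (1 : ℝ) :=
            Real.rpow_le_rpow_of_exponent_le (by norm_num) h1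
        _ = 4 := by norm_num
    have h2 : 0 < ((2 : ℝ) ^ 2) ^ α := by positivity
    have h3 : 0 < ((2 : ℝ) ^ m) ^ (-α) := by positivity
    rw [← mul_assoc, ← div_eq_mul_inv, le_div_iff₀ h2]
    nlinarith
  calc _ ≤ ∫ x, (|κ (m + 3) x| * |x| ^ α + |κ m x| * |x| ^ α) := by
        refine integral_mono (h.ktil_wint m α h0 h1)
          ((h.wint (m + 3) α h0 h1).add (h.wint m α h0 h1)) fun x => ?_
        dsimp only
        rw [← add_mul]
        gcongr
        exact abs_sub _ _
    _ = _ := integral_add (h.wint (m + 3) α h0 h1) (h.wint m α h0 h1)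
    _ ≤ C * ((2 : ℝ) ^ (m + 3)) ^ (-α) + C * ((2 : ℝ) ^ m) ^ (-α) :=
        add_le_add (h.wbd _ α h0 h1) (h.wbd _ α h0 h1)
    _ ≤ C * ((2 : ℝ) ^ (m + 2)) ^ (-α) + C * (4 * ((2 : ℝ) ^ (m + 2)) ^ (-α)) := by gcongr
    _ = _ := by ring

lemma KP.fat (h : KP κ c C) (m : ℕ) {f : ℝ → ℝ} (hf : BC f) (x : ℝ) :
    cv (ktil κ m) (cv (dker κ (m + 2)) f) x = c * cv (dker κ (m + 2)) f x := by
  have e1 : cv (ktil κ m) (cv (dker κ (m + 2)) f) x =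
      cv (κ (m + 3)) (cv (dker κ (m + 2)) f) x - cv (κ m) (cv (dker κ (m + 2)) f) x :=
    cv_sub_ker (h.integ _) (h.integ _) (hf.cv (h.dker_integ _)) x
  rw [e1, h.fat1 (m + 2) hf]
  have : cv (dker κ (m + 2)) f = fun x => cv (κ (m + 2)) f x - cv (κ (m + 1)) f x := by
    ext x; exact h.cv_dker_succ (m + 1) hf x
  have e2 : cv (κ m) (cv (dker κ (m + 2)) f) x = 0 := by
    rw [this, cv_sub_fun (h.integ _) (hf.cv (h.integ _)) (hf.cv (h.integ _)),
      h.cv_rep' _ _ (by omega) hf, h.cv_rep' _ _ (by omega) hf]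
    ring
  rw [e2, sub_zero]

end kernels

end Part3

section Part4
open Real MeasureTheory
open scoped ENNReal Classical NNReal

lemma pow_rpow (m : ℕ) (δ : ℝ) : ((2 : ℝ) ^ m) ^ δ = ((2 : ℝ) ^ δ) ^ m := by
  rw [← Real.rpow_natCast_mul (by norm_num), mul_comm, Real.rpow_mul_natCast (by norm_num)]

lemma geo_fin {θ : ℝ} (h0 : 0 ≤ θ) (h1 : θ < 1) (S : Finset ℕ) (g : ℕ → ℕ)
    (hg : Set.InjOn g S) : ∑ i ∈ S, θ ^ (g i) ≤ (1 - θ)⁻¹ := by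
  rw [← Finset.sum_image (f := fun j => θ ^ j) hg, ← tsum_geometric_of_lt_one h0 h1]
  exact (summable_geometric_of_lt_one h0 h1).sum_le_tsum _ fun i _ => by positivity

lemma two_rpow_neg_lt {a : ℝ} (ha : 0 < a) : (2 : ℝ) ^ (-a) < 1 :=
  Real.rpow_lt_one_of_one_lt_of_neg (by norm_num) (by linarith)

lemma geo_dec {δ : ℝ} (hδ : 0 < δ) : ∃ K : ℝ, 0 < K ∧
    ∀ S : Finset ℕ, ∑ m ∈ S, ((2 : ℝ) ^ m) ^ (-δ) ≤ K := by
  have := two_rpow_neg_lt hδ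
  refine ⟨(1 - (2 : ℝ) ^ (-δ))⁻¹, inv_pos.2 (by linarith), fun S => ?_⟩
  simp_rw [pow_rpow]
  exact geo_fin (by positivity) this S id (fun _ _ _ _ => id)

lemma geo_two {a : ℝ} (ha : 0 < a) : ∃ K : ℝ, 0 < K ∧ ∀ (x : ℝ), 0 < x → ∀ S : Finset ℕ,
    ∑ i ∈ S, min ((2 ^ i * x) ^ a) ((2 ^ i * x) ^ (-a)) ≤ K := by
  have hθ := two_rpow_neg_lt ha
  set θ := (2 : ℝ) ^ (-a) with hθd
  have hθ0 : 0 < θ := by positivity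
  have hK : 0 < (1 - θ)⁻¹ := inv_pos.2 (by linarith)
  refine ⟨(1 - θ)⁻¹ + (1 - θ)⁻¹, by positivity, fun x hx S => ?_⟩
  rw [← Finset.sum_filter_add_sum_filter_not S (fun i => 2 ^ i * x ≤ 1)]
  apply add_le_add
  · set S1 := S.filter (fun i => 2 ^ i * x ≤ 1)
    rcases S1.eq_empty_or_nonempty with he | hne
    · rw [he, Finset.sum_empty]; exact hK.le
    set n := S1.max' hne
    have hn : 2 ^ n * x ≤ 1 := (Finset.mem_filter.1 (S1.max'_mem hne)).2
    calc _ ≤ ∑ i ∈ S1, θ ^ (n - i) := by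
          refine Finset.sum_le_sum fun i hi => (min_le_left _ _).trans ?_
          have hin : i ≤ n := S1.le_max' i hi
          have e1 : (2 : ℝ) ^ i * x ≤ (2 ^ (n - i))⁻¹ := by
            rw [← one_div, le_div_iff₀ (by positivity)]
            calc _ = 2 ^ (i + (n - i)) * x := by rw [pow_add]; ring
              _ = 2 ^ n * x := by rw [Nat.add_sub_cancel' hin]
              _ ≤ 1 := hn
          calc _ ≤ ((2 ^ (n - i))⁻¹ : ℝ) ^ a := Real.rpow_le_rpow (by positivity) e1 ha.le
            _ = θ ^ (n - i) := by
              rw [Real.inv_rpow (by positivity), ← Real.rpow_neg (by positivity), pow_rpow]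
      _ ≤ _ := geo_fin hθ0.le hθ S1 _ (fun i hi j hj hij => by
          have h1 : i ≤ n := S1.le_max' i hi
          have h2 : j ≤ n := S1.le_max' j hj
          omega)
  · set S1 := S.filter (fun i => ¬ 2 ^ i * x ≤ 1)
    rcases S1.eq_empty_or_nonempty with he | hne
    · rw [he, Finset.sum_empty]; exact hK.le
    set n := S1.min' hne
    have hn : 1 ≤ 2 ^ n * x := (not_le.1 (Finset.mem_filter.1 (S1.min'_mem hne)).2).le
    calc _ ≤ ∑ i ∈ S1, θ ^ (i - n) := by
          refine Finset.sum_le_sum fun i hi => (min_le_right _ _).trans ?_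
          have hin : n ≤ i := S1.min'_le i hi
          have e1 : (2 : ℝ) ^ (i - n) ≤ 2 ^ i * x := by
            calc (2 : ℝ) ^ (i - n) ≤ 2 ^ (i - n) * (2 ^ n * x) := by
                  nlinarith [pow_pos (by norm_num : (0 : ℝ) < 2) (i - n)]
              _ = 2 ^ (i - n + n) * x := by rw [pow_add]; ring
              _ = _ := by rw [Nat.sub_add_cancel hin]
          calc _ ≤ ((2 : ℝ) ^ (i - n)) ^ (-a) :=
                Real.rpow_le_rpow_of_nonpos (by positivity) e1 (by linarith)
            _ = θ ^ (i - n) := by rw [pow_rpow]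
      _ ≤ _ := geo_fin hθ0.le hθ S1 _ (fun i hi j hj hij => by
          have h1 : n ≤ i := S1.min'_le i hi
          have h2 : n ≤ j := S1.min'_le j hj
          omega)

lemma min_pow_le {t a b : ℝ} (ht : 0 < t) (ha : 0 < a) (hb : 0 < b) :
    min (t ^ a) (t ^ (-b)) ≤ min (t ^ (min a b)) (t ^ (-(min a b))) := by
  have hm : 0 < min a b := lt_min ha hb
  rcases le_total t 1 with h | h
  · have e1 : t ^ a ≤ t ^ (min a b) := Real.rpow_le_rpow_of_exponent_ge ht h (min_le_left _ _)
    have e2 : t ^ (min a b) ≤ t ^ (-(min a b)) :=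
      Real.rpow_le_rpow_of_exponent_ge ht h (by linarith)
    exact (min_le_left _ _).trans (le_min e1 (e1.trans e2))
  · have e1 : t ^ (-b) ≤ t ^ (-(min a b)) :=
      Real.rpow_le_rpow_of_exponent_le h (by linarith [min_le_right a b])
    have e2 : t ^ (-(min a b)) ≤ t ^ (min a b) :=
      Real.rpow_le_rpow_of_exponent_le h (by linarith)
    exact (min_le_right _ _).trans (le_min (e1.trans e2) e1)

lemma geo_two' {a b : ℝ} (ha : 0 < a) (hb : 0 < b) : ∃ K : ℝ, 0 < K ∧ ∀ (x : ℝ), 0 < x →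
    ∀ S : Finset ℕ, ∑ i ∈ S, min ((2 ^ i * x) ^ a) ((2 ^ i * x) ^ (-b)) ≤ K := by
  obtain ⟨K, K0, hK⟩ := geo_two (lt_min ha hb)
  exact ⟨K, K0, fun x hx S => (Finset.sum_le_sum fun i _ =>
    min_pow_le (by positivity) ha hb).trans (hK x hx S)⟩

lemma sum1 {s : ℝ} (hs0 : 0 < s) (hs1 : s < 1) : ∃ K : ℝ, 0 < K ∧ ∀ (h : ℝ), 0 < h →
    ∀ S : Finset ℕ, ∑ k ∈ S, ((2 : ℝ) ^ k) ^ (-s) * min 1 (2 ^ k * h) ≤ K * h ^ s := by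
  obtain ⟨K, K0, hK⟩ := geo_two' (a := 1 - s) (by linarith) hs0
  refine ⟨K, K0, fun h hh S => ?_⟩
  have := mul_le_mul_of_nonneg_right (hK h hh S) (by positivity : 0 ≤ h ^ s)
  refine le_trans (le_of_eq ?_) this
  rw [Finset.sum_mul]
  refine Finset.sum_congr rfl fun k _ => ?_
  have ht : (0 : ℝ) < 2 ^ k * h := by positivity
  rw [sub_eq_add_neg, Real.rpow_add ht, Real.rpow_one, min_comm]
  have e : min (2 ^ k * h * (2 ^ k * h) ^ (-s)) ((2 ^ k * h) ^ (-s)) =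
      min (2 ^ k * h) 1 * (2 ^ k * h) ^ (-s) := by
    rw [min_mul_of_nonneg _ _ (by positivity), one_mul]
  rw [e, mul_assoc, Real.mul_rpow (by positivity) hh.le, mul_assoc, ← Real.rpow_add hh]
  simp [mul_comm]

lemma sum2 {β : ℝ} (hs0 : 0 < β) (hs1 : β < 1) : ∃ K : ℝ, 0 < K ∧ ∀ (k : ℕ),
    ∀ S : Finset ℕ, ∑ i ∈ S, ((2 : ℝ) ^ i) ^ β * min 1 (2 ^ k / 2 ^ i) ≤
      K * ((2 : ℝ) ^ k) ^ β := by
  obtain ⟨K, K0, hK⟩ := geo_two' (b := 1 - β) hs0 (by linarith)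
  refine ⟨K, K0, fun k S => ?_⟩
  have := mul_le_mul_of_nonneg_right (hK (2 ^ k)⁻¹ (by positivity) S)
    (by positivity : 0 ≤ ((2 : ℝ) ^ k) ^ β)
  refine le_trans (le_of_eq ?_) this
  rw [Finset.sum_mul]
  refine Finset.sum_congr rfl fun i _ => ?_
  set t : ℝ := 2 ^ i * (2 ^ k)⁻¹ with ht'
  have ht : (0 : ℝ) < t := by positivity
  have e0 : (2 : ℝ) ^ k / 2 ^ i = t⁻¹ := by rw [ht']; field_simp
  have e1 : (2 : ℝ) ^ i = t * 2 ^ k := by rw [ht']; field_simp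
  have e2 : -(1 - β) = β + -1 := by ring
  rw [e0, e1, e2, Real.rpow_add ht, Real.rpow_neg_one, Real.mul_rpow ht.le (by positivity)]
  have e : min (t ^ β) (t ^ β * t⁻¹) = t ^ β * min 1 t⁻¹ := by
    rw [mul_min_of_nonneg _ _ (by positivity), mul_one]
  rw [e]; ring

section kernels
variable {κ : ℕ → ℝ → ℝ} {c C : ℝ}

/-- Hölder regularity from Littlewood–Paley bounds. -/
lemma KP.hold (h : KP κ c C) {s : ℝ} (hs0 : 0 < s) (hs1 : s < 1) : ∃ K : ℝ, 0 < K ∧ ∀ (φ : ℝ → ℝ), BC φ →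
    ∀ A : ℝ, 0 ≤ A → (∀ k x, |cv (dker κ k) φ x| ≤ A * ((2 : ℝ) ^ k) ^ (-s)) →
    (∀ x, |φ x| ≤ K * A) ∧ ∀ x y, |φ x - φ y| ≤ K * A * |x - y| ^ s := by
  obtain ⟨K1, K10, hK1⟩ := geo_dec hs0
  obtain ⟨K2, K20, hK2⟩ := sum1 hs0 hs1
  have c0 := h.c_pos
  have C0 := h.C_pos
  set D := 2 + 2 * C / c with hD
  have D0 : 0 < D := by positivity
  refine ⟨(K1 + D * K2) / c, by positivity, fun φ hφ A A0 hA => ⟨fun x => ?_, fun x y => ?_⟩⟩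
  · have ht := (h.tends φ hφ x).abs
    have : |c * φ x| ≤ A * K1 := by
      refine le_of_tendsto ht (Filter.Eventually.of_forall fun n => ?_)
      have := h.sum_dker n hφ x
      unfold cv at this
      rw [← this]
      refine (Finset.abs_sum_le_sum_abs _ _).trans ?_
      refine (Finset.sum_le_sum fun i _ => hA i x).trans ?_
      rw [← Finset.mul_sum]
      gcongr
      exact hK1 _
    rw [abs_mul, abs_of_pos c0] at this
    rw [div_mul_eq_mul_div, le_div_iff₀ c0]
    have : 0 ≤ D * K2 * A := by positivity
    nlinarith
  · rcases eq_or_ne x y with rfl | hxy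
    · simp only [sub_self, abs_zero]; positivity
    have hd : 0 < |x - y| := abs_pos.2 (sub_ne_zero.2 hxy)
    have ht := ((h.tends φ hφ x).sub (h.tends φ hφ y)).abs
    have key : ∀ i, |cv (dker κ i) φ x - cv (dker κ i) φ y| ≤
        A * D * (((2 : ℝ) ^ i) ^ (-s) * min 1 (2 ^ i * |x - y|)) := by
      intro i
      have e1 : |cv (dker κ i) φ x - cv (dker κ i) φ y| ≤ 2 * (A * ((2 : ℝ) ^ i) ^ (-s)) := by
        refine (abs_sub _ _).trans ?_
        linarith [hA i x, hA i y]
      have e2 : |cv (dker κ i) φ x - cv (dker κ i) φ y| ≤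
          2 * C / c * (2 ^ i * |x - y|) * (A * ((2 : ℝ) ^ i) ^ (-s)) := by
        have := cv_lip (h.integ (i + 1)) (hφ.cv (h.dker_integ i)) (hA i) x y
          (h.diff_int (i + 1) (x - y))
        rw [h.fat1 i hφ, h.fat1 i hφ, ← mul_sub, abs_mul, abs_of_pos c0, mul_comm c,
          ← le_div_iff₀ c0] at this
        refine this.trans (le_of_eq ?_)
        rw [pow_succ]; ring
      set M := A * ((2 : ℝ) ^ i) ^ (-s)
      have M0 : 0 ≤ M := by positivity
      have E0 : 0 ≤ 2 * C / c := by positivity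
      have e3 : A * D * (((2 : ℝ) ^ i) ^ (-s) * min 1 (2 ^ i * |x - y|)) =
        M * (D * min 1 (2 ^ i * |x - y|)) := by simp only [M]; ring
      rw [e3]
      rcases min_cases 1 (2 ^ i * |x - y|) with ⟨hm, _⟩ | ⟨hm, _⟩
      · rw [hm]; rw [hD]; nlinarith [mul_nonneg M0 E0]
      · rw [hm]; rw [hD]
        have : 0 ≤ 2 ^ i * |x - y| := by positivity
        nlinarith [mul_nonneg M0 this]
    have : |c * φ x - c * φ y| ≤ A * D * (K2 * |x - y| ^ s) := by
      refine le_of_tendsto ht (Filter.Eventually.of_forall fun n => ?_)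
      have e1 := h.sum_dker n hφ x
      have e2 := h.sum_dker n hφ y
      unfold cv at e1 e2
      rw [← e1, ← e2, ← Finset.sum_sub_distrib]
      refine (Finset.abs_sum_le_sum_abs _ _).trans ?_
      refine (Finset.sum_le_sum fun i _ => key i).trans ?_
      rw [← Finset.mul_sum]
      gcongr
      exact hK2 _ hd _
    rw [← mul_sub, abs_mul, abs_of_pos c0] at this
    rw [div_mul_eq_mul_div, div_mul_eq_mul_div, le_div_iff₀ c0]
    have : 0 ≤ K1 * A * |x - y| ^ s := by positivity
    nlinarith

/-- The commutator kernel estimate. -/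
lemma KP.comm (h : KP κ c C) {T : ℝ × ℝ → ℝ} (hT : BC T) {D s : ℝ} (hs0 : 0 < s) (hs1 : s < 1)
    (h1 : ∀ y t, |T (y, t)| ≤ D * |y - t| ^ s)
    (h2 : ∀ y z t, |T (y, t) - T (z, t)| ≤ D * |y - z| ^ s) (j : ℕ) :
    (∀ y, |∫ t, κ j t * T (y, y - t)| ≤ D * C * ((2 : ℝ) ^ j) ^ (-s)) ∧
    ∀ y z, |(∫ t, κ j t * T (y, y - t)) - ∫ t, κ j t * T (z, z - t)| ≤
      C * D * |y - z| ^ s + C * D * (((2 : ℝ) ^ j) ^ (-s) * 2 ^ j) * |y - z| := by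
  have C0 := h.C_pos
  have D0 : 0 ≤ D := by
    have := (abs_nonneg _).trans (h1 1 0)
    simpa using this
  refine ⟨fun y => ?_, fun y z => ?_⟩
  · have hi : Integrable fun t => |κ j t| * (D * |t| ^ s) := by
      refine ((h.wint j s hs0.le hs1.le).const_mul D).congr (Filter.Eventually.of_forall fun t => ?_)
      dsimp only; ring
    refine (int_bound hi (fun t => ?_)).trans ?_
    · have := h1 y (y - t)
      rwa [sub_sub_cancel] at this
    · calc _ = D * ∫ t, |κ j t| * |t| ^ s := by
            rw [← integral_const_mul]; congr 1; ext t; ring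
        _ ≤ D * (C * ((2 : ℝ) ^ j) ^ (-s)) := by
            gcongr; exact h.wbd j s hs0.le hs1.le
        _ = _ := by ring
  · have hTy : ∀ y z, BC (fun w => T (y, z - w)) := fun y z => hT.comp (by fun_prop)
    have hk' : Integrable (fun w => κ j (w + (y - z))) := (h.integ j).comp_add_right _
    have e1 : (∫ t, κ j t * T (y, y - t)) = ∫ w, κ j (w + (y - z)) * T (y, z - w) :=
      cv_shift (κ j) (fun t => T (y, t)) y z
    have e2 : (∫ t, κ j t * T (y, y - t)) - ∫ t, κ j t * T (z, z - t) =
        (∫ w, κ j (w + (y - z)) * (T (y, z - w) - T (z, z - w))) +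
        ∫ w, (κ j (w + (y - z)) - κ j w) * T (z, z - w) := by
      have hkd : Integrable (fun w => κ j (w + (y - z)) - κ j w) := hk'.sub (h.integ j)
      rw [e1, ← integral_sub (BC.integrable hk' (hTy y z)) (BC.integrable (h.integ j) (hTy z z)),
        ← integral_add (BC.integrable hk' ((hTy y z).sub (hTy z z)))
          (BC.integrable hkd (hTy z z))]
      congr 1; ext w; ring
    rw [e2]
    refine (abs_add_le _ _).trans (add_le_add ?_ ?_)
    · refine (int_bound_const hk' (fun w => h2 y z (z - w))).trans ?_
      rw [integral_add_right_eq_self (fun w => |κ j w|), mul_assoc]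
      gcongr
      exact h.abs_int j
    · have hi : Integrable fun w => |κ j (w + (y - z)) - κ j w| * (D * |w| ^ s) := by
        refine ((h.dint j s (y - z) hs0.le hs1.le).const_mul D).congr
          (Filter.Eventually.of_forall fun t => ?_)
        dsimp only; ring
      refine (int_bound hi (fun t => ?_)).trans ?_
      · have := h1 z (z - t)
        rwa [sub_sub_cancel] at this
      · calc _ = D * ∫ w, |κ j (w + (y - z)) - κ j w| * |w| ^ s := by
              rw [← integral_const_mul]; congr 1; ext t; ring
          _ ≤ D * (C * ((2 : ℝ) ^ j) ^ (-s) * (2 ^ j * |y - z|)) := by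
              gcongr; exact h.dbd j s _ hs0.le hs1.le
          _ = _ := by ring

/-- Output estimate for a product with a frequency-localized factor. -/
lemma KP.out (h : KP κ c C) : ∃ K : ℝ, 0 < K ∧ ∀ (B : ℝ × ℝ → ℝ), BC B → ∀ (α b₀ b₁ b₂ : ℝ), 0 ≤ α → α ≤ 1 →
    0 ≤ b₁ → 0 ≤ b₂ → (∀ p, |B p| ≤ b₀) →
    (∀ y z w, |B (y, w) - B (z, w)| ≤ b₁ * |y - z| ^ α + b₂ * |y - z|) →
    ∀ m : ℕ, (∀ n, m = n + 2 → ∀ w y, ∫ τ, ktil κ n τ * B (w, y - τ) = c * B (w, y)) →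
    ∀ (k : ℕ) (x : ℝ), |∫ y, dker κ k y * B (x - y, x - y)| ≤
      K * (min 1 (2 ^ k / 2 ^ m) * b₀ + ((2 : ℝ) ^ m) ^ (-α) * b₁ + ((2 : ℝ) ^ m)⁻¹ * b₂) := by
  have C0 := h.C_pos
  have c0 := h.c_pos
  set E := 8 * C + 10 * C * C / c
  have E0 : 0 < E := by positivity
  refine ⟨E, E0, fun B hB α b₀ b₁ b₂ α0 α1 hb₁ hb₂ hb₀ hd m hm k x => ?_⟩
  have b0 : 0 ≤ b₀ := (abs_nonneg _).trans (hb₀ 0)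
  have hdi := h.dker_integ k
  have triv : |∫ y, dker κ k y * B (x - y, x - y)| ≤ 2 * C * b₀ :=
    (int_bound_const hdi (fun y => hb₀ _)).trans (by gcongr; exact h.dker_abs k)
  have r1 : 0 ≤ ((2 : ℝ) ^ m) ^ (-α) * b₁ := by positivity
  have r2 : 0 ≤ ((2 : ℝ) ^ m)⁻¹ * b₂ := by positivity
  have easy : (1 / 4 : ℝ) ≤ min 1 (2 ^ k / 2 ^ m) → |∫ y, dker κ k y * B (x - y, x - y)| ≤
      E * (min 1 (2 ^ k / 2 ^ m) * b₀ + ((2 : ℝ) ^ m) ^ (-α) * b₁ + ((2 : ℝ) ^ m)⁻¹ * b₂) := by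
    intro hq
    calc _ ≤ 2 * C * b₀ := triv
      _ = 8 * C * (1 / 4 * b₀) := by ring
      _ ≤ E * (min 1 (2 ^ k / 2 ^ m) * b₀) := by
          have : 8 * C ≤ E := by simp only [E]; linarith [(by positivity : 0 ≤ 10 * C * C / c)]
          gcongr
      _ ≤ _ := by gcongr; linarith
  rcases Nat.lt_or_ge m 2 with hm2 | hm2
  · apply easy
    have h1 : (1 : ℝ) ≤ 2 ^ k := one_le_pow₀ (by norm_num)
    refine le_min (by norm_num) ?_
    rw [le_div_iff₀ (by positivity)]
    have : (2 : ℝ) ^ m ≤ 2 ^ 2 := pow_le_pow_right₀ (by norm_num) hm2.le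
    linarith
  · obtain ⟨n, rfl⟩ := Nat.exists_eq_add_of_le' hm2
    rcases le_total 1 ((2 : ℝ) ^ k / 2 ^ (n + 2)) with hq | hq
    · apply easy; rw [min_eq_left hq]; norm_num
    rw [min_eq_right hq]
    have hrep := hm n rfl
    have hki := h.ktil_integ n
    set Q := ∫ y, dker κ k y * B (x - y, x - y) with hQ
    set I : ℝ → ℝ := fun τ => ∫ y, dker κ k y * B (x - y, x - y - τ) with hI
    have s1 : c * Q = ∫ τ, ktil κ n τ * I τ := by
      have := swapInt hdi hki (B := fun p : ℝ × ℝ => B (x - p.1, x - p.1 - p.2))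
        (hB.comp (by fun_prop))
      simp only [hrep] at this
      rw [← this, hQ, ← integral_const_mul]
      congr 1; ext y; ring
    have s2 : ∀ τ, I τ = ∫ y, dker κ k (y + (-τ)) * B (x - y + τ, x - y) := by
      intro τ
      rw [hI]
      dsimp only
      rw [← integral_add_right_eq_self (fun y => dker κ k y * B (x - y, x - y - τ)) (-τ)]
      congr 1; ext y
      congr 3 <;> ring
    have hBC : BC I := BC.int hdi (B := fun p : ℝ × ℝ => B (x - p.2, x - p.2 - p.1))
      (hB.comp (by fun_prop))
    have s3 : c * Q = ∫ τ, ktil κ n τ * (I τ - Q) := by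
      rw [s1]
      have : ∀ τ, ktil κ n τ * (I τ - Q) = ktil κ n τ * I τ - ktil κ n τ * Q := fun τ => by ring
      simp_rw [this]
      rw [integral_sub (BC.integrable hki hBC) (hki.mul_const _), integral_mul_const,
        h.ktil_mass]
      ring
    have s4 : ∀ τ, |I τ - Q| ≤ 2 * C * b₁ * |τ| ^ α + 2 * C * (2 ^ k * b₀ + b₂) * |τ| := by
      intro τ
      have hk' : Integrable (fun y => dker κ k (y + (-τ))) := hdi.comp_add_right _
      have f1 : BC (fun y => B (x - y + τ, x - y)) := hB.comp (by fun_prop)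
      have f2 : BC (fun y => B (x - y, x - y)) := hB.comp (by fun_prop)
      have : I τ - Q = (∫ y, (dker κ k (y + (-τ)) - dker κ k y) * B (x - y + τ, x - y)) +
          ∫ y, dker κ k y * (B (x - y + τ, x - y) - B (x - y, x - y)) := by
        have hkd : Integrable (fun y => dker κ k (y + (-τ)) - dker κ k y) := hk'.sub hdi
        rw [s2, hQ, ← integral_sub (BC.integrable hk' f1) (BC.integrable hdi f2),
          ← integral_add (BC.integrable hkd f1) (BC.integrable hdi (f1.sub f2))]
        congr 1; ext y; ring
      rw [this]
      have g1 : |∫ y, (dker κ k (y + (-τ)) - dker κ k y) * B (x - y + τ, x - y)| ≤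
          2 * C * (2 ^ k * |τ|) * b₀ := by
        refine (int_bound_const (hk'.sub hdi) (fun y => hb₀ _)).trans ?_
        have := h.dker_diff k (-τ)
        rw [abs_neg] at this
        exact mul_le_mul_of_nonneg_right this b0
      have g2 : |∫ y, dker κ k y * (B (x - y + τ, x - y) - B (x - y, x - y))| ≤
          2 * C * (b₁ * |τ| ^ α + b₂ * |τ|) := by
        refine (int_bound_const (D := b₁ * |τ| ^ α + b₂ * |τ|) hdi (fun y => ?_)).trans ?_
        · have := hd (x - y + τ) (x - y) (x - y)
          rwa [add_sub_cancel_left] at this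
        · gcongr; exact h.dker_abs k
      refine (abs_add_le _ _).trans ((add_le_add g1 g2).trans (le_of_eq ?_))
      ring
    have i1 := h.ktil_wint n α α0 α1
    have i2 := h.ktil_wint n 1 zero_le_one le_rfl
    have w1 := h.ktil_wbd n α α0 α1
    have w2 := h.ktil_wbd n 1 zero_le_one le_rfl
    simp only [Real.rpow_one, Real.rpow_neg_one] at i2 w2
    have hi : Integrable fun τ => |ktil κ n τ| *
        (2 * C * b₁ * |τ| ^ α + 2 * C * (2 ^ k * b₀ + b₂) * |τ|) := by
      refine ((i1.const_mul (2 * C * b₁)).add (i2.const_mul (2 * C * (2 ^ k * b₀ + b₂)))).congr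
        (Filter.Eventually.of_forall fun τ => ?_)
      simp only [Pi.add_apply]; ring
    have s5 : c * |Q| ≤ 2 * C * b₁ * (5 * C * ((2 : ℝ) ^ (n + 2)) ^ (-α)) +
        2 * C * (2 ^ k * b₀ + b₂) * (5 * C * ((2 : ℝ) ^ (n + 2))⁻¹) := by
      have hcQ : c * |Q| = |c * Q| := by rw [abs_mul, abs_of_pos c0]
      rw [hcQ, s3]
      refine (int_bound hi s4).trans ?_
      calc _ = 2 * C * b₁ * (∫ τ, |ktil κ n τ| * |τ| ^ α) +
            2 * C * (2 ^ k * b₀ + b₂) * ∫ τ, |ktil κ n τ| * |τ| := by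
            rw [← integral_const_mul, ← integral_const_mul,
              ← integral_add (i1.const_mul _) (i2.const_mul _)]
            congr 1; ext τ; ring
        _ ≤ _ := by gcongr
    have s6 : |Q| ≤ 10 * C * C / c * (2 ^ k / 2 ^ (n + 2) * b₀ + ((2 : ℝ) ^ (n + 2)) ^ (-α) * b₁ +
        ((2 : ℝ) ^ (n + 2))⁻¹ * b₂) := by
      rw [div_mul_eq_mul_div, le_div_iff₀ c0, mul_comm |Q|]
      refine s5.trans (le_of_eq ?_)
      rw [div_eq_mul_inv]
      ring
    refine s6.trans ?_
    gcongr
    simp only [E]; linarith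

end kernels

end Part4

section Part5
open Real MeasureTheory
open scoped ENNReal Classical NNReal

lemma cv_sum {k : ℝ → ℝ} (hk : Integrable k) {ι : Type*} (S : Finset ι) {f : ι → ℝ → ℝ}
    (hf : ∀ i, BC (f i)) (x : ℝ) :
    cv k (fun y => ∑ i ∈ S, f i y) x = ∑ i ∈ S, cv k (f i) x := by
  unfold cv
  rw [← integral_finsetSum _ (fun i _ => cv_integrable hk (hf i) x)]
  congr 1; ext y
  rw [Finset.mul_sum]

section kernels2
variable {κ : ℕ → ℝ → ℝ} {c C : ℝ}

/-- Dominated convergence for `f · S_n g`. -/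
lemma KP.prod_tends (h : KP κ c C) {f g : ℝ → ℝ} (hf : BC f) (hg : BC g) (k : ℕ) (x : ℝ) :
    Filter.Tendsto (fun n => cv (dker κ k) (fun y => f y * cv (κ n) g y) x) Filter.atTop
      (nhds (c * cv (dker κ k) (fun y => f y * g y) x)) := by
  obtain ⟨Df, Df0, hDf⟩ := hf.bound_nonneg
  obtain ⟨Dg, Dg0, hDg⟩ := hg.bound_nonneg
  have C0 := h.C_pos
  have e : c * cv (dker κ k) (fun y => f y * g y) x =
      ∫ y, dker κ k y * (f (x - y) * (c * g (x - y))) := by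
    unfold cv
    rw [← integral_const_mul]
    congr 1; ext y; ring
  rw [e]
  refine tendsto_integral_of_dominated_convergence (fun y => |dker κ k y| * (Df * (C * Dg)))
    (fun n => ?_) ((h.dker_integ k).abs.mul_const _) (fun n => ?_) ?_
  · exact (cv_integrable (h.dker_integ k) (hf.mul (hg.cv (h.integ n))) x).aestronglyMeasurable
  · refine Filter.Eventually.of_forall fun y => ?_
    rw [Real.norm_eq_abs, abs_mul, abs_mul]
    have h1 : |cv (κ n) g (x - y)| ≤ C * Dg :=
      (int_bound_const (h.integ n) (fun z => hDg _)).trans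
        (mul_le_mul_of_nonneg_right (h.abs_int n) Dg0)
    gcongr
    exact hDf _
  · refine Filter.Eventually.of_forall fun y => ?_
    exact ((h.tends g hg (x - y)).const_mul _).const_mul _

lemma KP.tri (h : KP κ c C) {α β : ℝ} (hβ0 : 0 < β) (hβα : β < α) (hα1 : α < 1) : ∃ K : ℝ, 0 < K ∧
    ∀ f g : ℝ → ℝ, BC f → BC g → ∀ a b : ℝ, 0 ≤ a → 0 ≤ b → (∀ x, |f x| ≤ a) →
    (∀ x y, |f x - f y| ≤ a * |x - y| ^ α) →
    (∀ i x, |cv (dker κ i) g x| ≤ b * ((2 : ℝ) ^ i) ^ β) →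
    ∀ k x, |cv (dker κ k) (fun y => f y * g y) x| ≤ K * (a * b) * ((2 : ℝ) ^ k) ^ β := by
  obtain ⟨K0, K00, hK0⟩ := h.out
  obtain ⟨K1, K10, hK1⟩ := geo_dec (sub_pos.2 hβα)
  obtain ⟨K2, K20, hK2⟩ := sum2 hβ0 (hβα.trans hα1)
  have c0 := h.c_pos
  refine ⟨K0 * (K1 + K2) / c, by positivity, fun f g hf hg a b a0 b0 hfa hfα hgb k x => ?_⟩
  have key : ∀ i, |cv (dker κ k) (fun y => f y * cv (dker κ i) g y) x| ≤
      K0 * (a * b) * (((2 : ℝ) ^ i) ^ β * min 1 (2 ^ k / 2 ^ i) + ((2 : ℝ) ^ i) ^ (-(α - β))) := by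
    intro i
    have hgi := hg.cv (h.dker_integ i)
    have := hK0 (fun p => f p.1 * cv (dker κ i) g p.2)
      ((hf.comp continuous_fst).mul (hgi.comp continuous_snd)) α
      (a * (b * ((2 : ℝ) ^ i) ^ β)) (a * (b * ((2 : ℝ) ^ i) ^ β)) 0
      (hβ0.trans hβα).le hα1.le (by positivity) le_rfl
      (fun p => by
        rw [abs_mul]; gcongr
        · exact hfa _
        · exact hgb _ _)
      (fun y z w => by
        dsimp only
        rw [← sub_mul, abs_mul, zero_mul, add_zero]
        calc _ ≤ (a * |y - z| ^ α) * (b * ((2 : ℝ) ^ i) ^ β) := by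
              gcongr
              · exact hfα _ _
              · exact hgb _ _
          _ = _ := by ring)
      i
      (fun n hn w y => by
        subst hn
        dsimp only
        have := h.fat n hg y
        unfold cv at this ⊢
        rw [← mul_assoc, mul_comm c, mul_assoc, ← this, ← integral_const_mul]
        congr 1; ext τ; ring)
      k x
    refine this.trans (le_of_eq ?_)
    rw [neg_sub, sub_eq_add_neg, Real.rpow_add (by positivity)]
    ring
  have hsum : ∀ n, |cv (dker κ k) (fun y => f y * cv (κ n) g y) x| ≤
      K0 * (a * b) * ((K1 + K2) * ((2 : ℝ) ^ k) ^ β) := by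
    intro n
    have e : cv (dker κ k) (fun y => f y * cv (κ n) g y) x =
        ∑ i ∈ Finset.range (n + 1), cv (dker κ k) (fun y => f y * cv (dker κ i) g y) x := by
      rw [← cv_sum (h.dker_integ k) _ (fun i => hf.mul (hg.cv (h.dker_integ i)))]
      congr 1; ext y
      rw [← Finset.mul_sum, h.sum_dker n hg y]
    rw [e]
    refine (Finset.abs_sum_le_sum_abs _ _).trans ((Finset.sum_le_sum fun i _ => key i).trans ?_)
    rw [← Finset.mul_sum, Finset.sum_add_distrib]
    gcongr
    have h1 : (1 : ℝ) ≤ ((2 : ℝ) ^ k) ^ β := Real.one_le_rpow (one_le_pow₀ (by norm_num)) hβ0.le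
    have := hK1 (Finset.range (n + 1))
    have := hK2 k (Finset.range (n + 1))
    nlinarith
  have := le_of_tendsto (h.prod_tends hf hg k x).abs (Filter.Eventually.of_forall hsum)
  rw [abs_mul, abs_of_pos c0] at this
  rw [div_mul_eq_mul_div, div_mul_eq_mul_div, le_div_iff₀ c0]
  linarith

end kernels2

end Part5

section Part6
open Real MeasureTheory
open scoped ENNReal Classical NNReal

/-- Convolution in the first variable. -/
def pu (k : ℝ → ℝ) (F : ℝ × ℝ → ℝ) (p : ℝ × ℝ) : ℝ := ∫ y : ℝ, k y * F (p.1 - y, p.2)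

/-- Convolution in the second variable. -/
def pv (k : ℝ → ℝ) (F : ℝ × ℝ → ℝ) (p : ℝ × ℝ) : ℝ := ∫ y : ℝ, k y * F (p.1, p.2 - y)

lemma pu_eq (k : ℝ → ℝ) (F : ℝ × ℝ → ℝ) (u v : ℝ) : pu k F (u, v) = cv k (fun u => F (u, v)) u :=
  rfl

lemma pv_eq (k : ℝ → ℝ) (F : ℝ × ℝ → ℝ) (u v : ℝ) : pv k F (u, v) = cv k (fun v => F (u, v)) v :=
  rfl

lemma BC.pu {k : ℝ → ℝ} {F : ℝ × ℝ → ℝ} (hk : Integrable k) (hF : BC F) : BC (pu k F) :=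
  BC.int hk (B := fun q : (ℝ × ℝ) × ℝ => F (q.1.1 - q.2, q.1.2)) (hF.comp (by fun_prop))

lemma BC.pv {k : ℝ → ℝ} {F : ℝ × ℝ → ℝ} (hk : Integrable k) (hF : BC F) : BC (pv k F) :=
  BC.int hk (B := fun q : (ℝ × ℝ) × ℝ => F (q.1.1, q.1.2 - q.2)) (hF.comp (by fun_prop))

lemma BC.left {F : ℝ × ℝ → ℝ} (hF : BC F) (v : ℝ) : BC (fun u => F (u, v)) :=
  hF.comp (by fun_prop)

lemma BC.right {F : ℝ × ℝ → ℝ} (hF : BC F) (u : ℝ) : BC (fun v => F (u, v)) :=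
  hF.comp (by fun_prop)

lemma pu_pv {k₁ k₂ : ℝ → ℝ} (h₁ : Integrable k₁) (h₂ : Integrable k₂) {F : ℝ × ℝ → ℝ} (hF : BC F)
    (p : ℝ × ℝ) : pu k₁ (pv k₂ F) p = pv k₂ (pu k₁ F) p :=
  swapInt h₁ h₂ (B := fun q : ℝ × ℝ => F (p.1 - q.1, p.2 - q.2)) (hF.comp (by fun_prop))

lemma hold_prod {f g : ℝ → ℝ} {a b α : ℝ} (a0 : 0 ≤ a) (b0 : 0 ≤ b)
    (hf : ∀ x, |f x| ≤ a) (hg : ∀ x, |g x| ≤ b)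
    (hf' : ∀ x y, |f x - f y| ≤ a * |x - y| ^ α) (hg' : ∀ x y, |g x - g y| ≤ b * |x - y| ^ α) :
    (∀ x, |f x * g x| ≤ 2 * (a * b)) ∧
    ∀ x y, |f x * g x - f y * g y| ≤ 2 * (a * b) * |x - y| ^ α := by
  refine ⟨fun x => ?_, fun x y => ?_⟩
  · rw [abs_mul]
    have := mul_le_mul (hf x) (hg x) (abs_nonneg _) a0
    nlinarith [mul_nonneg a0 b0]
  · have e : f x * g x - f y * g y = (f x - f y) * g x + f y * (g x - g y) := by ring
    rw [e]
    refine (abs_add_le _ _).trans ?_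
    rw [abs_mul, abs_mul]
    have h1 := mul_le_mul (hf' x y) (hg x) (abs_nonneg _) (by positivity)
    have h2 := mul_le_mul (hf y) (hg' x y) (abs_nonneg _) a0
    linarith

section kernels3
variable {κ : ℕ → ℝ → ℝ} {c C : ℝ}

lemma KP.estF (h : KP κ c C) {s α : ℝ} (hs0 : 0 < s) (hs1 : s < 1) (hα0 : 0 < α) (hα1 : α < 1) :
    ∃ K : ℝ, 0 < K ∧ ∀ F : ℝ × ℝ → ℝ, BC F → ∀ a : ℝ, 0 ≤ a →
    (∀ k₁ k₂ p, |pu (dker κ k₁) (pv (dker κ k₂) F) p| ≤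
      a * (((2 : ℝ) ^ k₁) ^ (-s) * ((2 : ℝ) ^ k₂) ^ (-α))) →
    ∀ y t, (∀ v, |F (y, v) - F (t, v)| ≤ K * a * |y - t| ^ s) ∧
      ∀ v w, |(F (y, v) - F (t, v)) - (F (y, w) - F (t, w))| ≤
        K * a * |y - t| ^ s * |v - w| ^ α := by
  obtain ⟨K1, K10, hK1⟩ := h.hold hs0 hs1
  obtain ⟨K2, K20, hK2⟩ := h.hold hα0 hα1
  refine ⟨K2 * K1, by positivity, fun F hF a a0 hFa y t => ?_⟩
  have e1 : ∀ k₂ v, |cv (dker κ k₂) (fun v => F (y, v) - F (t, v)) v| ≤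
      K1 * a * |y - t| ^ s * ((2 : ℝ) ^ k₂) ^ (-α) := by
    intro k₂ v
    rw [cv_sub_fun (h.dker_integ k₂) (hF.right y) (hF.right t)]
    have := (hK1 (fun u => pv (dker κ k₂) F (u, v)) ((hF.pv (h.dker_integ k₂)).left v)
      (a * ((2 : ℝ) ^ k₂) ^ (-α)) (by positivity) (fun k x => by
        rw [← pu_eq]; refine (hFa k k₂ (x, v)).trans (le_of_eq ?_); ring)).2 y t
    rw [pv_eq, pv_eq] at this
    refine this.trans (le_of_eq ?_); ring
  obtain ⟨f1, f2⟩ := hK2 (fun v => F (y, v) - F (t, v)) ((hF.right y).sub (hF.right t))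
    (K1 * a * |y - t| ^ s) (by positivity) e1
  refine ⟨fun v => (f1 v).trans (le_of_eq ?_), fun v w => (f2 v w).trans (le_of_eq ?_)⟩ <;> ring

lemma KP.estG (h : KP κ c C) {α : ℝ} (hα0 : 0 < α) (hα1 : α < 1) :
    ∃ K : ℝ, 0 < K ∧ ∀ G : ℝ × ℝ → ℝ, BC G → ∀ b β : ℝ, 0 ≤ b →
    (∀ k₁ k₂ p, |pu (dker κ k₁) (pv (dker κ k₂) G) p| ≤
      b * (((2 : ℝ) ^ k₁) ^ (-α) * ((2 : ℝ) ^ k₂) ^ β)) →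
    ∀ k t v, |cv (dker κ k) (fun v => G (t, v)) v| ≤ K * b * ((2 : ℝ) ^ k) ^ β := by
  obtain ⟨K1, K10, hK1⟩ := h.hold hα0 hα1
  refine ⟨K1, K10, fun G hG b β b0 hGb k t v => ?_⟩
  have := (hK1 (fun u => pv (dker κ k) G (u, v)) ((hG.pv (h.dker_integ k)).left v)
      (b * ((2 : ℝ) ^ k) ^ β) (by positivity) (fun k' x => by
        rw [← pu_eq]; refine (hGb k' k (x, v)).trans (le_of_eq ?_); ring)).1 t
  rw [pv_eq] at this
  refine this.trans (le_of_eq ?_); ring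

lemma KP.estH (h : KP κ c C) {α : ℝ} (hα0 : 0 < α) (hα1 : α < 1) :
    ∃ K : ℝ, 0 < K ∧ ∀ H : ℝ × ℝ → ℝ, BC H → ∀ d η : ℝ, 0 ≤ d →
    (∀ k₁ k₂ p, |pu (dker κ k₁) (pv (dker κ k₂) H) p| ≤
      d * (((2 : ℝ) ^ k₁) ^ η * ((2 : ℝ) ^ k₂) ^ (-α))) →
    ∀ m z, (∀ v, |pu (dker κ m) H (z, v)| ≤ K * d * ((2 : ℝ) ^ m) ^ η) ∧
      ∀ v w, |pu (dker κ m) H (z, v) - pu (dker κ m) H (z, w)| ≤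
        K * d * ((2 : ℝ) ^ m) ^ η * |v - w| ^ α := by
  obtain ⟨K1, K10, hK1⟩ := h.hold hα0 hα1
  refine ⟨K1, K10, fun H hH d η d0 hHd m z => ?_⟩
  obtain ⟨f1, f2⟩ := hK1 (fun v => pu (dker κ m) H (z, v)) ((hH.pu (h.dker_integ m)).right z)
      (d * ((2 : ℝ) ^ m) ^ η) (by positivity) (fun k x => by
        rw [← pv_eq, ← pu_pv (h.dker_integ m) (h.dker_integ k) hH]
        refine (hHd m k (z, x)).trans (le_of_eq ?_); ring)
  refine ⟨fun v => (f1 v).trans (le_of_eq ?_), fun v w => (f2 v w).trans (le_of_eq ?_)⟩ <;> ring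

/-- The trilinear bound in the second variable. -/
lemma KP.estT (h : KP κ c C) {s α β : ℝ} (hs0 : 0 < s) (hs1 : s < 1) (hβ0 : 0 < β) (hβα : β < α) (hα1 : α < 1) :
    ∃ K : ℝ, 0 < K ∧ ∀ F G H : ℝ × ℝ → ℝ, BC F → BC G → BC H → ∀ a b d η : ℝ,
    0 ≤ a → 0 ≤ b → 0 ≤ d →
    (∀ k₁ k₂ p, |pu (dker κ k₁) (pv (dker κ k₂) F) p| ≤
      a * (((2 : ℝ) ^ k₁) ^ (-s) * ((2 : ℝ) ^ k₂) ^ (-α))) →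
    (∀ k₁ k₂ p, |pu (dker κ k₁) (pv (dker κ k₂) G) p| ≤
      b * (((2 : ℝ) ^ k₁) ^ (-α) * ((2 : ℝ) ^ k₂) ^ β)) →
    (∀ k₁ k₂ p, |pu (dker κ k₁) (pv (dker κ k₂) H) p| ≤
      d * (((2 : ℝ) ^ k₁) ^ η * ((2 : ℝ) ^ k₂) ^ (-α))) →
    ∀ m k y y' t z v₀,
      |∫ v, dker κ k v * ((F (y, v₀ - v) - F (y', v₀ - v)) * pu (dker κ m) H (z, v₀ - v) *
        G (t, v₀ - v))| ≤
      K * (a * b * d) * (((2 : ℝ) ^ m) ^ η * ((2 : ℝ) ^ k) ^ β) * |y - y'| ^ s := by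
  have hα0 := hβ0.trans hβα
  obtain ⟨K1, K10, hK1⟩ := h.estF hs0 hs1 hα0 hα1
  obtain ⟨K2, K20, hK2⟩ := h.estG hα0 hα1
  obtain ⟨K3, K30, hK3⟩ := h.estH hα0 hα1
  obtain ⟨K4, K40, hK4⟩ := h.tri hβ0 hβα hα1
  refine ⟨K4 * (2 * K1 * K2 * K3), by positivity,
    fun F G H hF hG hH a b d η a0 b0 d0 hFa hGb hHd m k y y' t z v₀ => ?_⟩
  obtain ⟨f1, f2⟩ := hK1 F hF a a0 hFa y y'
  obtain ⟨g1, g2⟩ := hK3 H hH d η d0 hHd m z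
  have hg := hK2 G hG b β b0 hGb
  obtain ⟨p1, p2⟩ := hold_prod (f := fun v => F (y, v) - F (y', v))
    (g := fun v => pu (dker κ m) H (z, v)) (by positivity) (by positivity) f1 g1 f2 g2
  have := hK4 _ _ (((hF.right y).sub (hF.right y')).mul ((hH.pu (h.dker_integ m)).right z))
    (hG.right t) (2 * (K1 * a * |y - y'| ^ s * (K3 * d * ((2 : ℝ) ^ m) ^ η))) (K2 * b)
    (by positivity) (by positivity) p1 p2 (fun i x => hg i t x) k v₀
  refine this.trans (le_of_eq ?_); ring

end kernels3

end Part6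

section Part7
open Real MeasureTheory
open scoped ENNReal Classical NNReal

section kernels4
variable {κ : ℕ → ℝ → ℝ} {c C : ℝ}

/-- The single-scale estimate. -/
lemma KP.single (h : KP κ c C) {s α β : ℝ} (hs0 : 0 < s) (hs1 : s < 1) (hβ0 : 0 < β) (hβα : β < α)
    (hα1 : α < 1) :
    ∃ K : ℝ, 0 < K ∧ ∀ F G H : ℝ × ℝ → ℝ, BC F → BC G → BC H → ∀ a b d η : ℝ,
    0 ≤ a → 0 ≤ b → 0 ≤ d →
    (∀ k₁ k₂ p, |pu (dker κ k₁) (pv (dker κ k₂) F) p| ≤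
      a * (((2 : ℝ) ^ k₁) ^ (-s) * ((2 : ℝ) ^ k₂) ^ (-α))) →
    (∀ k₁ k₂ p, |pu (dker κ k₁) (pv (dker κ k₂) G) p| ≤
      b * (((2 : ℝ) ^ k₁) ^ (-α) * ((2 : ℝ) ^ k₂) ^ β)) →
    (∀ k₁ k₂ p, |pu (dker κ k₁) (pv (dker κ k₂) H) p| ≤
      d * (((2 : ℝ) ^ k₁) ^ η * ((2 : ℝ) ^ k₂) ^ (-α))) →
    ∀ m j k₁ k₂ p,
      |pu (dker κ k₁) (pv (dker κ k₂) (fun q =>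
        F q * pu (κ j) G q * pu (dker κ m) H q -
          pu (κ j) (fun q => F q * G q) q * pu (dker κ m) H q)) p| ≤
      K * (a * b * d) * (((2 : ℝ) ^ m) ^ η * ((2 : ℝ) ^ k₂) ^ β) *
        (min 1 (2 ^ k₁ / 2 ^ m) * ((2 : ℝ) ^ j) ^ (-s) + ((2 : ℝ) ^ m) ^ (-s) +
          ((2 : ℝ) ^ m)⁻¹ * (((2 : ℝ) ^ j) ^ (-s) * 2 ^ j)) := by
  obtain ⟨K1, K10, hK1⟩ := h.estT hs0 hs1 hβ0 hβα hα1
  obtain ⟨K2, K20, hK2⟩ := h.out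
  have C0 := h.C_pos
  refine ⟨K2 * (C * K1), by positivity,
    fun F G H hF hG hH a b d η a0 b0 d0 hFa hGb hHd m j k₁ k₂ p => ?_⟩
  have est := hK1 F G H hF hG hH a b d η a0 b0 d0 hFa hGb hHd m k₂
  set D := K1 * (a * b * d) * (((2 : ℝ) ^ m) ^ η * ((2 : ℝ) ^ k₂) ^ β) with hD
  have D0 : 0 ≤ D := by positivity
  obtain ⟨u₀, v₀⟩ := p
  set Hm := pu (dker κ m) H with hHm
  have hHmBC : BC Hm := hH.pu (h.dker_integ m)
  have hd2 := h.dker_integ k₂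
  have hκj := h.integ j
  -- the four-variable integrand
  set Φ : ℝ × ℝ × ℝ × ℝ → ℝ := fun q =>
    (F (q.1, v₀ - q.2.2.2) - F (q.2.1, v₀ - q.2.2.2)) * Hm (q.2.2.1, v₀ - q.2.2.2) *
      G (q.2.1, v₀ - q.2.2.2) with hΦ
  have hΦBC : BC Φ := by
    refine BC.mul (BC.mul (BC.sub (hF.comp ?_) (hF.comp ?_)) (hHmBC.comp ?_)) (hG.comp ?_) <;>
      fun_prop
  set T : ℝ × ℝ × ℝ → ℝ := fun q => ∫ v, dker κ k₂ v * Φ (q.1, q.2.1, q.2.2, v) with hT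
  have hTBC : BC T := BC.int hd2
    (B := fun q : (ℝ × ℝ × ℝ) × ℝ => Φ (q.1.1, q.1.2.1, q.1.2.2, q.2)) (hΦBC.comp (by fun_prop))
  have hT1 : ∀ z y t, |T (y, t, z)| ≤ D * |y - t| ^ s := fun z y t => est y t t z v₀
  have hT2 : ∀ z y y' t, |T (y, t, z) - T (y', t, z)| ≤ D * |y - y'| ^ s := by
    intro z y y' t
    refine le_trans (le_of_eq ?_) (est y y' t z v₀)
    simp only [hT]
    rw [← integral_sub (BC.integrable hd2 (hΦBC.comp (by fun_prop)))
      (BC.integrable hd2 (hΦBC.comp (by fun_prop)))]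
    congr 2; ext v; simp only [hΦ]; ring
  set B : ℝ × ℝ → ℝ := fun q => ∫ t, κ j t * T (q.1, q.1 - t, q.2) with hB
  have hBBC : BC B := BC.int hκj
    (B := fun q : (ℝ × ℝ) × ℝ => T (q.1.1, q.1.1 - q.2, q.1.2)) (hTBC.comp (by fun_prop))
  have hcomm := fun z => h.comm (T := fun q => T (q.1, q.2, z)) (hTBC.comp (by fun_prop))
    hs0 hs1 (hT1 z) (hT2 z) j
  have hrep : ∀ n, m = n + 2 → ∀ w y, ∫ τ, ktil κ n τ * B (w, y - τ) = c * B (w, y) := by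
    intro n hn w y
    have hki := h.ktil_integ n
    have s1 := swapInt hki hκj (B := fun q : ℝ × ℝ => T (w, w - q.2, y - q.1))
      (hTBC.comp (by fun_prop))
    have s2 : ∀ t, ∫ τ, ktil κ n τ * T (w, w - t, y - τ) = c * T (w, w - t, y) := by
      intro t
      have s3 := swapInt hki hd2 (B := fun q : ℝ × ℝ => Φ (w, w - t, y - q.1, q.2))
        (hΦBC.comp (by fun_prop))
      have s4 : ∀ v, ∫ τ, ktil κ n τ * Φ (w, w - t, y - τ, v) = c * Φ (w, w - t, y, v) := by
        intro v
        have := h.fat n (hH.left (v₀ - v)) y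
        subst hn
        have e1 : ∀ τ, ktil κ n τ * Φ (w, w - t, y - τ, v) =
            ((F (w, v₀ - v) - F (w - t, v₀ - v)) * G (w - t, v₀ - v)) *
              (ktil κ n τ * Hm (y - τ, v₀ - v)) := fun τ => by simp only [hΦ]; ring
        simp_rw [e1]
        rw [integral_const_mul]
        have e2 : ∫ τ, ktil κ n τ * Hm (y - τ, v₀ - v) = c * Hm (y, v₀ - v) := this
        rw [e2]
        simp only [hΦ]; ring
      simp only [s4] at s3
      simp only [hT]
      rw [s3, ← integral_const_mul]
      congr 1; ext v; ring
    simp only [s2] at s1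
    simp only [hB]
    rw [s1, ← integral_const_mul]
    congr 1; ext v; ring
  have hdiag : ∀ y, pv (dker κ k₂) (fun q =>
        F q * pu (κ j) G q * Hm q - pu (κ j) (fun q => F q * G q) q * Hm q) (y, v₀) = B (y, y) := by
    intro y
    have s1 := swapInt hκj hd2 (B := fun q : ℝ × ℝ => Φ (y, y - q.1, y, q.2))
      (hΦBC.comp (by fun_prop))
    simp only [hB, hT]
    rw [s1]
    unfold pv
    congr 1; ext w
    congr 1
    have e1 : ∀ t, κ j t * Φ (y, y - t, y, w) =
        F (y, v₀ - w) * Hm (y, v₀ - w) * (κ j t * G (y - t, v₀ - w)) -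
        Hm (y, v₀ - w) * (κ j t * (F (y - t, v₀ - w) * G (y - t, v₀ - w))) := fun t => by
      simp only [hΦ]; ring
    simp_rw [e1]
    rw [integral_sub ((BC.integrable hκj (hG.comp (by fun_prop))).const_mul _)
      ((BC.integrable hκj ((hF.comp (by fun_prop)).mul (hG.comp (by fun_prop)))).const_mul _),
      integral_const_mul, integral_const_mul]
    unfold pu
    dsimp only
    ring
  have key := hK2 B hBBC s (D * C * ((2 : ℝ) ^ j) ^ (-s)) (C * D)
    (C * D * (((2 : ℝ) ^ j) ^ (-s) * 2 ^ j)) hs0.le hs1.le (by positivity) (by positivity)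
    (fun q => ?_) (fun y z w => ?_) m hrep k₁ u₀
  · have e : pu (dker κ k₁) (pv (dker κ k₂) (fun q => F q * pu (κ j) G q * Hm q -
        pu (κ j) (fun q => F q * G q) q * Hm q)) (u₀, v₀) =
        ∫ y, dker κ k₁ y * B (u₀ - y, u₀ - y) := by
      simp only [← hdiag]; rfl
    rw [e]
    refine key.trans (le_of_eq ?_)
    rw [hD]; ring
  · exact (hcomm q.2).1 q.1
  · exact (hcomm w).2 y z

end kernels4

end Part7

section Part8
open Real MeasureTheory
open scoped ENNReal Classical NNReal

lemma numerics {x X J s σ β η δ : ℝ} (hx : 1 ≤ x) (hX : 1 ≤ X) (hJ : 0 < J)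
    (hJ1 : J ≤ x ^ (1 - σ)) (hJ2 : x ^ (1 - σ) ≤ 2 * J) (hs0 : 0 < s) (hs1 : s < 1)
    (hσ0 : 0 < σ) (hβ0 : 0 < β) (hβ1 : β < 1)
    (h1 : η - β - s * (1 - σ) ≤ -δ) (h2 : η - s ≤ -δ) :
    x ^ η * (min 1 (X / x) * J ^ (-s) + x ^ (-s) + x⁻¹ * (J ^ (-s) * J)) ≤
      4 * (X ^ β * x ^ (-δ)) := by
  have x0 : 0 < x := by linarith
  have X0 : 0 < X := by linarith
  have hXβ : 1 ≤ X ^ β := Real.one_le_rpow hX hβ0.le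
  have m1 : min 1 (X / x) ≤ X ^ β * x ^ (-β) := by
    have : min 1 (X / x) ≤ (X / x) ^ β := by
      have hq : 0 < X / x := by positivity
      rcases le_total (X / x) 1 with hh | hh
      · refine (min_le_right _ _).trans ?_
        calc X / x = (X / x) ^ (1 : ℝ) := (Real.rpow_one _).symm
          _ ≤ _ := Real.rpow_le_rpow_of_exponent_ge hq hh hβ1.le
      · exact (min_le_left _ _).trans (Real.one_le_rpow hh hβ0.le)
    refine this.trans (le_of_eq ?_)
    rw [Real.div_rpow X0.le x0.le, Real.rpow_neg x0.le, div_eq_mul_inv]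
  have j1 : J ^ (-s) ≤ 2 * x ^ (-(s * (1 - σ))) := by
    have : (2 * J) ^ (-s) ≤ (x ^ (1 - σ)) ^ (-s) :=
      Real.rpow_le_rpow_of_nonpos (by positivity) hJ2 (by linarith)
    rw [Real.mul_rpow (by norm_num) hJ.le, ← Real.rpow_mul x0.le, Real.rpow_neg (by norm_num : (0:ℝ) ≤ 2)] at this
    have h2s : (2 : ℝ) ^ s ≤ 2 := by
      calc (2 : ℝ) ^ s ≤ 2 ^ (1 : ℝ) := Real.rpow_le_rpow_of_exponent_le (by norm_num) hs1.le
        _ = 2 := Real.rpow_one _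
    have e : (1 - σ) * (-s) = -(s * (1 - σ)) := by ring
    rw [e, inv_mul_le_iff₀ (by positivity)] at this
    refine this.trans ?_
    gcongr
  have j2 : J ^ (-s) * J ≤ x ^ (1 - s) := by
    have e : J ^ (-s) * J = J ^ (1 - s) := by
      rw [sub_eq_neg_add, Real.rpow_add hJ, Real.rpow_one]
    rw [e]
    refine Real.rpow_le_rpow hJ.le (hJ1.trans ?_) (by linarith)
    calc x ^ (1 - σ) ≤ x ^ (1 : ℝ) := Real.rpow_le_rpow_of_exponent_le hx (by linarith)
      _ = x := Real.rpow_one _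
  have t1 : x ^ η * (min 1 (X / x) * J ^ (-s)) ≤ 2 * (X ^ β * x ^ (-δ)) := by
    calc _ ≤ x ^ η * ((X ^ β * x ^ (-β)) * (2 * x ^ (-(s * (1 - σ))))) := by gcongr
      _ = 2 * (X ^ β * x ^ (η - β - s * (1 - σ))) := by
        rw [sub_eq_add_neg _ (s * (1 - σ)), sub_eq_add_neg η, Real.rpow_add x0, Real.rpow_add x0]; ring
      _ ≤ _ := by gcongr
  have t2 : x ^ η * x ^ (-s) ≤ X ^ β * x ^ (-δ) := by
    rw [← Real.rpow_add x0, ← sub_eq_add_neg]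
    calc x ^ (η - s) ≤ x ^ (-δ) := Real.rpow_le_rpow_of_exponent_le hx h2
      _ ≤ _ := le_mul_of_one_le_left (by positivity) hXβ
  have t3 : x ^ η * (x⁻¹ * (J ^ (-s) * J)) ≤ X ^ β * x ^ (-δ) := by
    refine le_trans ?_ t2
    gcongr
    calc x⁻¹ * (J ^ (-s) * J) ≤ x⁻¹ * x ^ (1 - s) := by gcongr
      _ = x ^ (-s) := by
        rw [sub_eq_add_neg, Real.rpow_add x0, Real.rpow_one, inv_mul_cancel_left₀ x0.ne']
  linarith

lemma BC.finsum {E : Type*} [TopologicalSpace E] {ι : Type*} (S : Finset ι) {f : ι → E → ℝ}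
    (hf : ∀ i, BC (f i)) : BC (fun x => ∑ i ∈ S, f i x) := by
  choose D D0 hD using fun i => (hf i).bound_nonneg
  exact ⟨continuous_finsetSum _ fun i _ => (hf i).1, ∑ i ∈ S, D i, fun x =>
    (Finset.abs_sum_le_sum_abs _ _).trans (Finset.sum_le_sum fun i _ => hD i x)⟩

section kernels5
variable {κ : ℕ → ℝ → ℝ} {c C : ℝ}

lemma KP.main (h : KP κ c C) {s r r' σ : ℝ}
    (hs0 : 0 < s) (hs1 : s < 1)
    (_hr'0 : 0 < r') (hr'r : r' < r) (hr1 : r < 1)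
    (hsum : 1 < r' + s) (hσ0 : 0 < σ) (hσ1 : σ < 1)
    (hkey : (1 - σ) * (1 - r' - s) + r - s - σ < 0) :
    ∃ K : ℝ, 0 < K ∧ ∀ F G H : ℝ × ℝ → ℝ, BC F → BC G → BC H → ∀ a b d : ℝ,
    0 ≤ a → 0 ≤ b → 0 ≤ d →
    (∀ k₁ k₂ p, |pu (dker κ k₁) (pv (dker κ k₂) F) p| ≤
      a * (((2 : ℝ) ^ k₁) ^ (-s) * ((2 : ℝ) ^ k₂) ^ (-(1 - r')))) →
    (∀ k₁ k₂ p, |pu (dker κ k₁) (pv (dker κ k₂) G) p| ≤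
      b * (((2 : ℝ) ^ k₁) ^ (-(1 - r')) * ((2 : ℝ) ^ k₂) ^ (1 - r))) →
    (∀ k₁ k₂ p, |pu (dker κ k₁) (pv (dker κ k₂) H) p| ≤
      d * (((2 : ℝ) ^ k₁) ^ (1 - s - σ) * ((2 : ℝ) ^ k₂) ^ (-(1 - r')))) →
    ∀ J : ℕ → ℕ, (∀ m, (2 : ℝ) ^ J m ≤ ((2 : ℝ) ^ m) ^ (1 - σ)) →
    (∀ m, ((2 : ℝ) ^ m) ^ (1 - σ) ≤ 2 * (2 : ℝ) ^ J m) →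
    ∀ (S : Finset ℕ) k₁ k₂ p,
      |pu (dker κ k₁) (pv (dker κ k₂) (fun q => ∑ m ∈ S,
        (F q * pu (κ (J m)) G q * pu (dker κ m) H q -
          pu (κ (J m)) (fun q => F q * G q) q * pu (dker κ m) H q))) p| ≤
      K * (a * b * d) * (((2 : ℝ) ^ k₁) ^ (1 - r) * ((2 : ℝ) ^ k₂) ^ (1 - r)) := by
  have d1 : (1 - s - σ) - (1 - r) - s * (1 - σ) < 0 := by
    nlinarith [mul_pos (sub_pos.2 hσ1) (by linarith : 0 < 1 - r')]
  have d2 : (1 - s - σ) - s < 0 := by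
    nlinarith [mul_pos hσ0 (by linarith : 0 < r' + s - 1)]
  set δ := min (-((1 - s - σ) - (1 - r) - s * (1 - σ))) (-((1 - s - σ) - s)) with hδ
  have δ0 : 0 < δ := lt_min (by linarith) (by linarith)
  have hδ1 : δ ≤ -((1 - s - σ) - (1 - r) - s * (1 - σ)) := min_le_left _ _
  have hδ2 : δ ≤ -((1 - s - σ) - s) := min_le_right _ _
  obtain ⟨K1, K10, hK1⟩ := h.single (β := 1 - r) (α := 1 - r') hs0 hs1 (by linarith)
    (by linarith) (by linarith)
  obtain ⟨K2, K20, hK2⟩ := geo_dec δ0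
  refine ⟨K1 * (4 * K2), by positivity,
    fun F G H hF hG hH a b d a0 b0 d0 hFa hGb hHd J hJ1 hJ2 S k₁ k₂ p => ?_⟩
  have hterm := hK1 F G H hF hG hH a b d (1 - s - σ) a0 b0 d0 hFa hGb hHd
  set Ψ : ℕ → ℝ × ℝ → ℝ := fun m q => F q * pu (κ (J m)) G q * pu (dker κ m) H q -
          pu (κ (J m)) (fun q => F q * G q) q * pu (dker κ m) H q with hΨ
  have hΨBC : ∀ m, BC (Ψ m) := fun m =>
    ((hF.mul (hG.pu (h.integ _))).mul (hH.pu (h.dker_integ m))).sub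
      (((hF.mul hG).pu (h.integ _)).mul (hH.pu (h.dker_integ m)))
  have e1 : pv (dker κ k₂) (fun q => ∑ m ∈ S, Ψ m q) = fun q => ∑ m ∈ S, pv (dker κ k₂) (Ψ m) q := by
    ext ⟨u, v⟩
    exact cv_sum (h.dker_integ k₂) S (fun m => (hΨBC m).right u) v
  have e2 : pu (dker κ k₁) (fun q => ∑ m ∈ S, pv (dker κ k₂) (Ψ m) q) p =
      ∑ m ∈ S, pu (dker κ k₁) (pv (dker κ k₂) (Ψ m)) p := by
    obtain ⟨u, v⟩ := p
    exact cv_sum (h.dker_integ k₁) S (fun m => ((hΨBC m).pv (h.dker_integ k₂)).left v) u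
  rw [e1, e2]
  calc _ ≤ ∑ m ∈ S, |pu (dker κ k₁) (pv (dker κ k₂) (Ψ m)) p| := Finset.abs_sum_le_sum_abs _ _
    _ ≤ ∑ m ∈ S, (K1 * (a * b * d) * ((2 : ℝ) ^ k₂) ^ (1 - r)) *
        (4 * (((2 : ℝ) ^ k₁) ^ (1 - r) * ((2 : ℝ) ^ m) ^ (-δ))) := by
      refine Finset.sum_le_sum fun m _ => (hterm m (J m) k₁ k₂ p).trans ?_
      have := numerics (x := 2 ^ m) (X := 2 ^ k₁) (J := 2 ^ J m) (one_le_pow₀ (by norm_num))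
        (one_le_pow₀ (by norm_num)) (by positivity) (hJ1 m) (hJ2 m) hs0 hs1 hσ0
        (by linarith : 0 < 1 - r) (by linarith) (η := 1 - s - σ) (δ := δ) (by linarith) (by linarith)
      have := mul_le_mul_of_nonneg_left this
        (by positivity : 0 ≤ K1 * (a * b * d) * ((2 : ℝ) ^ k₂) ^ (1 - r))
      refine le_trans (le_of_eq ?_) this
      ring
    _ = (K1 * (a * b * d) * ((2 : ℝ) ^ k₂) ^ (1 - r)) * (4 * ((2 : ℝ) ^ k₁) ^ (1 - r)) *
        ∑ m ∈ S, ((2 : ℝ) ^ m) ^ (-δ) := by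
      rw [Finset.mul_sum]; refine Finset.sum_congr rfl fun m _ => ?_; ring
    _ ≤ (K1 * (a * b * d) * ((2 : ℝ) ^ k₂) ^ (1 - r)) * (4 * ((2 : ℝ) ^ k₁) ^ (1 - r)) * K2 := by
      gcongr; exact hK2 S
    _ = _ := by ring

/-- A bounded continuous function all of whose pieces vanish is zero. -/
lemma KP.zero1 (h : KP κ c C) {f : ℝ → ℝ} (hf : BC f) (h0 : ∀ k x, cv (dker κ k) f x = 0) (x : ℝ) : f x = 0 := by
  have e : ∀ n, ∫ y, κ n y * f (x - y) = 0 := fun n => by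
    have := h.sum_dker n hf x
    simp only [h0, Finset.sum_const_zero] at this
    exact this.symm
  have := h.tends f hf x
  simp only [e] at this
  have := tendsto_nhds_unique this tendsto_const_nhds
  exact (mul_eq_zero.1 this).resolve_left h.c_pos.ne'

lemma KP.zero2 (h : KP κ c C) {F : ℝ × ℝ → ℝ} (hF : BC F)
    (h0 : ∀ k₁ k₂ p, pu (dker κ k₁) (pv (dker κ k₂) F) p = 0) : F = fun _ => 0 := by
  ext ⟨u, v⟩
  refine h.zero1 (hF.right u) (fun k v => ?_) v
  exact h.zero1 ((hF.pv (h.dker_integ k)).left v) (fun k₁ x => h0 k₁ k (x, v)) u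

end kernels5

end Part8

lemma CbSmooth.bc {F : ℝ × ℝ → ℝ} (hF : CbSmooth F) : BC F := by
  refine ⟨hF.1.continuous, ?_⟩
  obtain ⟨D, hD⟩ := hF.2 0
  refine ⟨D, fun x => ?_⟩
  have := hD x
  rwa [norm_iteratedFDeriv_zero, Real.norm_eq_abs] at this

lemma LPu_eq_pu {ρ : ℝ → ℝ} (hρ : IsLPCutoff ρ) (k : ℕ) (F : ℝ × ℝ → ℝ) :
    LPu ρ k F = pu (dker (kap ρ) k) F := by
  rw [← lpKernel_eq hρ]; rfl

lemma LPv_eq_pv {ρ : ℝ → ℝ} (hρ : IsLPCutoff ρ) (k : ℕ) (F : ℝ × ℝ → ℝ) :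
    LPv ρ k F = pv (dker (kap ρ) k) F := by
  rw [← lpKernel_eq hρ]; rfl

lemma LPuLe_eq {ρ : ℝ → ℝ} (hρ : IsLPCutoff ρ) {c C : ℝ} (h : KP (kap ρ) c C) {L : ℝ} {j : ℕ}
    (h1 : (2 : ℝ) ^ j ≤ L) (h2 : L < 2 ^ (j + 1)) {F : ℝ × ℝ → ℝ} (hF : BC F) (p : ℝ × ℝ) :
    LPuLe ρ L F p = pu (kap ρ j) F p := by
  unfold LPuLe
  have hiff : ∀ l : ℕ, (2 : ℝ) ^ l ≤ L ↔ l ∈ Finset.range (j + 1) := by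
    intro l
    rw [Finset.mem_range]
    constructor
    · intro hl
      exact (pow_lt_pow_iff_right₀ (by norm_num : (1 : ℝ) < 2)).1 (hl.trans_lt h2)
    · intro hl
      exact (pow_le_pow_right₀ (by norm_num) (by omega)).trans h1
  rw [tsum_eq_sum (s := Finset.range (j + 1)) (fun l hl => if_neg (fun hh => hl ((hiff l).1 hh)))]
  rw [Finset.sum_congr rfl (fun l hl => if_pos ((hiff l).2 hl))]
  simp_rw [LPu_eq_pu hρ]
  obtain ⟨u, v⟩ := p
  exact h.sum_dker j (hF.left v) u

lemma hNorm2_bd {ρ : ℝ → ℝ} {γ₁ γ₂ : ℝ} {F : ℝ × ℝ → ℝ} (hN : hNorm2 ρ γ₁ γ₂ F ≠ ∞)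
    (k₁ k₂ : ℕ) (p : ℝ × ℝ) : |LPu ρ k₁ (LPv ρ k₂ F) p| ≤
      (hNorm2 ρ γ₁ γ₂ F).toReal * (((2 : ℝ) ^ k₁) ^ (-γ₁) * ((2 : ℝ) ^ k₂) ^ (-γ₂)) := by
  have w0 : 0 < ((2 : ℝ) ^ k₁) ^ γ₁ * ((2 : ℝ) ^ k₂) ^ γ₂ := by positivity
  have h1 : ENNReal.ofReal (((2 : ℝ) ^ k₁) ^ γ₁ * ((2 : ℝ) ^ k₂) ^ γ₂) *
      ENNReal.ofReal |LPu ρ k₁ (LPv ρ k₂ F) p| ≤ hNorm2 ρ γ₁ γ₂ F := by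
    unfold hNorm2
    refine le_trans ?_ (le_iSup₂ k₁ k₂)
    gcongr
    exact le_iSup (fun p => ENNReal.ofReal |LPu ρ k₁ (LPv ρ k₂ F) p|) p
  rw [← ENNReal.ofReal_mul w0.le, ENNReal.ofReal_le_iff_le_toReal hN] at h1
  rw [Real.rpow_neg (by positivity), Real.rpow_neg (by positivity), ← mul_inv, ← div_eq_mul_inv,
    le_div_iff₀ w0]
  linarith

lemma hNorm2_le {ρ : ℝ → ℝ} {γ₁ γ₂ : ℝ} {F : ℝ × ℝ → ℝ} {A : ℝ} (A0 : 0 ≤ A)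
    (hA : ∀ k₁ k₂ p, |LPu ρ k₁ (LPv ρ k₂ F) p| ≤
      A * (((2 : ℝ) ^ k₁) ^ (-γ₁) * ((2 : ℝ) ^ k₂) ^ (-γ₂))) :
    hNorm2 ρ γ₁ γ₂ F ≤ ENNReal.ofReal A := by
  unfold hNorm2
  refine iSup₂_le fun k₁ k₂ => ?_
  rw [ENNReal.mul_iSup]
  refine iSup_le fun p => ?_
  have w0 : 0 < ((2 : ℝ) ^ k₁) ^ γ₁ * ((2 : ℝ) ^ k₂) ^ γ₂ := by positivity
  rw [← ENNReal.ofReal_mul w0.le]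
  refine ENNReal.ofReal_le_ofReal ?_
  have := hA k₁ k₂ p
  rw [Real.rpow_neg (by positivity), Real.rpow_neg (by positivity), ← mul_inv, ← div_eq_mul_inv,
    le_div_iff₀ w0] at this
  linarith

lemma hNorm2_zero (ρ : ℝ → ℝ) (γ₁ γ₂ : ℝ) : hNorm2 ρ γ₁ γ₂ (fun _ => 0) = 0 := by
  refine le_antisymm ?_ bot_le
  have := hNorm2_le (ρ := ρ) (γ₁ := γ₁) (γ₂ := γ₂) (F := fun _ => 0) le_rfl (fun k₁ k₂ p => by
    simp [LPu, LPv])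
  simpa using this

lemma eq_zero_of_hNorm2 {ρ : ℝ → ℝ} (hρ : IsLPCutoff ρ) {c C : ℝ} (h : KP (kap ρ) c C)
    {γ₁ γ₂ : ℝ} {F : ℝ × ℝ → ℝ} (hF : BC F) (hN : hNorm2 ρ γ₁ γ₂ F = 0) : F = fun _ => 0 := by
  refine h.zero2 hF fun k₁ k₂ p => ?_
  have := hNorm2_bd (hN ▸ ENNReal.zero_ne_top) k₁ k₂ p
  rw [hN, ENNReal.toReal_zero, zero_mul, LPu_eq_pu hρ, LPv_eq_pv hρ] at this
  exact abs_eq_zero.1 (le_antisymm this (abs_nonneg _))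

/-- **Corollary 2.12: commutator estimate for the modified low×high paraproduct.**
For parameters `0 < s < 1`, `0 < r′ < r < 1`, `r′ + s > 1`, `σ ∈ (0,1)` with
`(1−σ)(1−r′−s) + r − s − σ < 0`, one has
`‖F (G ⪅_σ^u H) − (F G) ⪅_σ^u H‖_{C_u^{r−1}C_v^{r−1}}
  ≲ ‖F‖_{C_u^{s}C_v^{1−r′}} ‖G‖_{C_u^{1−r′}C_v^{r−1}} ‖H‖_{C_u^{s−1+σ}C_v^{1−r′}}`. -/
theorem commutator_modified_paraproduct
    (ρ : ℝ → ℝ) (hρ : IsLPCutoff ρ)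
    (s r r' σ : ℝ)
    (hs0 : 0 < s) (hs1 : s < 1)
    (hr'0 : 0 < r') (hr'r : r' < r) (hr1 : r < 1)
    (hsum : 1 < r' + s) (hσ0 : 0 < σ) (hσ1 : σ < 1)
    (hkey : (1 - σ) * (1 - r' - s) + r - s - σ < 0) :
    ∃ C : ℝ≥0∞, C ≠ ∞ ∧ ∀ F G H : ℝ × ℝ → ℝ,
      CbSmooth F → CbSmooth G → CbSmooth H → ∀ S : Finset ℕ,
        hNorm2 ρ (r - 1) (r - 1)
            (fun p => ∑ m ∈ S,
              (F p * LPuLe ρ (((2 : ℝ) ^ m) ^ (1 - σ)) G p * LPu ρ m H p -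
                LPuLe ρ (((2 : ℝ) ^ m) ^ (1 - σ)) (fun q => F q * G q) p * LPu ρ m H p)) ≤
          C * hNorm2 ρ s (1 - r') F * hNorm2 ρ (1 - r') (r - 1) G *
            hNorm2 ρ (s - 1 + σ) (1 - r') H := by
  obtain ⟨c, C, h⟩ := kp_exists hρ
  obtain ⟨K, K0, hK⟩ := h.main hs0 hs1 hr'0 hr'r hr1 hsum hσ0 hσ1 hkey
  refine ⟨ENNReal.ofReal K, ENNReal.ofReal_ne_top, fun F G H hF hG hH S => ?_⟩
  have hF := hF.bc
  have hG := hG.bc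
  have hH := hH.bc
  have hex : ∀ m : ℕ, ∃ j : ℕ, (2 : ℝ) ^ j ≤ ((2 : ℝ) ^ m) ^ (1 - σ) ∧
      ((2 : ℝ) ^ m) ^ (1 - σ) < 2 ^ (j + 1) := fun m =>
    exists_nat_pow_near (Real.one_le_rpow (one_le_pow₀ (by norm_num)) (by linarith)) (by norm_num)
  choose J hJ1 hJ2 using hex
  have hfun : (fun p => ∑ m ∈ S,
      (F p * LPuLe ρ (((2 : ℝ) ^ m) ^ (1 - σ)) G p * LPu ρ m H p -
        LPuLe ρ (((2 : ℝ) ^ m) ^ (1 - σ)) (fun q => F q * G q) p * LPu ρ m H p)) =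
      fun p => ∑ m ∈ S,
        (F p * pu (kap ρ (J m)) G p * pu (dker (kap ρ) m) H p -
          pu (kap ρ (J m)) (fun q => F q * G q) p * pu (dker (kap ρ) m) H p) := by
    ext p
    refine Finset.sum_congr rfl fun m _ => ?_
    rw [LPuLe_eq hρ h (hJ1 m) (hJ2 m) hG, LPuLe_eq hρ h (hJ1 m) (hJ2 m) (hF.mul hG),
      LPu_eq_pu hρ]
  rw [hfun]
  have hKne : ENNReal.ofReal K ≠ 0 := (ENNReal.ofReal_pos.2 K0).ne'
  by_cases zF : hNorm2 ρ s (1 - r') F = 0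
  · have := eq_zero_of_hNorm2 hρ h hF zF
    subst this
    simp [pu, hNorm2_zero]
  by_cases zG : hNorm2 ρ (1 - r') (r - 1) G = 0
  · have := eq_zero_of_hNorm2 hρ h hG zG
    subst this
    simp [pu, hNorm2_zero]
  by_cases zH : hNorm2 ρ (s - 1 + σ) (1 - r') H = 0
  · have := eq_zero_of_hNorm2 hρ h hH zH
    subst this
    simp [pu, hNorm2_zero]
  by_cases tF : hNorm2 ρ s (1 - r') F = ∞
  · rw [tF, ENNReal.mul_top hKne, ENNReal.top_mul zG, ENNReal.top_mul zH]; exact le_top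
  by_cases tG : hNorm2 ρ (1 - r') (r - 1) G = ∞
  · rw [tG, ENNReal.mul_top (mul_ne_zero hKne zF), ENNReal.top_mul zH]; exact le_top
  by_cases tH : hNorm2 ρ (s - 1 + σ) (1 - r') H = ∞
  · rw [tH, ENNReal.mul_top (mul_ne_zero (mul_ne_zero hKne zF) zG)]; exact le_top
  have bF := hNorm2_bd tF
  have bG := hNorm2_bd tG
  have bH := hNorm2_bd tH
  have eH : -(s - 1 + σ) = 1 - s - σ := by ring
  simp only [LPu_eq_pu hρ, LPv_eq_pv hρ, neg_sub r 1, eH] at bF bG bH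
  have := hK F G H hF hG hH _ _ _ ENNReal.toReal_nonneg ENNReal.toReal_nonneg
    ENNReal.toReal_nonneg bF bG bH J hJ1 (fun m => by
      have := (hJ2 m).le
      rwa [pow_succ, mul_comm] at this) S
  refine (hNorm2_le (A := K * ((hNorm2 ρ s (1 - r') F).toReal *
    (hNorm2 ρ (1 - r') (r - 1) G).toReal * (hNorm2 ρ (s - 1 + σ) (1 - r') H).toReal))
    (by positivity) (fun k₁ k₂ p => ?_)).trans (le_of_eq ?_)
  · rw [LPu_eq_pu hρ, LPv_eq_pv hρ, neg_sub]
    exact this k₁ k₂ p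
  · rw [ENNReal.ofReal_mul K0.le, ENNReal.ofReal_mul (by positivity),
      ENNReal.ofReal_mul (by positivity), ENNReal.ofReal_toReal tF, ENNReal.ofReal_toReal tG,
      ENNReal.ofReal_toReal tH]
    ring
end
end

section
/- Trace estimate (Lemma 2.18). Let α, β ∈ ℝ∖{0} and γ ∈ ℝ, let F: ℝ² → ℝ be C_b^∞, and define Tr F: ℝ → ℝ by (Tr F)(x) := F(x,x). Assume either (i) γ ≤ min(α, β) and α + β > 0, or (ii) γ ≤ min(α, β, α+β) and P_M^u P_N^v F = 0 for all pairs of dyadic scales with M ∼ N. Then ‖Tr F‖_{C^γ} ≤ C‖F‖_{C_u^{α}C_v^{β}}, with a constant C depending only on α, β, γ. -/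
noncomputable section

open Real MeasureTheory
open scoped ENNReal Classical NNReal

open Filter Topology

open FourierTransform in
/-- The kernel of a smooth compactly supported function is a rescaled Fourier transform. -/
lemma kernel_eq_fourier (g : ℝ → ℝ) (hc : HasCompactSupport g) (hs : ContDiff ℝ (⊤ : ℕ∞) g) :
    ∃ φ : SchwartzMap ℝ ℂ, (∀ x, φ x = (g x : ℂ)) ∧
      ∀ x, (∫ ξ : ℝ, Real.cos (x * ξ) * g ξ) = ((𝓕 φ : SchwartzMap ℝ ℂ) (x / (2 * π))).re := by
  have hc' : HasCompactSupport (fun x => (g x : ℂ)) := hc.comp_left (g := fun y : ℝ => (y : ℂ)) (by simp)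
  have hs' : ContDiff ℝ (⊤ : ℕ∞) (fun x => (g x : ℂ)) := Complex.ofRealCLM.contDiff.comp hs
  refine ⟨hc'.toSchwartzMap hs', fun x => rfl, fun x => ?_⟩
  rw [SchwartzMap.fourier_coe, fourier_real_eq_integral_exp_smul]
  have hexpint : Integrable (fun v : ℝ => Complex.exp (↑(-2 * π * v * (x / (2 * π))) * Complex.I) •
      (hc'.toSchwartzMap hs') v) := by
    have h0 : Integrable (fun v : ℝ => (hc'.toSchwartzMap hs') v) := SchwartzMap.integrable _
    refine h0.bdd_mul (c := 1) ?_ ?_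
    · exact Continuous.aestronglyMeasurable (by fun_prop)
    · filter_upwards with v
      rw [Complex.norm_exp_ofReal_mul_I]
  rw [show (∀ z : ℂ, z.re = RCLike.re z) from fun _ => rfl, ← integral_re hexpint]
  congr 1; ext v
  have : (hc'.toSchwartzMap hs') v = (g v : ℂ) := rfl
  rw [this]
  have h2 : -2 * π * v * (x / (2 * π)) = -(x * v) := by field_simp
  rw [h2]
  simp only [smul_eq_mul, RCLike.re_to_complex, Complex.mul_re, Complex.ofReal_re, Complex.ofReal_im,
    mul_zero, sub_zero, Complex.exp_ofReal_mul_I_re, Real.cos_neg]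

lemma invFourier_even (g : ℝ → ℝ) (x : ℝ) : invFourier g (-x) = invFourier g x := by
  simp [invFourier]

lemma invFourier_cont (g : ℝ → ℝ) (hc : HasCompactSupport g) (hs : ContDiff ℝ (⊤ : ℕ∞) g) :
    Continuous (invFourier g) := by
  obtain ⟨φ, _, h⟩ := kernel_eq_fourier g hc hs
  unfold invFourier
  simp_rw [h]
  have := (FourierTransform.fourier φ : SchwartzMap ℝ ℂ).continuous
  fun_prop

lemma invFourier_integrable (g : ℝ → ℝ) (hc : HasCompactSupport g) (hs : ContDiff ℝ (⊤ : ℕ∞) g) :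
    Integrable (invFourier g) := by
  obtain ⟨φ, _, h⟩ := kernel_eq_fourier g hc hs
  unfold invFourier
  simp_rw [h]
  have := (FourierTransform.fourier φ : SchwartzMap ℝ ℂ).integrable (μ := volume)
  exact ((this.comp_div (by positivity : (2 * π) ≠ 0)).re).const_mul _

lemma invFourier_bdd (g : ℝ → ℝ) (hc : HasCompactSupport g) (hs : ContDiff ℝ (⊤ : ℕ∞) g) :
    ∃ B, ∀ x, |invFourier g x| ≤ B := by
  refine ⟨(Real.sqrt (2 * π))⁻¹ * ∫ ξ, |g ξ|, fun x => ?_⟩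
  unfold invFourier
  rw [abs_mul, abs_of_nonneg (by positivity)]
  gcongr
  refine (norm_integral_le_integral_norm (fun ξ : ℝ => Real.cos (x * ξ) * g ξ)).trans ?_
  have hi : Integrable g := hs.continuous.integrable_of_hasCompactSupport hc
  refine integral_mono_of_nonneg (Eventually.of_forall fun t => norm_nonneg _) hi.norm
    (Eventually.of_forall fun t => ?_)
  simp only [norm_mul, Real.norm_eq_abs]
  exact mul_le_of_le_one_left (abs_nonneg _) (Real.abs_cos_le_one _)

open FourierTransform in
/-- Fourier inversion in the cosine normalization. -/
lemma invFourier_inversion (g : ℝ → ℝ) (hc : HasCompactSupport g) (hs : ContDiff ℝ (⊤ : ℕ∞) g)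
    (he : ∀ x, g (-x) = g x) (θ : ℝ) :
    ∫ y, invFourier g y * Real.cos (y * θ) = Real.sqrt (2 * π) * g θ := by
  obtain ⟨φ, hφ, h⟩ := kernel_eq_fourier g hc hs
  unfold invFourier
  simp_rw [h]
  have hφe : ∀ w, (𝓕 φ : SchwartzMap ℝ ℂ) (-w) = (𝓕 φ : SchwartzMap ℝ ℂ) w := by
    intro w
    rw [SchwartzMap.fourier_coe, fourier_real_eq_integral_exp_smul, fourier_real_eq_integral_exp_smul,
      ← integral_neg_eq_self]
    congr 1; ext v
    rw [hφ, hφ, he]; congr 3; push_cast; ring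
  have inv : ((g θ : ℝ) : ℂ) = (𝓕⁻ (𝓕 φ : SchwartzMap ℝ ℂ) : SchwartzMap ℝ ℂ) θ := by
    rw [FourierTransform.fourierInv_fourier_eq, hφ]
  set ψ := (𝓕 φ : SchwartzMap ℝ ℂ)
  have hψ : Integrable (fun w => ψ w) := SchwartzMap.integrable _
  have hexpint : Integrable (fun v : ℝ => Complex.exp (↑(2 * π * v * θ) * Complex.I) • ψ v) := by
    refine hψ.bdd_mul (c := 1) ?_ ?_
    · exact Continuous.aestronglyMeasurable (by fun_prop)
    · filter_upwards with v
      rw [Complex.norm_exp_ofReal_mul_I]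
  rw [SchwartzMap.fourierInv_coe, Real.fourierInv_eq'] at inv
  have inv2 : ((g θ : ℝ) : ℂ) = ∫ v : ℝ, Complex.exp (↑(2 * π * v * θ) * Complex.I) • ψ v := by
    rw [inv]; congr 1; ext v; congr 3; simp; ring
  have inv3 : g θ = ∫ v : ℝ, (Real.cos (2 * π * v * θ) * (ψ v).re - Real.sin (2 * π * v * θ) * (ψ v).im) := by
    have := congrArg RCLike.re inv2
    rw [← integral_re hexpint] at this
    rw [show g θ = RCLike.re ((g θ : ℝ) : ℂ) from rfl, this]
    congr 1; ext v
    simp only [smul_eq_mul, RCLike.re_to_complex, Complex.mul_re, Complex.exp_ofReal_mul_I_re,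
      Complex.exp_ofReal_mul_I_im]
  have hi1 : Integrable (fun v : ℝ => Real.cos (2 * π * v * θ) * (ψ v).re) :=
    hψ.re.bdd_mul (c := 1) (Continuous.aestronglyMeasurable (by fun_prop))
      (Eventually.of_forall fun v => Real.abs_cos_le_one _)
  have hi2 : Integrable (fun v : ℝ => Real.sin (2 * π * v * θ) * (ψ v).im) :=
    hψ.im.bdd_mul (c := 1) (Continuous.aestronglyMeasurable (by fun_prop))
      (Eventually.of_forall fun v => Real.abs_sin_le_one _)
  have hz : ∫ v : ℝ, Real.sin (2 * π * v * θ) * (ψ v).im = 0 := by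
    have h1 := integral_neg_eq_self (μ := volume) (fun v : ℝ => Real.sin (2 * π * v * θ) * (ψ v).im)
    have h2 : (fun v : ℝ => Real.sin (2 * π * (-v) * θ) * (ψ (-v)).im)
       = fun v => - (Real.sin (2 * π * v * θ) * (ψ v).im) := by
      ext v
      rw [hφe, show 2 * π * (-v) * θ = - (2 * π * v * θ) by ring, Real.sin_neg]; ring
    beta_reduce at h1
    rw [h2, integral_neg] at h1
    linarith
  rw [integral_sub hi1 hi2, hz, sub_zero] at inv3
  rw [inv3]
  have h3 := Measure.integral_comp_div (fun v : ℝ => Real.cos (2 * π * v * θ) * (ψ v).re) (2 * π)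
  rw [abs_of_pos (by positivity : 0 < 2 * π), smul_eq_mul] at h3
  have h4 : Real.sqrt (2 * π) = (Real.sqrt (2 * π))⁻¹ * (2 * π) := by
    have : 0 < Real.sqrt (2 * π) := by positivity
    field_simp
    rw [Real.sq_sqrt (by positivity)]
  conv_rhs => rw [h4]
  rw [mul_assoc, ← h3, ← integral_const_mul]
  congr 1; ext y
  rw [show 2 * π * (y / (2 * π)) * θ = y * θ by field_simp]
  ring


section symbol
variable {ρ : ℝ → ℝ}

lemma rho_cs (hρ : IsLPCutoff ρ) : HasCompactSupport ρ := by
  refine HasCompactSupport.of_support_subset_isCompact (isCompact_Icc (a := (-2 : ℝ)) (b := 2)) ?_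
  intro x hx
  by_contra h
  apply hx
  apply hρ.eq_zero
  by_contra h2
  push Not at h2
  have := abs_lt.1 h2
  apply h
  constructor <;> linarith [this.1, this.2]

lemma sym_smooth (hρ : IsLPCutoff ρ) (k : ℕ) : ContDiff ℝ (⊤ : ℕ∞) (lpSymbol ρ k) := by
  have := hρ.smooth
  cases k with
  | zero => exact this
  | succ k =>
    exact (this.comp (contDiff_id.div_const _)).sub
      (this.comp ((contDiff_const.mul contDiff_id).div_const _))

lemma sym_even (hρ : IsLPCutoff ρ) (k : ℕ) (ξ : ℝ) : lpSymbol ρ k (-ξ) = lpSymbol ρ k ξ := by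
  cases k with
  | zero => exact hρ.even ξ
  | succ k =>
    simp only [lpSymbol]
    rw [neg_div, hρ.even, mul_neg, neg_div, hρ.even]

lemma sym_upper (hρ : IsLPCutoff ρ) (k : ℕ) (ξ : ℝ) (h : lpSymbol ρ k ξ ≠ 0) :
    |ξ| < 9 / 8 * 2 ^ k := by
  by_contra h2
  push Not at h2
  apply h
  cases k with
  | zero => exact hρ.eq_zero ξ (by simpa using h2)
  | succ k =>
    have hp : (0 : ℝ) < 2 ^ (k + 1) := by positivity
    simp only [lpSymbol]
    rw [hρ.eq_zero, hρ.eq_zero, sub_zero]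
    · rw [abs_div, abs_of_pos hp, le_div_iff₀ hp, abs_mul, abs_two]
      linarith [abs_nonneg ξ]
    · rw [abs_div, abs_of_pos hp, le_div_iff₀ hp]
      linarith

lemma sym_lower (hρ : IsLPCutoff ρ) (k : ℕ) (hk : k ≠ 0) (ξ : ℝ) (h : lpSymbol ρ k ξ ≠ 0) :
    7 / 16 * 2 ^ k < |ξ| := by
  by_contra h2
  push Not at h2
  apply h
  cases k with
  | zero => exact absurd rfl hk
  | succ k =>
    have hp : (0 : ℝ) < 2 ^ (k + 1) := by positivity
    simp only [lpSymbol]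
    rw [hρ.eq_one, hρ.eq_one, sub_self]
    · rw [abs_div, abs_of_pos hp, div_le_iff₀ hp, abs_mul, abs_two]
      linarith [abs_nonneg ξ]
    · rw [abs_div, abs_of_pos hp, div_le_iff₀ hp]
      linarith

lemma sym_cs (hρ : IsLPCutoff ρ) (k : ℕ) : HasCompactSupport (lpSymbol ρ k) := by
  refine HasCompactSupport.of_support_subset_isCompact
    (isCompact_Icc (a := (-(9 / 8 * 2 ^ k) : ℝ)) (b := 9 / 8 * 2 ^ k)) ?_
  intro x hx
  have := abs_lt.1 (sym_upper hρ k x hx)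
  exact ⟨this.1.le, this.2.le⟩

lemma ker_cont (hρ : IsLPCutoff ρ) (k : ℕ) : Continuous (lpKernel ρ k) :=
  invFourier_cont _ (sym_cs hρ k) (sym_smooth hρ k)

lemma ker_int (hρ : IsLPCutoff ρ) (k : ℕ) : Integrable (lpKernel ρ k) :=
  invFourier_integrable _ (sym_cs hρ k) (sym_smooth hρ k)

/-- The rescaled low-frequency kernel. -/
def sk (ρ : ℝ → ℝ) (L : ℕ) (x : ℝ) : ℝ := 2 ^ L * invFourier ρ (2 ^ L * x)

lemma sk_int (hρ : IsLPCutoff ρ) (L : ℕ) : Integrable (sk ρ L) :=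
  ((invFourier_integrable _ (rho_cs hρ) hρ.smooth).comp_mul_left' (by positivity)).const_mul _

lemma sk_norm (ρ : ℝ → ℝ) (L : ℕ) : ∫ x, |sk ρ L x| = ∫ x, |invFourier ρ x| := by
  unfold sk
  have := Measure.integral_comp_mul_left (fun x => |invFourier ρ x|) ((2 : ℝ) ^ L)
  simp_rw [abs_mul]
  rw [integral_const_mul, this, abs_inv]
  simp

lemma sk_eq (ρ : ℝ → ℝ) (L : ℕ) (x : ℝ) :
    invFourier (fun ξ => ρ (ξ / 2 ^ L)) x = sk ρ L x := by
  unfold sk invFourier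
  have := Measure.integral_comp_div (fun η => Real.cos (2 ^ L * x * η) * ρ η) ((2 : ℝ) ^ L)
  rw [abs_of_pos (by positivity), smul_eq_mul] at this
  rw [mul_left_comm, ← this]
  congr 2; ext ξ
  congr 2; field_simp

lemma ker_succ (hρ : IsLPCutoff ρ) (k : ℕ) (x : ℝ) :
    lpKernel ρ (k + 1) x = sk ρ (k + 1) x - sk ρ k x := by
  rw [← sk_eq, ← sk_eq]
  unfold lpKernel invFourier
  have hi : Integrable ρ := hρ.smooth.continuous.integrable_of_hasCompactSupport (rho_cs hρ)
  have hj : ∀ L : ℕ, Integrable (fun ξ => Real.cos (x * ξ) * ρ (ξ / 2 ^ L)) := fun L =>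
    (hi.comp_div (by positivity : (2 : ℝ) ^ L ≠ 0)).bdd_mul (c := 1)
      (Continuous.aestronglyMeasurable (by fun_prop))
      (Eventually.of_forall fun v => Real.abs_cos_le_one _)
  rw [← mul_sub, ← integral_sub (hj _) (hj _)]
  congr 2; ext ξ
  rw [← mul_sub]
  simp only [lpSymbol]
  congr 3
  rw [pow_succ]; field_simp

lemma ker_zero (ρ : ℝ → ℝ) (x : ℝ) : lpKernel ρ 0 x = sk ρ 0 x := by
  simp [lpKernel, lpSymbol, sk]

lemma ker_sum (hρ : IsLPCutoff ρ) (L : ℕ) (x : ℝ) :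
    ∑ k ∈ Finset.range (L + 1), lpKernel ρ k x = sk ρ L x := by
  induction L with
  | zero => simp [ker_zero]
  | succ L ih => rw [Finset.sum_range_succ, ih, ker_succ hρ]; ring

/-- The uniform `L¹` bound for the kernels. -/
def A1 (ρ : ℝ → ℝ) : ℝ := 2 * ∫ x, |invFourier ρ x|

lemma A1_nonneg (ρ : ℝ → ℝ) : 0 ≤ A1 ρ := by
  unfold A1
  have : 0 ≤ ∫ x, |invFourier ρ x| := integral_nonneg fun x => abs_nonneg _
  linarith

lemma ker_norm (hρ : IsLPCutoff ρ) (k : ℕ) : ∫ x, |lpKernel ρ k x| ≤ A1 ρ := by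
  have h0 : 0 ≤ ∫ x, |invFourier ρ x| := integral_nonneg fun x => abs_nonneg _
  cases k with
  | zero =>
    simp_rw [ker_zero]
    rw [sk_norm, A1]; linarith
  | succ k =>
    simp_rw [ker_succ hρ]
    calc ∫ x, |sk ρ (k + 1) x - sk ρ k x| ≤ ∫ x, (|sk ρ (k + 1) x| + |sk ρ k x|) := by
          refine integral_mono ((sk_int hρ _).sub (sk_int hρ _)).abs
            ((sk_int hρ _).abs.add (sk_int hρ _).abs) fun x => abs_sub _ _
      _ = A1 ρ := by
          rw [integral_add (sk_int hρ _).abs (sk_int hρ _).abs, sk_norm, sk_norm, A1]; ring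

/-- Basic Fubini statement. -/
lemma swap_mul (k g : ℝ → ℝ) (b : ℝ → ℝ → ℝ) (hk : Integrable k) (hg : Integrable g)
    (hb : Continuous (Function.uncurry b)) (B : ℝ) (hB : ∀ y ξ, |b y ξ| ≤ B) :
    ∫ y, k y * ∫ ξ, g ξ * b y ξ = ∫ ξ, g ξ * ∫ y, k y * b y ξ := by
  simp_rw [← integral_const_mul]
  rw [integral_integral_swap]
  · congr 1; ext ξ; congr 1; ext y; ring
  · have h := hk.mul_prod hg
    have := h.mul_bdd (c := B) hb.aestronglyMeasurable (Eventually.of_forall fun p => hB p.1 p.2)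
    refine this.congr (Eventually.of_forall fun p => ?_)
    simp only [Function.uncurry]; ring

/-- Fubini with a translated kernel. -/
lemma swap_conv (k g : ℝ → ℝ) (b : ℝ → ℝ → ℝ) (hk : Integrable k) (hg : Integrable g)
    (hb : Continuous (Function.uncurry b)) (B : ℝ) (hB : ∀ y ξ, |b y ξ| ≤ B) :
    ∫ y, k y * ∫ s, g (s - y) * b y s = ∫ s, ∫ y, k y * g (s - y) * b y s := by
  simp_rw [← integral_const_mul]
  rw [integral_integral_swap]
  · congr 1; ext ξ; congr 1; ext y; ring
  · have h := (hk.convolution_integrand (ContinuousLinearMap.mul ℝ ℝ) hg).swap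
    have := h.mul_bdd (c := B) hb.aestronglyMeasurable (Eventually.of_forall fun p => hB p.1 p.2)
    refine this.congr (Eventually.of_forall fun p => ?_)
    simp [Function.uncurry]; ring

lemma ker_sin (ρ : ℝ → ℝ) (k : ℕ) (θ : ℝ) : ∫ y, lpKernel ρ k y * Real.sin (y * θ) = 0 := by
  have h1 := integral_neg_eq_self (μ := volume) (fun y => lpKernel ρ k y * Real.sin (y * θ))
  have h2 : (fun y : ℝ => lpKernel ρ k (-y) * Real.sin ((-y) * θ))
      = fun y => - (lpKernel ρ k y * Real.sin (y * θ)) := by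
    ext y
    rw [neg_mul, Real.sin_neg, lpKernel, invFourier_even]; ring
  beta_reduce at h1
  rw [h2, integral_neg] at h1
  linarith

lemma ker_cos_shift (hρ : IsLPCutoff ρ) (k : ℕ) (θ c : ℝ) :
    ∫ y, lpKernel ρ k y * Real.cos (c - y * θ)
      = Real.cos c * (Real.sqrt (2 * π) * lpSymbol ρ k θ) := by
  have hi : Integrable (fun y => lpKernel ρ k y * Real.cos (y * θ)) :=
    (ker_int hρ k).mul_bdd (c := 1) (Continuous.aestronglyMeasurable (by fun_prop))
      (Eventually.of_forall fun v => Real.abs_cos_le_one _)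
  have hj : Integrable (fun y => lpKernel ρ k y * Real.sin (y * θ)) :=
    (ker_int hρ k).mul_bdd (c := 1) (Continuous.aestronglyMeasurable (by fun_prop))
      (Eventually.of_forall fun v => Real.abs_sin_le_one _)
  have h := invFourier_inversion _ (sym_cs hρ k) (sym_smooth hρ k) (sym_even hρ k) θ
  rw [← h, ← integral_const_mul]
  have : (fun y => lpKernel ρ k y * Real.cos (c - y * θ)) = fun y =>
      Real.cos c * (lpKernel ρ k y * Real.cos (y * θ))
        + Real.sin c * (lpKernel ρ k y * Real.sin (y * θ)) := by
    ext y; rw [Real.cos_sub]; ring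
  rw [this, integral_add (hi.const_mul _) (hj.const_mul _), integral_const_mul, integral_const_mul,
    integral_const_mul, ker_sin]
  simp [lpKernel]

lemma triple_cos (hρ : IsLPCutoff ρ) (k : ℕ) (s t ξ η : ℝ)
    (h1 : lpSymbol ρ k (ξ + η) = 0) (h2 : lpSymbol ρ k (ξ - η) = 0) :
    ∫ y, lpKernel ρ k y * (Real.cos ((s - y) * ξ) * Real.cos ((t - y) * η)) = 0 := by
  have hi : ∀ c θ, Integrable (fun y => lpKernel ρ k y * Real.cos (c - y * θ)) := fun c θ =>
    (ker_int hρ k).mul_bdd (c := 1) (Continuous.aestronglyMeasurable (by fun_prop))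
      (Eventually.of_forall fun v => Real.abs_cos_le_one _)
  have : (fun y => lpKernel ρ k y * (Real.cos ((s - y) * ξ) * Real.cos ((t - y) * η)))
     = fun y => 1 / 2 * (lpKernel ρ k y * Real.cos ((s * ξ + t * η) - y * (ξ + η)))
        + 1 / 2 * (lpKernel ρ k y * Real.cos ((s * ξ - t * η) - y * (ξ - η))) := by
    ext y
    rw [show (s * ξ + t * η) - y * (ξ + η) = (s - y) * ξ + (t - y) * η by ring,
      show (s * ξ - t * η) - y * (ξ - η) = (s - y) * ξ - (t - y) * η by ring,
      Real.cos_add, Real.cos_sub]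
    ring
  rw [this, integral_add ((hi _ _).const_mul _) ((hi _ _).const_mul _), integral_const_mul,
    integral_const_mul, ker_cos_shift hρ, ker_cos_shift hρ, h1, h2]
  simp

lemma sym_int (hρ : IsLPCutoff ρ) (k : ℕ) : Integrable (lpSymbol ρ k) :=
  (sym_smooth hρ k).continuous.integrable_of_hasCompactSupport (sym_cs hρ k)

/-- Frequency support vanishing of the triple kernel. -/
lemma triple_zero (hρ : IsLPCutoff ρ) (k m n : ℕ)
    (h : ∀ ξ η, lpSymbol ρ m ξ ≠ 0 → lpSymbol ρ n η ≠ 0 → lpSymbol ρ k (ξ + η) = 0) (s t : ℝ) :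
    ∫ y, lpKernel ρ k y * lpKernel ρ m (s - y) * lpKernel ρ n (t - y) = 0 := by
  obtain ⟨B, hB⟩ := invFourier_bdd _ (sym_cs hρ n) (sym_smooth hρ n)
  have hcn : Continuous (lpKernel ρ n) := ker_cont hρ n
  have e1 : ∀ j x, lpKernel ρ j x
      = (Real.sqrt (2 * π))⁻¹ * ∫ ξ, lpSymbol ρ j ξ * Real.cos (x * ξ) := by
    intro j x; simp only [lpKernel, invFourier]; congr 2; ext ξ; ring
  have step1 : ∫ y, (lpKernel ρ k y * lpKernel ρ n (t - y)) *
      (∫ ξ, lpSymbol ρ m ξ * Real.cos ((s - y) * ξ)) = 0 := by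
    have hkn : Integrable (fun y => lpKernel ρ k y * lpKernel ρ n (t - y)) :=
      (ker_int hρ k).mul_bdd (c := B) (g := fun y => lpKernel ρ n (t - y))
        (Continuous.aestronglyMeasurable (by fun_prop)) (Eventually.of_forall fun v => hB _)
    rw [swap_mul _ _ (fun y ξ => Real.cos ((s - y) * ξ)) hkn
      (sym_int hρ m) (by unfold Function.uncurry; fun_prop) 1 (fun _ _ => Real.abs_cos_le_one _)]
    have : ∀ ξ, lpSymbol ρ m ξ * (∫ y, lpKernel ρ k y * lpKernel ρ n (t - y)
        * Real.cos ((s - y) * ξ)) = 0 := by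
      intro ξ
      by_cases hm : lpSymbol ρ m ξ = 0
      · rw [hm, zero_mul]
      have : ∫ y, (lpKernel ρ k y * Real.cos ((s - y) * ξ)) *
          (∫ η, lpSymbol ρ n η * Real.cos ((t - y) * η)) = 0 := by
        rw [swap_mul _ _ (fun y η => Real.cos ((t - y) * η)) ((ker_int hρ k).mul_bdd (c := 1)
          (Continuous.aestronglyMeasurable (by fun_prop))
          (Eventually.of_forall fun v => Real.abs_cos_le_one _))
          (sym_int hρ n) (by unfold Function.uncurry; fun_prop) 1
          (fun _ _ => Real.abs_cos_le_one _)]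
        refine integral_eq_zero_of_ae (Eventually.of_forall fun η => ?_)
        by_cases hn : lpSymbol ρ n η = 0
        · simp [hn]
        have h1 := h ξ η hm hn
        have h2 := h ξ (-η) hm (by rwa [sym_even hρ])
        have := triple_cos hρ k s t ξ η h1 h2
        simp only [← mul_assoc] at this
        simp [this]
      have h3 : (fun y => lpKernel ρ k y * lpKernel ρ n (t - y) * Real.cos ((s - y) * ξ))
        = fun y => (Real.sqrt (2 * π))⁻¹ * ((lpKernel ρ k y * Real.cos ((s - y) * ξ)) *
          (∫ η, lpSymbol ρ n η * Real.cos ((t - y) * η))) := by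
        ext y; rw [e1 n]; ring
      rw [h3, integral_const_mul, this]; simp
    simp [this]
  have h3 : (fun y => lpKernel ρ k y * lpKernel ρ m (s - y) * lpKernel ρ n (t - y))
    = fun y => (Real.sqrt (2 * π))⁻¹ * ((lpKernel ρ k y * lpKernel ρ n (t - y)) *
      (∫ ξ, lpSymbol ρ m ξ * Real.cos ((s - y) * ξ))) := by
    ext y; rw [e1 m]; ring
  rw [h3, integral_const_mul, step1, mul_zero]

end symbol


section ops
variable {ρ : ℝ → ℝ}

lemma conv_bound (K : ℝ → ℝ) (hK : Integrable K) (A B : ℝ) (hA : ∫ y, |K y| ≤ A)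
    (f : ℝ → ℝ) (hB0 : 0 ≤ B) (hB : ∀ y, |f y| ≤ B) : |∫ y, K y * f y| ≤ A * B := by
  calc |∫ y, K y * f y| ≤ ∫ y, |K y * f y| := norm_integral_le_integral_norm (fun y => K y * f y)
    _ ≤ ∫ y, |K y| * B := by
        refine integral_mono_of_nonneg (Eventually.of_forall fun y => abs_nonneg _)
          (hK.abs.mul_const B) (Eventually.of_forall fun y => ?_)
        simp only [abs_mul]
        exact mul_le_mul_of_nonneg_left (hB y) (abs_nonneg _)
    _ = (∫ y, |K y|) * B := integral_mul_const _ _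
    _ ≤ A * B := by gcongr

lemma conv_cont {X : Type*} [TopologicalSpace X] [FirstCountableTopology X]
    (K : ℝ → ℝ) (hK : Integrable K) (Φ : X → ℝ → ℝ)
    (hΦ : Continuous (Function.uncurry Φ)) (B : ℝ) (hB : ∀ p y, |Φ p y| ≤ B) :
    Continuous (fun p => ∫ y, K y * Φ p y) := by
  refine continuous_of_dominated (bound := fun y => |K y| * B) (fun p => ?_) (fun p => ?_)
    (hK.abs.mul_const B) ?_
  · refine hK.aestronglyMeasurable.mul (Continuous.aestronglyMeasurable ?_)
    exact hΦ.comp (by fun_prop : Continuous fun y : ℝ => (p, y))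
  · refine Eventually.of_forall fun y => ?_
    rw [Real.norm_eq_abs, abs_mul]
    exact mul_le_mul_of_nonneg_left (hB p y) (abs_nonneg _)
  · refine Eventually.of_forall fun y => ?_
    exact continuous_const.mul (hΦ.comp (by fun_prop : Continuous fun p : X => (p, y)))

variable {F : ℝ × ℝ → ℝ} {B : ℝ}

lemma conv_int (K : ℝ → ℝ) (hK : Integrable K) (f : ℝ → ℝ) (hf : Continuous f)
    (hB : ∀ y, |f y| ≤ B) : Integrable (fun y => K y * f y) :=
  hK.mul_bdd (c := B) hf.aestronglyMeasurable (Eventually.of_forall hB)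

lemma B_nonneg (hB : ∀ p, |F p| ≤ B) : 0 ≤ B := (abs_nonneg _).trans (hB 0)

lemma LPv_cont (hρ : IsLPCutoff ρ) (hF : Continuous F) (hB : ∀ p, |F p| ≤ B) (n : ℕ) :
    Continuous (LPv ρ n F) := by
  unfold LPv
  exact conv_cont _ (ker_int hρ n) (fun (p : ℝ × ℝ) y => F (p.1, p.2 - y))
    (by unfold Function.uncurry; fun_prop) B (fun p y => hB _)

lemma LPu_cont (hρ : IsLPCutoff ρ) (hF : Continuous F) (hB : ∀ p, |F p| ≤ B) (n : ℕ) :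
    Continuous (LPu ρ n F) := by
  unfold LPu
  exact conv_cont _ (ker_int hρ n) (fun (p : ℝ × ℝ) y => F (p.1 - y, p.2))
    (by unfold Function.uncurry; fun_prop) B (fun p y => hB _)

lemma LPv_bdd (hρ : IsLPCutoff ρ) (hB : ∀ p, |F p| ≤ B) (n : ℕ) (p : ℝ × ℝ) :
    |LPv ρ n F p| ≤ A1 ρ * B :=
  conv_bound _ (ker_int hρ n) _ _ (ker_norm hρ n) _ (B_nonneg hB) (fun _ => hB _)

lemma LPu_bdd (hρ : IsLPCutoff ρ) (hB : ∀ p, |F p| ≤ B) (n : ℕ) (p : ℝ × ℝ) :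
    |LPu ρ n F p| ≤ A1 ρ * B :=
  conv_bound _ (ker_int hρ n) _ _ (ker_norm hρ n) _ (B_nonneg hB) (fun _ => hB _)

/-- Vanishing of a frequency-localized trace. -/
lemma trace_zero (hρ : IsLPCutoff ρ) (hF : Continuous F) (hB : ∀ p, |F p| ≤ B) (k m n : ℕ)
    (h : ∀ ξ η, lpSymbol ρ m ξ ≠ 0 → lpSymbol ρ n η ≠ 0 → lpSymbol ρ k (ξ + η) = 0) (x : ℝ) :
    LP ρ k (fun z => LPu ρ m (LPv ρ n F) (z, z)) x = 0 := by
  have hΦc := LPv_cont hρ hF hB n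
  have hΦb := LPv_bdd hρ hB n
  have e1 : ∀ y, LPu ρ m (LPv ρ n F) (x - y, x - y)
      = ∫ s, lpKernel ρ m (s - y) * LPv ρ n F (x - s, x - y) := by
    intro y
    unfold LPu
    rw [← integral_sub_right_eq_self _ y]
    congr 1; ext s
    congr 3; simp only []; ring
  have e2 : ∀ s y, LPv ρ n F (x - s, x - y)
      = ∫ t, lpKernel ρ n (t - y) * F (x - s, x - t) := by
    intro s y
    unfold LPv
    rw [← integral_sub_right_eq_self _ y]
    congr 1; ext s
    congr 3; simp only []; ring
  unfold LP
  simp only [e1]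
  rw [swap_conv _ _ (fun y s => LPv ρ n F (x - s, x - y)) (ker_int hρ k) (ker_int hρ m)
    (by unfold Function.uncurry; fun_prop) _ (fun _ _ => hΦb _)]
  refine integral_eq_zero_of_ae (Eventually.of_forall fun s => ?_)
  simp only [e2]
  obtain ⟨C, hC⟩ := invFourier_bdd _ (sym_cs hρ m) (sym_smooth hρ m)
  have hcm := ker_cont hρ m
  have hkm : Integrable (fun y => lpKernel ρ k y * lpKernel ρ m (s - y)) :=
    conv_int _ (ker_int hρ k) (fun y => lpKernel ρ m (s - y)) (by fun_prop) (fun y => hC _)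
  rw [swap_conv _ _ (fun y t => F (x - s, x - t)) hkm (ker_int hρ n)
    (by unfold Function.uncurry; fun_prop) B (fun _ _ => hB _)]
  refine integral_eq_zero_of_ae (Eventually.of_forall fun t => ?_)
  simp only [integral_mul_const, triple_zero hρ k m n h s t]
  simp

lemma sk_scale (ρ : ℝ → ℝ) (L : ℕ) (f : ℝ → ℝ) :
    ∫ y, sk ρ L y * f y = ∫ y, invFourier ρ y * f (y / 2 ^ L) := by
  have h := Measure.integral_comp_mul_left (fun y => invFourier ρ y * f (y / 2 ^ L)) ((2 : ℝ) ^ L)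
  rw [abs_of_pos (by positivity), smul_eq_mul] at h
  have h2 : ∫ y, invFourier ρ y * f (y / 2 ^ L)
      = 2 ^ L * ∫ x, invFourier ρ (2 ^ L * x) * f (2 ^ L * x / 2 ^ L) := by
    rw [h]; field_simp
  rw [h2, ← integral_const_mul]
  congr 1; ext y
  rw [sk, mul_div_cancel_left₀ _ (by positivity)]; ring

/-- The truncated double Littlewood-Paley sum. -/
def trunc (ρ : ℝ → ℝ) (L : ℕ) (F : ℝ × ℝ → ℝ) (p : ℝ × ℝ) : ℝ :=
  ∑ m ∈ Finset.range (L + 1), ∑ n ∈ Finset.range (L + 1), LPu ρ m (LPv ρ n F) p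

lemma trunc_eq (hρ : IsLPCutoff ρ) (hF : Continuous F) (hB : ∀ p, |F p| ≤ B) (L : ℕ)
    (p : ℝ × ℝ) : trunc ρ L F p
      = ∫ a, invFourier ρ a * ∫ b, invFourier ρ b * F (p.1 - a / 2 ^ L, p.2 - b / 2 ^ L) := by
  have e1 : ∀ q, ∑ n ∈ Finset.range (L + 1), LPv ρ n F q
      = ∫ b, invFourier ρ b * F (q.1, q.2 - b / 2 ^ L) := by
    intro q
    unfold LPv
    rw [← integral_finsetSum _ fun n _ => conv_int (B := B) _ (ker_int hρ n)
      (fun y => F (q.1, q.2 - y)) (by fun_prop) (fun y => hB _)]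
    simp_rw [← Finset.sum_mul, ker_sum hρ]
    exact sk_scale ρ L (fun b => F (q.1, q.2 - b))
  unfold trunc
  have e2 : ∀ a : ℝ, (∫ b, invFourier ρ b * F (p.1 - a / 2 ^ L, p.2 - b / 2 ^ L))
      = ∑ n ∈ Finset.range (L + 1), LPv ρ n F (p.1 - a / 2 ^ L, p.2) :=
    fun a => (e1 (p.1 - a / 2 ^ L, p.2)).symm
  simp_rw [e2]
  rw [← sk_scale ρ L (fun a => ∑ n ∈ Finset.range (L + 1), LPv ρ n F (p.1 - a, p.2))]
  unfold LPu
  have hi : ∀ m n, Integrable (fun y => lpKernel ρ m y * LPv ρ n F (p.1 - y, p.2)) := by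
    intro m n
    have := LPv_cont hρ hF hB n
    exact conv_int _ (ker_int hρ m) _ (by fun_prop) (fun y => LPv_bdd hρ hB n _)
  simp_rw [← ker_sum hρ, Finset.sum_mul, Finset.mul_sum]
  rw [integral_finsetSum _ fun m _ => integrable_finsetSum _ fun n _ => hi m n]
  refine Finset.sum_congr rfl fun m _ => ?_
  rw [integral_finsetSum _ fun n _ => hi m n]

lemma kappa_int (hρ : IsLPCutoff ρ) : Integrable (invFourier ρ) :=
  invFourier_integrable _ (rho_cs hρ) hρ.smooth

lemma kappa_norm (ρ : ℝ → ℝ) : ∫ y, |invFourier ρ y| ≤ A1 ρ := by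
  have h0 : 0 ≤ ∫ x, |invFourier ρ x| := integral_nonneg fun x => abs_nonneg _
  unfold A1; linarith

lemma trunc_bdd (hρ : IsLPCutoff ρ) (hF : Continuous F) (hB : ∀ p, |F p| ≤ B) (L : ℕ)
    (p : ℝ × ℝ) : |trunc ρ L F p| ≤ A1 ρ * (A1 ρ * B) := by
  rw [trunc_eq hρ hF hB]
  refine conv_bound _ (kappa_int hρ) _ _ (kappa_norm ρ) _
    (mul_nonneg (A1_nonneg ρ) (B_nonneg hB)) (fun y => ?_)
  exact conv_bound _ (kappa_int hρ) _ _ (kappa_norm ρ) _ (B_nonneg hB) (fun _ => hB _)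

lemma trunc_cont (hρ : IsLPCutoff ρ) (hF : Continuous F) (hB : ∀ p, |F p| ≤ B) (L : ℕ) :
    Continuous (trunc ρ L F) := by
  unfold trunc
  refine continuous_finsetSum _ fun m _ => continuous_finsetSum _ fun n _ => ?_
  exact LPu_cont hρ (LPv_cont hρ hF hB n) (LPv_bdd hρ hB n) m

lemma kappa_total (hρ : IsLPCutoff ρ) : ∫ y, invFourier ρ y = Real.sqrt (2 * π) := by
  have := invFourier_inversion ρ (rho_cs hρ) hρ.smooth hρ.even 0
  simpa [hρ.eq_one 0 (by norm_num)] using this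

lemma trunc_tendsto (hρ : IsLPCutoff ρ) (hF : Continuous F) (hB : ∀ p, |F p| ≤ B)
    (p : ℝ × ℝ) : Tendsto (fun L => trunc ρ L F p) atTop (𝓝 (2 * π * F p)) := by
  have hz : ∀ a : ℝ, Tendsto (fun L : ℕ => a / (2 : ℝ) ^ L) atTop (𝓝 0) := fun a =>
    tendsto_const_nhds.div_atTop (tendsto_pow_atTop_atTop_of_one_lt one_lt_two)
  have e : 2 * π * F p = ∫ a, invFourier ρ a * ∫ b, invFourier ρ b * F p := by
    rw [integral_mul_const, integral_mul_const, kappa_total hρ, ← mul_assoc,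
      Real.mul_self_sqrt (by positivity)]
  rw [e]
  simp_rw [trunc_eq hρ hF hB]
  refine tendsto_integral_of_dominated_convergence (fun a => |invFourier ρ a| * (A1 ρ * B))
    (fun L => ?_) ((kappa_int hρ).abs.mul_const _) (fun L => Eventually.of_forall fun a => ?_)
    (Eventually.of_forall fun a => ?_)
  · refine (kappa_int hρ).aestronglyMeasurable.mul (Continuous.aestronglyMeasurable ?_)
    exact conv_cont _ (kappa_int hρ) (fun a b => F (p.1 - a / 2 ^ L, p.2 - b / 2 ^ L))
      (by unfold Function.uncurry; fun_prop) B (fun _ _ => hB _)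
  · rw [Real.norm_eq_abs, abs_mul]
    refine mul_le_mul_of_nonneg_left ?_ (abs_nonneg _)
    exact conv_bound _ (kappa_int hρ) _ _ (kappa_norm ρ) _ (B_nonneg hB) (fun _ => hB _)
  · refine Tendsto.const_mul _ ?_
    refine tendsto_integral_of_dominated_convergence (fun a => |invFourier ρ a| * B)
      (fun L => ?_) ((kappa_int hρ).abs.mul_const _) (fun L => Eventually.of_forall fun b => ?_)
      (Eventually.of_forall fun b => ?_)
    · exact (kappa_int hρ).aestronglyMeasurable.mul (Continuous.aestronglyMeasurable (by fun_prop))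
    · rw [Real.norm_eq_abs, abs_mul]
      exact mul_le_mul_of_nonneg_left (hB _) (abs_nonneg _)
    · refine Tendsto.const_mul _ ?_
      have h1 : Tendsto (fun L : ℕ => (p.1 - a / (2 : ℝ) ^ L, p.2 - b / (2 : ℝ) ^ L)) atTop
          (𝓝 (p.1 - 0, p.2 - 0)) :=
        (tendsto_const_nhds.sub (hz a)).prodMk_nhds (tendsto_const_nhds.sub (hz b))
      simp only [sub_zero] at h1
      exact (hF.tendsto p).comp h1

lemma LP_le_of_sum (hρ : IsLPCutoff ρ) (hF : Continuous F) (hB : ∀ p, |F p| ≤ B) (k : ℕ) (x S : ℝ)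
    (hS : ∀ L : ℕ, ∑ m ∈ Finset.range (L + 1), ∑ n ∈ Finset.range (L + 1),
      |LP ρ k (fun z => LPu ρ m (LPv ρ n F) (z, z)) x| ≤ S) :
    2 * π * |LP ρ k (fun z => F (z, z)) x| ≤ S := by
  have ht : Tendsto (fun L => LP ρ k (fun z => trunc ρ L F (z, z)) x) atTop
      (𝓝 (LP ρ k (fun z => 2 * π * F (z, z)) x)) := by
    unfold LP
    refine tendsto_integral_of_dominated_convergence
      (fun a => |lpKernel ρ k a| * (A1 ρ * (A1 ρ * B)))
      (fun L => ?_) ((ker_int hρ k).abs.mul_const _) (fun L => Eventually.of_forall fun a => ?_)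
      (Eventually.of_forall fun a => ?_)
    · refine (ker_int hρ k).aestronglyMeasurable.mul (Continuous.aestronglyMeasurable ?_)
      have := trunc_cont hρ hF hB L
      fun_prop
    · rw [Real.norm_eq_abs, abs_mul]
      exact mul_le_mul_of_nonneg_left (trunc_bdd hρ hF hB L _) (abs_nonneg _)
    · exact (trunc_tendsto hρ hF hB _).const_mul _
  have e : LP ρ k (fun z => 2 * π * F (z, z)) x = 2 * π * LP ρ k (fun z => F (z, z)) x := by
    unfold LP
    rw [← integral_const_mul]; congr 1; ext y; ring
  rw [e] at ht
  have h2 : |2 * π * LP ρ k (fun z => F (z, z)) x| ≤ S := by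
    refine le_of_tendsto ht.abs (Eventually.of_forall fun L => ?_)
    refine le_trans ?_ (hS L)
    have hi : ∀ m n, Integrable (fun y => lpKernel ρ k y *
        LPu ρ m (LPv ρ n F) (x - y, x - y)) := by
      intro m n
      have := LPu_cont hρ (LPv_cont hρ hF hB n) (LPv_bdd hρ hB n) m
      exact conv_int _ (ker_int hρ k) _ (by fun_prop)
        (fun y => LPu_bdd hρ (LPv_bdd hρ hB n) m _)
    have e2 : LP ρ k (fun z => trunc ρ L F (z, z)) x = ∑ m ∈ Finset.range (L + 1),
        ∑ n ∈ Finset.range (L + 1), LP ρ k (fun z => LPu ρ m (LPv ρ n F) (z, z)) x := by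
      unfold LP trunc
      simp_rw [Finset.mul_sum]
      rw [integral_finsetSum _ fun m _ => integrable_finsetSum _ fun n _ => hi m n]
      refine Finset.sum_congr rfl fun m _ => ?_
      rw [integral_finsetSum _ fun n _ => hi m n]
    rw [e2]
    refine (Finset.abs_sum_le_sum_abs _ _).trans (Finset.sum_le_sum fun m _ => ?_)
    exact Finset.abs_sum_le_sum_abs _ _
  rwa [abs_mul, abs_of_pos (by positivity : 0 < 2 * π)] at h2

end ops


section comb

lemma expo (α β γ : ℝ) (hα : α ≠ 0) (hβ : β ≠ 0) : ∃ δ > 0, ∃ D : ℝ,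
    γ ≤ α → γ ≤ β → γ ≤ α + β → ∀ k m n : ℝ, 0 ≤ k → 0 ≤ m → 0 ≤ n →
    ((m + 10 ≤ n ∧ k ≤ n + 1 ∧ n ≤ k + 1) ∨ (n + 10 ≤ m ∧ k ≤ m + 1 ∧ m ≤ k + 1) ∨
      (0 < α + β ∧ m ≤ n + 9 ∧ n ≤ m + 9 ∧ k ≤ m + 10)) →
    (γ * k - α * m - β * n ≤ D - δ * (m + |n - k|) ∨
     γ * k - α * m - β * n ≤ D - δ * (|m - k| + |n - k|) ∨
     γ * k - α * m - β * n ≤ D - δ * (|m - k| + n)) := by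
  have ha : 0 < |α| := abs_pos.2 hα
  have hb : 0 < |β| := abs_pos.2 hβ
  set e : ℝ := if 0 < α + β then α + β else 1 with he
  have he0 : 0 < e := by rw [he]; split_ifs <;> linarith
  set δ : ℝ := min (min |α| |β|) e / 2 with hδ
  have d0 : 0 < δ := by rw [hδ]; have := lt_min (lt_min ha hb) he0; linarith
  have d1 : 2 * δ ≤ |α| := by
    have : min (min |α| |β|) e ≤ |α| := (min_le_left _ _).trans (min_le_left _ _)
    linarith
  have d2 : 2 * δ ≤ |β| := by
    have : min (min |α| |β|) e ≤ |β| := (min_le_left _ _).trans (min_le_right _ _)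
    linarith
  have d3 : 2 * δ ≤ e := by
    have : min (min |α| |β|) e ≤ e := min_le_right _ _
    linarith
  refine ⟨δ, d0, 100 * (|α| + |β|), ?_⟩
  intro h1 h2 h3 k m n hk hm hn h
  have g1 : γ * k ≤ α * k := mul_le_mul_of_nonneg_right h1 hk
  have g2 : γ * k ≤ β * k := mul_le_mul_of_nonneg_right h2 hk
  have g3 : γ * k ≤ (α + β) * k := mul_le_mul_of_nonneg_right h3 hk
  have small : ∀ c t r : ℝ, 0 ≤ r → |t| ≤ r → c * t ≤ |c| * r := by
    intro c t r hr ht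
    calc c * t ≤ |c * t| := le_abs_self _
      _ = |c| * |t| := abs_mul _ _
      _ ≤ |c| * r := by gcongr
  rcases h with ⟨p1, p2, p3⟩ | ⟨p1, p2, p3⟩ | ⟨p0, p1, p2, p3⟩
  · have hnk : |n - k| ≤ 1 := abs_le.2 ⟨by linarith, by linarith⟩
    have s1 := small β (k - n) 1 (by norm_num) (by rwa [abs_sub_comm])
    have s2 : δ * |n - k| ≤ δ * 1 := by gcongr
    rcases lt_or_gt_of_ne hα with hneg | hpos
    · right; left
      rw [abs_of_neg hneg] at *
      rw [abs_of_neg (by linarith : m - k < 0)]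
      have : δ * (k - m) ≤ (-α) * (k - m) := by
        apply mul_le_mul_of_nonneg_right <;> linarith
      nlinarith
    · left
      rw [abs_of_pos hpos] at *
      have : δ * m ≤ α * m := by
        apply mul_le_mul_of_nonneg_right <;> linarith
      nlinarith
  · have hmk : |m - k| ≤ 1 := abs_le.2 ⟨by linarith, by linarith⟩
    have s1 := small α (k - m) 1 (by norm_num) (by rwa [abs_sub_comm])
    have s2 : δ * |m - k| ≤ δ * 1 := by gcongr
    rcases lt_or_gt_of_ne hβ with hneg | hpos
    · right; left
      rw [abs_of_neg hneg] at *
      rw [abs_of_neg (by linarith : n - k < 0)]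
      have : δ * (k - n) ≤ (-β) * (k - n) := by
        apply mul_le_mul_of_nonneg_right <;> linarith
      nlinarith
    · right; right
      rw [abs_of_pos hpos] at *
      have : δ * n ≤ β * n := by
        apply mul_le_mul_of_nonneg_right <;> linarith
      nlinarith
  · right; left
    rw [if_pos p0] at he
    have s1 := small β (m - n) 9 (by norm_num) (abs_le.2 ⟨by linarith, by linarith⟩)
    have t1 : |n - k| ≤ |m - k| + 9 := by
      have : |n - k| ≤ |n - m| + |m - k| := abs_sub_le _ _ _
      have : |n - m| ≤ 9 := abs_le.2 ⟨by linarith, by linarith⟩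
      linarith
    have t2 : δ * (|m - k| + |n - k|) ≤ 2 * δ * |m - k| + 9 * δ := by
      have := mul_le_mul_of_nonneg_left t1 d0.le
      nlinarith
    have ab : α + β ≤ |α| + |β| := add_le_add (le_abs_self _) (le_abs_self _)
    have t3 : (α + β) * (k - m) ≤ 20 * (α + β) - (α + β) * |m - k| := by
      rcases le_total k m with hh | hh
      · rw [abs_of_nonneg (by linarith)]; nlinarith
      · rw [abs_of_nonpos (by linarith)]; nlinarith
    have t4 : 2 * δ * |m - k| ≤ (α + β) * |m - k| := by
      apply mul_le_mul_of_nonneg_right _ (abs_nonneg _); linarith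
    nlinarith

lemma geom_int (q : ℝ) (h0 : 0 ≤ q) (h1 : q < 1) : Summable (fun z : ℤ => q ^ z.natAbs) := by
  refine Summable.of_nat_of_neg ?_ ?_
  · simpa using summable_geometric_of_lt_one h0 h1
  · simpa using summable_geometric_of_lt_one h0 h1

lemma geom_sum_le (q : ℝ) (h0 : 0 ≤ q) (h1 : q < 1) (N j : ℕ) :
    ∑ m ∈ Finset.range N, q ^ ((m : ℤ) - j).natAbs ≤ ∑' z : ℤ, q ^ z.natAbs := by
  have hinj : Function.Injective (fun m : ℕ => (m : ℤ) - j) := by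
    intro a b h; simpa using h
  have := (geom_int q h0 h1).sum_le_tsum ((Finset.range N).image (fun m : ℕ => (m : ℤ) - j))
    (fun _ _ => by positivity)
  rwa [Finset.sum_image (fun a _ b _ h => hinj h)] at this

/-- Summation of the dyadic weights over the admissible frequency pairs. -/
lemma weight_sum (α β γ : ℝ) (hα : α ≠ 0) (hβ : β ≠ 0) : ∃ S : ℝ, 0 ≤ S ∧
    (γ ≤ α → γ ≤ β → γ ≤ α + β → ∀ (k N : ℕ) (a : ℕ → ℕ → ℝ),
    (∀ m n, 0 ≤ a m n) → (∀ m n, a m n ≤ (2 : ℝ) ^ (γ * k - α * m - β * n)) →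
    (∀ m n, a m n ≠ 0 → 
      ((m + 10 ≤ n ∧ k ≤ n + 1 ∧ n ≤ k + 1) ∨ (n + 10 ≤ m ∧ k ≤ m + 1 ∧ m ≤ k + 1) ∨
      (0 < α + β ∧ m ≤ n + 9 ∧ n ≤ m + 9 ∧ k ≤ m + 10))) →
    ∑ m ∈ Finset.range N, ∑ n ∈ Finset.range N, a m n ≤ S) := by
  obtain ⟨δ, d0, D, hD⟩ := expo α β γ hα hβ
  set q : ℝ := (2 : ℝ) ^ (-δ) with hq
  have q0 : 0 ≤ q := by positivity
  have q1 : q < 1 := Real.rpow_lt_one_of_one_lt_of_neg (by norm_num) (by linarith)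
  set T := ∑' z : ℤ, q ^ z.natAbs with hT
  have T0 : 0 ≤ T := tsum_nonneg fun _ => by positivity
  refine ⟨3 * (2 ^ D * (T * T)), by positivity, ?_⟩
  intro h1 h2 h3 k N a a0 ale ane
  set W : ℕ → ℕ → ℝ := fun j m => q ^ ((m : ℤ) - j).natAbs with hW
  have W0 : ∀ j m, 0 ≤ W j m := fun j m => by positivity
  have WT : ∀ j, ∑ m ∈ Finset.range N, W j m ≤ T := fun j => geom_sum_le q q0 q1 N j
  have Weq : ∀ i j m n : ℕ, (2 : ℝ) ^ (D - δ * (|(m : ℝ) - i| + |(n : ℝ) - j|))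
      = 2 ^ D * (W i m * W j n) := by
    intro i j m n
    have e : ∀ j m : ℕ, W j m = (2 : ℝ) ^ (-δ * |(m : ℝ) - j|) := by
      intro j m
      rw [Real.rpow_mul (by norm_num), ← hq, hW]
      have : |(m : ℝ) - j| = (((m : ℤ) - j).natAbs : ℝ) := by
        rw [Nat.cast_natAbs]; push_cast; rfl
      rw [this, Real.rpow_natCast]
    rw [e, e, ← Real.rpow_add (by norm_num), ← Real.rpow_add (by norm_num)]
    congr 1; ring
  have key : ∀ m n, a m n ≤ 2 ^ D * (W 0 m * W k n) + 2 ^ D * (W k m * W k n)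
      + 2 ^ D * (W k m * W 0 n) := by
    intro m n
    have p1 : 0 ≤ 2 ^ D * (W 0 m * W k n) := by positivity
    have p2 : 0 ≤ 2 ^ D * (W k m * W k n) := by positivity
    have p3 : 0 ≤ 2 ^ D * (W k m * W 0 n) := by positivity
    by_cases hz : a m n = 0
    · rw [hz]; linarith
    have hc := ane m n hz
    have hm : |(m : ℝ) - (0 : ℕ)| = m := by simp
    have hn : |(n : ℝ) - (0 : ℕ)| = n := by simp
    have := hD h1 h2 h3 k m n (by positivity) (by positivity) (by positivity)
      (by exact_mod_cast hc)
    have l2 : (1 : ℝ) ≤ 2 := by norm_num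
    rcases this with h | h | h
    · have h4 := (ale m n).trans (Real.rpow_le_rpow_of_exponent_le l2 h)
      have := Weq 0 k m n
      rw [hm] at this
      linarith
    · have h4 := (ale m n).trans (Real.rpow_le_rpow_of_exponent_le l2 h)
      have := Weq k k m n
      linarith
    · have h4 := (ale m n).trans (Real.rpow_le_rpow_of_exponent_le l2 h)
      have := Weq k 0 m n
      rw [hn] at this
      linarith
  have prod : ∀ i j, ∑ m ∈ Finset.range N, ∑ n ∈ Finset.range N, 2 ^ D * (W i m * W j n)
      ≤ 2 ^ D * (T * T) := by
    intro i j
    simp_rw [← Finset.mul_sum]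
    rw [← Finset.sum_mul]
    have : 0 ≤ ∑ n ∈ Finset.range N, W j n := Finset.sum_nonneg fun n _ => W0 j n
    have := WT i
    have := WT j
    gcongr
  calc ∑ m ∈ Finset.range N, ∑ n ∈ Finset.range N, a m n
      ≤ ∑ m ∈ Finset.range N, ∑ n ∈ Finset.range N, (2 ^ D * (W 0 m * W k n)
        + 2 ^ D * (W k m * W k n) + 2 ^ D * (W k m * W 0 n)) :=
        Finset.sum_le_sum fun m _ => Finset.sum_le_sum fun n _ => key m n
    _ ≤ 3 * (2 ^ D * (T * T)) := by
        simp_rw [Finset.sum_add_distrib]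
        have := prod 0 k
        have := prod k k
        have := prod k 0
        linarith

variable {ρ : ℝ → ℝ}

lemma pow_le_add (a b j : ℕ) (h : a + j ≤ b) : (2 : ℝ) ^ a * 2 ^ j ≤ 2 ^ b := by
  rw [← pow_add]; exact pow_le_pow_right₀ (by norm_num) h

lemma freq_low (hρ : IsLPCutoff ρ) (k m n : ℕ) (h : m + 10 ≤ n) (hk : n + 2 ≤ k ∨ k + 2 ≤ n)
    (ξ η : ℝ) (h1 : lpSymbol ρ m ξ ≠ 0) (h2 : lpSymbol ρ n η ≠ 0) :
    lpSymbol ρ k (ξ + η) = 0 := by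
  by_contra h3
  have a1 := sym_upper hρ m ξ h1
  have a2 := sym_upper hρ n η h2
  have a3 := sym_lower hρ n (by omega) η h2
  have a4 := sym_upper hρ k _ h3
  have b1 := pow_le_add m n 10 h
  have c1 : |ξ + η| ≤ |ξ| + |η| := abs_add_le _ _
  have c2 : |η| ≤ |ξ + η| + |ξ| := by
    have := abs_sub (ξ + η) ξ
    simpa using this
  have p : (0 : ℝ) < 2 ^ n := by positivity
  have p2 : (0 : ℝ) < 2 ^ k := by positivity
  rcases hk with hk | hk
  · have a5 := sym_lower hρ k (by omega) _ h3
    have b2 := pow_le_add _ _ 2 hk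
    norm_num at b1 b2
    linarith
  · have b2 := pow_le_add _ _ 2 hk
    norm_num at b1 b2
    linarith

lemma freq_diag (hρ : IsLPCutoff ρ) (k m n : ℕ) (h : n ≤ m + 9) (hk : m + 11 ≤ k)
    (ξ η : ℝ) (h1 : lpSymbol ρ m ξ ≠ 0) (h2 : lpSymbol ρ n η ≠ 0) :
    lpSymbol ρ k (ξ + η) = 0 := by
  by_contra h3
  have a1 := sym_upper hρ m ξ h1
  have a2 := sym_upper hρ n η h2
  have a5 := sym_lower hρ k (by omega) _ h3
  have b1 : (2 : ℝ) ^ n ≤ 2 ^ m * 2 ^ 9 := by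
    rw [← pow_add]; exact pow_le_pow_right₀ (by norm_num) h
  have b2 := pow_le_add _ _ 11 hk
  have c1 : |ξ + η| ≤ |ξ| + |η| := abs_add_le _ _
  have p : (0 : ℝ) < 2 ^ m := by positivity
  norm_num at b1 b2
  linarith

lemma dclose_of (m n : ℕ) (h1 : m ≤ n + 9) (h2 : n ≤ m + 9) : DClose m n := by
  have p : (0 : ℝ) < 2 ^ m := by positivity
  have p2 : (0 : ℝ) < 2 ^ n := by positivity
  have b1 : (2 : ℝ) ^ n ≤ 2 ^ m * 2 ^ 9 := by
    rw [← pow_add]; exact pow_le_pow_right₀ (by norm_num) h2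
  have b2 : (2 : ℝ) ^ m ≤ 2 ^ n * 2 ^ 9 := by
    rw [← pow_add]; exact pow_le_pow_right₀ (by norm_num) h1
  norm_num at b1 b2
  constructor <;> norm_num <;> linarith

end comb

/-- **Lemma 2.18: trace estimate.**
With `Tr F (x) = F (x, x)`, under either (i) `γ ≤ min (α, β)` and `α + β > 0`, or (ii)
`γ ≤ min (α, β, α+β)` and `P_M^u P_N^v F = 0` for all `M ∼ N`, one has
`‖Tr F‖_{C^γ} ≲ ‖F‖_{C_u^{α}C_v^{β}}`. -/
theorem trace_estimate
    (ρ : ℝ → ℝ) (hρ : IsLPCutoff ρ)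
    (α β γ : ℝ) (hα : α ≠ 0) (hβ : β ≠ 0) :
    ∃ C : ℝ≥0∞, C ≠ ∞ ∧ ∀ F : ℝ × ℝ → ℝ, CbSmooth F →
      ((γ ≤ min α β ∧ 0 < α + β) ∨
        (γ ≤ min α (min β (α + β)) ∧
          ∀ m n : ℕ, DClose m n → ∀ p, LPu ρ m (LPv ρ n F) p = 0)) →
      hNorm ρ γ (fun x => F (x, x)) ≤ C * hNorm2 ρ α β F := by
  obtain ⟨S, S0, hS⟩ := weight_sum α β γ hα hβ
  have A0 := A1_nonneg ρ
  refine ⟨ENNReal.ofReal (A1 ρ * S + 1), ENNReal.ofReal_ne_top, ?_⟩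
  intro F hF hcase
  have hFc : Continuous F := hF.1.continuous
  obtain ⟨B, hB'⟩ := hF.2 0
  have hB : ∀ p, |F p| ≤ B := by
    intro p
    have := hB' p
    rwa [norm_iteratedFDeriv_zero] at this
  by_cases htop : hNorm2 ρ α β F = ∞
  · rw [htop, ENNReal.mul_top]
    · exact le_top
    · have : 0 < A1 ρ * S + 1 := by positivity
      simpa using this
  set H := (hNorm2 ρ α β F).toReal with hH
  have H0 : 0 ≤ H := ENNReal.toReal_nonneg
  have pw : ∀ m n p, ((2 : ℝ) ^ m) ^ α * ((2 : ℝ) ^ n) ^ β * |LPu ρ m (LPv ρ n F) p| ≤ H := by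
    intro m n p
    rw [hH, ← ENNReal.ofReal_le_iff_le_toReal htop, ENNReal.ofReal_mul (by positivity)]
    unfold hNorm2
    refine le_trans ?_ (le_iSup_of_le m (le_iSup_of_le n le_rfl))
    gcongr
    exact le_iSup (fun p => ENNReal.ofReal |LPu ρ m (LPv ρ n F) p|) p
  have hγ : γ ≤ α ∧ γ ≤ β ∧ γ ≤ α + β := by
    rcases hcase with ⟨h, h'⟩ | ⟨h, _⟩
    · have ha := h.trans (min_le_left _ _)
      have hb := h.trans (min_le_right _ _)
      refine ⟨ha, hb, ?_⟩
      by_cases h0 : 0 ≤ α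
      · linarith
      · linarith
    · have h2 := h.trans (min_le_right _ _)
      exact ⟨h.trans (min_le_left _ _), h2.trans (min_le_left _ _), h2.trans (min_le_right _ _)⟩
  have hHo : hNorm2 ρ α β F = ENNReal.ofReal H := (ENNReal.ofReal_toReal htop).symm
  rw [hHo, ← ENNReal.ofReal_mul (by positivity)]
  unfold hNorm
  refine iSup_le fun k => ?_
  rw [ENNReal.mul_iSup]
  refine iSup_le fun x => ?_
  rw [← ENNReal.ofReal_mul (by positivity)]
  refine ENNReal.ofReal_le_ofReal ?_
  set cond : ℕ → ℕ → Prop := fun m n =>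
    ((m + 10 ≤ n ∧ k ≤ n + 1 ∧ n ≤ k + 1) ∨ (n + 10 ≤ m ∧ k ≤ m + 1 ∧ m ≤ k + 1) ∨
      (0 < α + β ∧ m ≤ n + 9 ∧ n ≤ m + 9 ∧ k ≤ m + 10)) with hcond
  set a : ℕ → ℕ → ℝ := fun m n =>
    if cond m n then (2 : ℝ) ^ (γ * k - α * m - β * n) else 0 with ha
  have hsum := fun N => hS hγ.1 hγ.2.1 hγ.2.2 k N a
    (fun m n => by rw [ha]; dsimp only; split_ifs <;> positivity)
    (fun m n => by
      rw [ha]; dsimp only; split_ifs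
      · exact le_rfl
      · positivity)
    (fun m n h => by
      by_contra h2
      exact h (if_neg h2))
  set wk : ℝ := ((2 : ℝ) ^ k) ^ γ with hwk
  have wk0 : 0 < wk := by positivity
  have hterm : ∀ m n, |LP ρ k (fun z => LPu ρ m (LPv ρ n F) (z, z)) x| ≤
      A1 ρ * H / wk * a m n := by
    intro m n
    by_cases hc : cond m n
    · have e : a m n = wk * (((2 : ℝ) ^ m) ^ α * ((2 : ℝ) ^ n) ^ β)⁻¹ := by
        rw [ha]; dsimp only
        rw [if_pos hc, hwk, Real.rpow_sub (by norm_num), Real.rpow_sub (by norm_num)]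
        have e1 : ∀ (c : ℝ) (j : ℕ), (2 : ℝ) ^ (c * j) = ((2 : ℝ) ^ j) ^ c := by
          intro c j
          rw [mul_comm, Real.rpow_mul (by norm_num), Real.rpow_natCast]
        rw [e1, e1, e1]
        field_simp
      have hw : 0 < ((2 : ℝ) ^ m) ^ α * ((2 : ℝ) ^ n) ^ β := by positivity
      have hb : ∀ p, |LPu ρ m (LPv ρ n F) p| ≤ H / (((2 : ℝ) ^ m) ^ α * ((2 : ℝ) ^ n) ^ β) := by
        intro p
        rw [le_div_iff₀ hw, mul_comm]
        exact pw m n p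
      have := conv_bound _ (ker_int hρ k) _ _ (ker_norm hρ k)
        (fun y => LPu ρ m (LPv ρ n F) (x - y, x - y)) (by positivity) (fun y => hb _)
      refine this.trans (le_of_eq ?_)
      rw [e]; field_simp
    · have ez : a m n = 0 := if_neg hc
      rw [ez, mul_zero]
      refine le_of_eq ?_
      rw [abs_eq_zero]
      by_cases c1 : m + 10 ≤ n
      · exact trace_zero hρ hFc hB k m n (freq_low hρ k m n c1 (by
          by_contra h; apply hc; left; omega)) x
      by_cases c2 : n + 10 ≤ m
      · refine trace_zero hρ hFc hB k m n (fun ξ η h1 h2 => ?_) x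
        rw [add_comm]
        exact freq_low hρ k n m c2 (by by_contra h; apply hc; right; left; omega) η ξ h2 h1
      by_cases c3 : m + 11 ≤ k
      · exact trace_zero hρ hFc hB k m n (freq_diag hρ k m n (by omega) c3) x
      rcases hcase with ⟨_, h'⟩ | ⟨_, h'⟩
      · exact absurd (Or.inr (Or.inr ⟨h', by omega, by omega, by omega⟩)) hc
      · have := h' m n (dclose_of m n (by omega) (by omega))
        simp [LP, this]
  have hfin := LP_le_of_sum hρ hFc hB k x (A1 ρ * H / wk * S) (fun L => by
    calc _ ≤ ∑ m ∈ Finset.range (L + 1), ∑ n ∈ Finset.range (L + 1), A1 ρ * H / wk * a m n :=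
          Finset.sum_le_sum fun m _ => Finset.sum_le_sum fun n _ => hterm m n
      _ = A1 ρ * H / wk * ∑ m ∈ Finset.range (L + 1), ∑ n ∈ Finset.range (L + 1), a m n := by
          simp_rw [Finset.mul_sum]
      _ ≤ _ := mul_le_mul_of_nonneg_left (hsum _) (by positivity))
  have hpi : 1 ≤ 2 * π := by linarith [Real.pi_gt_three]
  have h1 : |LP ρ k (fun z => F (z, z)) x| ≤ A1 ρ * H / wk * S :=
    (le_mul_of_one_le_left (abs_nonneg _) hpi).trans hfin
  calc wk * |LP ρ k (fun z => F (z, z)) x| ≤ wk * (A1 ρ * H / wk * S) :=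
        mul_le_mul_of_nonneg_left h1 wk0.le
    _ = A1 ρ * S * H := by field_simp
    _ ≤ (A1 ρ * S + 1) * H := by nlinarith
end
end
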